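/- Consider critical Bernoulli bond percolation on Z² (edges independently open with probability 1/2). Assume μ[A_01(1,R)] > 0 for all integers R ≥ 2, and assume the limits α_1 := lim_{R→∞} (−log μ[A_1(1,R)] / log R), α_0 := lim_{R→∞} (−log μ[A_0(1,R)] / log R), and α_01 := lim_{R→∞} (−log μ[A_01(1,R)] / log R) all exist as real numbers. Then α_01 > α_0 + α_1. -/

import Mathlib

open MeasureTheory ENNReal

namespace FKArm

/-- Vertices of the square lattice `ℤ²`. -/
abbrev Vertex : Type := ℤ × ℤ

/-- Edges of `ℤ²`, parametrized by their lower-left endpoint and an orientation: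
`(v, false)` is the horizontal edge from `v` to `v + (1,0)`,
`(v, true)` is the vertical edge from `v` to `v + (0,1)`. -/
abbrev Edge : Type := Vertex × Bool

/-- Percolation configurations: an edge `e` is open iff `ω e = true`. -/
abbrev Config : Type := Edge → Bool

/-- The two endpoints of a (primal) edge. -/
def ends (e : Edge) : Vertex × Vertex :=
  (e.1, if e.2 then (e.1.1, e.1.2 + 1) else (e.1.1 + 1, e.1.2))

/-- The two endpoints of the dual edge crossing `e`. A dual vertex `u : ℤ × ℤ`
represents the point `u + (1/2, 1/2)` of the dual lattice. -/
def dualEnds (e : Edge) : Vertex × Vertex :=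
  if e.2 then ((e.1.1 - 1, e.1.2), e.1) else ((e.1.1, e.1.2 - 1), e.1)

/-- The `L∞` norm of a vertex of `ℤ²`. -/
def vnorm (x : Vertex) : ℤ := max |x.1| |x.2|

/-- Twice the `L∞` norm of the dual vertex `u + (1/2, 1/2)`. -/
def dnorm2 (u : Vertex) : ℤ := max |2 * u.1 + 1| |2 * u.2 + 1|

/-- `x` and `y` are joined by an open (primal) edge of `ω`. -/
def openAdj (ω : Config) (x y : Vertex) : Prop :=
  ∃ e : Edge, ω e = true ∧
    ((ends e).1 = x ∧ (ends e).2 = y ∨ (ends e).1 = y ∧ (ends e).2 = x)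

/-- Dual vertices `u` and `v` are joined by an open dual edge of `ω`
(the dual edge `e*` is open iff `e` is closed). -/
def dualAdj (ω : Config) (u v : Vertex) : Prop :=
  ∃ e : Edge, ω e = false ∧
    ((dualEnds e).1 = u ∧ (dualEnds e).2 = v ∨ (dualEnds e).1 = v ∧ (dualEnds e).2 = u)

/-- Connectivity by a path whose steps use the adjacency `adj` and all of whose
vertices lie in the set `S`. -/
def connIn (adj : Vertex → Vertex → Prop) (S : Set Vertex) (x y : Vertex) : Prop :=
  Relation.ReflTransGen (fun a b => adj a b ∧ a ∈ S ∧ b ∈ S) x y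

/-- The one-arm (primal) event: a path of open edges, staying in the annulus
`r ≤ ‖·‖∞ ≤ R`, joining a vertex of norm `r` to a vertex of norm `R`. -/
def A1 (r R : ℤ) : Set Config :=
  {ω | ∃ x y : Vertex, vnorm x = r ∧ vnorm y = R ∧
    connIn (openAdj ω) {z | r ≤ vnorm z ∧ vnorm z ≤ R} x y}

/-- The one-arm dual event: a path of open dual edges, staying in the annulus
`r - 1/2 ≤ ‖·‖∞ ≤ R + 1/2`, joining a dual vertex of norm `≤ r + 1/2` to a
dual vertex of norm `≥ R - 1/2`. (Norms of dual vertices are doubled.) -/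
def A0 (r R : ℤ) : Set Config :=
  {ω | ∃ u v : Vertex, dnorm2 u ≤ 2 * r + 1 ∧ 2 * R - 1 ≤ dnorm2 v ∧
    connIn (dualAdj ω) {w | 2 * r - 1 ≤ dnorm2 w ∧ dnorm2 w ≤ 2 * R + 1} u v}

/-- The alternating two-arm event. -/
def A01 (r R : ℤ) : Set Config := A0 r R ∩ A1 r R

/-- The critical/self-dual point `p_c(q) = √q / (1 + √q)`. -/
noncomputable def pc (q : ℝ) : ℝ := Real.sqrt q / (1 + Real.sqrt q)

/-- The configuration equal to `σ` on `F` and to `η` outside `F`. -/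
def combine (F : Finset Edge) (σ : {e // e ∈ F} → Bool) (η : {e // e ∉ F} → Bool) : Config :=
  fun e => if h : e ∈ F then σ ⟨e, h⟩ else η ⟨e, h⟩

/-- The restriction of a configuration to the complement of `F`. -/
def restrictOut (F : Finset Edge) (ω : Config) : {e // e ∉ F} → Bool := fun e => ω e.1

/-- The set of endpoints of edges of `F`. -/
def edgeVerts (F : Finset Edge) : Set Vertex := ⋃ e ∈ F, {(ends e).1, (ends e).2}

/-- Connectivity by a path of open edges of `ω` (anywhere in the lattice). -/
def conn (ω : Config) : Vertex → Vertex → Prop := Relation.ReflTransGen (openAdj ω)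

/-- `k(σ,η)`: the number of equivalence classes of the endpoints of edges of `F`
under the relation "joined by a path of open edges". Here applied to a full
configuration `ω`. -/
noncomputable def numClasses (F : Finset Edge) (ω : Config) : ℕ :=
  Set.ncard {C : Set Vertex | ∃ x ∈ edgeVerts F, C = {y ∈ edgeVerts F | conn ω x y}}

/-- `|σ|`: the number of open edges of `σ`. -/
noncomputable def numOpen (F : Finset Edge) (σ : {e // e ∈ F} → Bool) : ℕ :=
  Nat.card {e : {e // e ∈ F} // σ e = true}

/-- The weight `w(σ,η) = (p/(1-p))^{|σ|} · q^{k(σ,η)}` at `p = p_c(q)`. -/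
noncomputable def w (q : ℝ) (F : Finset Edge) (σ : {e // e ∈ F} → Bool)
    (η : {e // e ∉ F} → Bool) : ℝ :=
  (pc q / (1 - pc q)) ^ numOpen F σ * q ^ numClasses F (combine F σ η)

/-- A probability measure `φ` on configurations is a critical FK(q) Gibbs measure
if it satisfies the DLR equations with weights `w` for every finite set of edges. -/
def IsCriticalFK (q : ℝ) (φ : Measure Config) : Prop :=
  IsProbabilityMeasure φ ∧
  ∀ F : Finset Edge, ∀ f : Config → ℝ, Measurable f → (∃ M : ℝ, ∀ ω, |f ω| ≤ M) →
    ∫ ω, f ω ∂φ =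
      ∫ ω, (∑ σ : {e // e ∈ F} → Bool,
              w q F σ (restrictOut F ω) * f (combine F σ (restrictOut F ω))) /
            (∑ σ : {e // e ∈ F} → Bool, w q F σ (restrictOut F ω)) ∂φ

/-- `μ` is the law of i.i.d. Bernoulli(1/2) edge variables: critical Bernoulli
bond percolation on `ℤ²`. -/
def IsBernoulliHalf (μ : Measure Config) : Prop :=
  IsProbabilityMeasure μ ∧
  ∀ s : Finset Edge, ∀ b : Edge → Bool,
    μ {ω | ∀ e ∈ s, ω e = b e} = (1 / 2 : ℝ≥0∞) ^ s.card

end FKArm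

namespace FKArm

section Averaging

variable {ι κ : Type*}

/-- `f` does not depend on the coordinates in `F`. -/
def Inv (F : Set ι) (f : (ι → Bool) → ℝ) : Prop :=
  ∀ ω σ : ι → Bool, (∀ i ∉ F, ω i = σ i) → f ω = f σ

/-- `f` is nondecreasing in the coordinates in `F`. -/
def MonoOn (F : Set ι) (f : (ι → Bool) → ℝ) : Prop :=
  ∀ ω σ : ι → Bool, ω ≤ σ → (∀ i ∉ F, ω i = σ i) → f ω ≤ f σ

/-- `f` is nonincreasing in the coordinates in `F`. -/
def AntiOn (F : Set ι) (f : (ι → Bool) → ℝ) : Prop := MonoOn F (fun ω => -f ω)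

lemma Inv.mul {F : Set ι} {f g : (ι → Bool) → ℝ} (hf : Inv F f) (hg : Inv F g) :
    Inv F (fun ω => f ω * g ω) :=
  fun ω ω' h => by simp only [hf ω ω' h, hg ω ω' h]

lemma MonoOn.mono {F G : Set ι} {f : (ι → Bool) → ℝ} (h : MonoOn G f) (hFG : F ⊆ G) :
    MonoOn F f :=
  fun ω ω' hω hi => h ω ω' hω fun i hG => hi i fun hF => hG (hFG hF)

variable [DecidableEq ι] [DecidableEq κ]

/-- The average of `f` over all values of the coordinates in `F`, the others being frozen. -/
noncomputable def avg (F : Finset ι) (f : (ι → Bool) → ℝ) (ω : ι → Bool) : ℝ :=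
  (∑ s ∈ F.powerset, f (fun i => if i ∈ F then decide (i ∈ s) else ω i)) / 2 ^ F.card

lemma avg_empty (f : (ι → Bool) → ℝ) (ω : ι → Bool) : avg ∅ f ω = f ω := by
  simp [avg]

lemma avg_insert {F : Finset ι} {i : ι} (h : i ∉ F) (f : (ι → Bool) → ℝ) (ω : ι → Bool) :
    avg (insert i F) f ω =
      (avg F f (Function.update ω i true) + avg F f (Function.update ω i false)) / 2 := by
  unfold avg
  rw [Finset.sum_powerset_insert h, Finset.card_insert_of_notMem h, ← add_div, div_div,
    ← pow_succ, add_comm]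
  congr 2
  · refine Finset.sum_congr rfl fun s hs => ?_
    congr 1
    funext j
    by_cases hj : j = i
    · subst hj; simp [h]
    · simp [hj]
  · refine Finset.sum_congr rfl fun s hs => ?_
    have hi : i ∉ s := fun hi => h (Finset.mem_powerset.1 hs hi)
    congr 1
    funext j
    by_cases hj : j = i
    · subst hj; simp [h, hi]
    · simp [hj]

lemma avg_mono {F : Finset ι} {f g : (ι → Bool) → ℝ} (h : ∀ ω, f ω ≤ g ω) (ω : ι → Bool) :
    avg F f ω ≤ avg F g ω := by
  unfold avg
  gcongr
  exact h _

lemma avg_congr {F : Finset ι} {f g : (ι → Bool) → ℝ} {ω : ι → Bool}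
    (h : ∀ ω', (∀ i ∉ F, ω' i = ω i) → f ω' = g ω') : avg F f ω = avg F g ω := by
  unfold avg
  congr 1
  refine Finset.sum_congr rfl fun s _ => h _ fun i hi => by simp [hi]

lemma avg_mono' {F : Finset ι} {f g : (ι → Bool) → ℝ} {ω : ι → Bool}
    (h : ∀ ω', (∀ i ∉ F, ω' i = ω i) → f ω' ≤ g ω') : avg F f ω ≤ avg F g ω := by
  unfold avg
  gcongr
  exact h _ fun i hi => by simp [hi]

lemma avg_add (F : Finset ι) (f g : (ι → Bool) → ℝ) (ω : ι → Bool) :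
    avg F (fun ω => f ω + g ω) ω = avg F f ω + avg F g ω := by
  simp [avg, Finset.sum_add_distrib, add_div]

lemma avg_neg (F : Finset ι) (f : (ι → Bool) → ℝ) (ω : ι → Bool) :
    avg F (fun ω => -f ω) ω = -avg F f ω := by
  simp [avg, neg_div]

lemma avg_sub (F : Finset ι) (f g : (ι → Bool) → ℝ) (ω : ι → Bool) :
    avg F (fun ω => f ω - g ω) ω = avg F f ω - avg F g ω := by
  simp [avg, sub_div]

lemma avg_sum {α : Type*} (t : Finset α) (F : Finset ι) (f : α → (ι → Bool) → ℝ) (ω : ι → Bool) :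
    avg F (fun ω => ∑ a ∈ t, f a ω) ω = ∑ a ∈ t, avg F (f a) ω := by
  simp only [avg]
  rw [Finset.sum_comm, Finset.sum_div]

lemma avg_mul_left_of_inv {F : Finset ι} {f g : (ι → Bool) → ℝ} (hf : Inv (F : Set ι) f)
    (ω : ι → Bool) : avg F (fun ω => f ω * g ω) ω = f ω * avg F g ω := by
  unfold avg
  rw [mul_div_assoc', Finset.mul_sum]
  congr 1
  refine Finset.sum_congr rfl fun s _ => ?_
  beta_reduce
  rw [hf _ ω fun i hi => by simp at hi; simp [hi]]

lemma avg_const_mul (F : Finset ι) (c : ℝ) (f : (ι → Bool) → ℝ) (ω : ι → Bool) :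
    avg F (fun ω => c * f ω) ω = c * avg F f ω :=
  avg_mul_left_of_inv (f := fun _ => c) (fun _ _ _ => rfl) ω

lemma avg_const (F : Finset ι) (c : ℝ) (ω : ι → Bool) : avg F (fun _ => c) ω = c := by
  simp [avg, Finset.card_powerset]

lemma avg_of_inv {F : Finset ι} {f : (ι → Bool) → ℝ} (hf : Inv (F : Set ι) f)
    (ω : ι → Bool) : avg F f ω = f ω := by
  simpa [avg_const] using avg_mul_left_of_inv (g := fun _ => 1) hf ω

lemma avg_nonneg {F : Finset ι} {f : (ι → Bool) → ℝ} (h : ∀ ω, 0 ≤ f ω) (ω : ι → Bool) :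
    0 ≤ avg F f ω := by
  simpa [avg_const] using avg_mono (F := F) (f := fun _ => 0) h ω

lemma inv_avg (F : Finset ι) (f : (ι → Bool) → ℝ) : Inv (F : Set ι) (avg F f) := by
  intro ω ω' h
  unfold avg
  congr 1
  refine Finset.sum_congr rfl fun s _ => ?_
  congr 1
  funext i
  split_ifs with hi
  · rfl
  · exact h i (by simpa using hi)

lemma Inv.avg {F : Set ι} {G : Finset ι} {f : (ι → Bool) → ℝ} (hf : Inv F f) :
    Inv F (avg G f) := by
  intro ω ω' h
  unfold FKArm.avg
  congr 1
  refine Finset.sum_congr rfl fun s _ => hf _ _ fun i hi => ?_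
  simp [h i hi]

lemma avg_union {F G : Finset ι} (h : Disjoint F G) (f : (ι → Bool) → ℝ) (ω : ι → Bool) :
    avg (F ∪ G) f ω = avg F (avg G f) ω := by
  induction F using Finset.induction_on generalizing ω with
  | empty => simp [avg_empty]
  | insert i F hi ih =>
    rw [Finset.disjoint_insert_left] at h
    rw [Finset.insert_union, avg_insert (by simp [hi, h.1]), avg_insert hi, ih h.2, ih h.2]

lemma avg_union' {F G : Finset ι} (h : Disjoint F G) (f : (ι → Bool) → ℝ) (ω : ι → Bool) :
    avg (F ∪ G) f ω = avg G (avg F f) ω := by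
  rw [Finset.union_comm, avg_union h.symm]

/-- Averaging over more coordinates than `f` depends on changes nothing. -/
lemma avg_eq_of_subset {F G : Finset ι} (hFG : F ⊆ G) {f : (ι → Bool) → ℝ}
    (hf : Inv ((G \ F : Finset ι) : Set ι) f) (ω : ι → Bool) : avg G f ω = avg F f ω := by
  conv_lhs => rw [← Finset.union_sdiff_of_subset hFG]
  rw [avg_union Finset.disjoint_sdiff]
  congr 1
  exact funext (avg_of_inv hf)

/-- The average of a product of functions of disjoint sets of coordinates. -/
lemma avg_mul_of_disjoint {F G : Finset ι} (h : Disjoint F G) {f g : (ι → Bool) → ℝ}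
    (hf : Inv (G : Set ι) f) (hg : Inv (F : Set ι) g) (ω : ι → Bool) :
    avg (F ∪ G) (fun ω => f ω * g ω) ω = avg (F ∪ G) f ω * avg (F ∪ G) g ω := by
  rw [avg_union h, avg_union h, avg_union' h]
  have h1 : avg G (fun ω => f ω * g ω) = fun ω => avg G g ω * f ω := by
    funext ω'
    rw [avg_mul_left_of_inv hf, mul_comm]
  rw [h1, avg_mul_left_of_inv hg.avg]
  have h2 : avg G f = f := funext fun ω' => avg_of_inv hf ω'
  have h3 : avg F g = g := funext fun ω' => avg_of_inv hg ω'
  rw [h2, h3, mul_comm]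

lemma MonoOn.avg_le {F : Finset ι} {S : Set ι} {f : (ι → Bool) → ℝ} (hf : MonoOn S f)
    {ω ω' : ι → Bool} (h : ω ≤ ω') (hS : ∀ i ∉ S, ω i = ω' i) : avg F f ω ≤ avg F f ω' := by
  unfold avg
  gcongr with s _
  refine hf _ _ (fun i => ?_) fun i hi => ?_
  · by_cases hi : i ∈ F
    · simp [hi]
    · simpa [hi] using h i
  · simp [hS i hi]

/-- Harris' inequality. -/
lemma avg_mul_ge {F : Finset ι} {f g : (ι → Bool) → ℝ} (hf : MonoOn (F : Set ι) f)
    (hg : MonoOn (F : Set ι) g) (ω : ι → Bool) :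
    avg F f ω * avg F g ω ≤ avg F (fun ω => f ω * g ω) ω := by
  induction F using Finset.induction_on generalizing ω with
  | empty => simp [avg_empty]
  | insert i F hi ih =>
    have hup : Function.update ω i false ≤ Function.update ω i true := by
      intro j
      by_cases hj : j = i
      · subst hj; simp
      · simp [hj]
    have hoff : ∀ j ∉ ((insert i F : Finset ι) : Set ι),
        Function.update ω i false j = Function.update ω i true j := by
      intro j hj
      have : j ≠ i := fun h => hj (by simp [h])
      simp [this]
    have hsub : (F : Set ι) ⊆ ((insert i F : Finset ι) : Set ι) := by simp
    have h1 := ih (hf.mono hsub) (hg.mono hsub) (Function.update ω i true)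
    have h2 := ih (hf.mono hsub) (hg.mono hsub) (Function.update ω i false)
    have h3 : avg F f _ ≤ avg F f _ := hf.avg_le hup hoff
    have h4 : avg F g _ ≤ avg F g _ := hg.avg_le hup hoff
    rw [avg_insert hi, avg_insert hi, avg_insert hi]
    nlinarith [mul_nonneg (sub_nonneg.2 h3) (sub_nonneg.2 h4)]

lemma avg_mul_ge_of_anti {F : Finset ι} {f g : (ι → Bool) → ℝ} (hf : AntiOn (F : Set ι) f)
    (hg : AntiOn (F : Set ι) g) (ω : ι → Bool) :
    avg F f ω * avg F g ω ≤ avg F (fun ω => f ω * g ω) ω := by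
  have := avg_mul_ge hf hg ω
  simpa [avg_neg] using this

lemma avg_mul_le {F : Finset ι} {f g : (ι → Bool) → ℝ} (hf : MonoOn (F : Set ι) f)
    (hg : AntiOn (F : Set ι) g) (ω : ι → Bool) :
    avg F (fun ω => f ω * g ω) ω ≤ avg F f ω * avg F g ω := by
  have := avg_mul_ge hf hg ω
  simp only [mul_neg, avg_neg] at this
  linarith

/-- Averages are compatible with injective relabelling of the coordinates. -/
lemma avg_comp {j : κ → ι} (hj : Function.Injective j) (F : Finset ι) (f : (κ → Bool) → ℝ)
    (ω : ι → Bool) :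
    avg F (fun ω => f (ω ∘ j)) ω = avg (F.preimage j hj.injOn) f (ω ∘ j) := by
  induction F using Finset.induction_on generalizing ω with
  | empty => simp [avg_empty]
  | insert i F hi ih =>
    rw [avg_insert hi, ih, ih]
    by_cases h : ∃ k, j k = i
    · obtain ⟨k, rfl⟩ := h
      have : (insert (j k) F).preimage j hj.injOn = insert k (F.preimage j hj.injOn) := by
        ext k'; simp [hj.eq_iff]
      rw [this, avg_insert (by simpa using hi), Function.update_comp_eq_of_injective _ hj,
        Function.update_comp_eq_of_injective _ hj]
    · have hne : ∀ k, j k ≠ i := fun k hk => h ⟨k, hk⟩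
      have : (insert i F).preimage j hj.injOn = F.preimage j hj.injOn := by
        ext k'; simp [hne]
      rw [this, Function.update_comp_eq_of_notMem_range _ _ (by simpa using h),
        Function.update_comp_eq_of_notMem_range _ _ (by simpa using h)]
      ring

/-- Averages are compatible with flipping all coordinates. -/
lemma avg_not (F : Finset ι) (f : (ι → Bool) → ℝ) (ω : ι → Bool) :
    avg F (fun ω => f (fun i => !ω i)) ω = avg F f (fun i => !ω i) := by
  induction F using Finset.induction_on generalizing ω with
  | empty => simp [avg_empty]
  | insert i F hi ih =>
    have h : ∀ b, (fun k => !Function.update ω i b k) =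
        Function.update (fun k => !ω k) i (!b) := by
      intro b
      funext k
      by_cases hk : k = i
      · subst hk; simp
      · simp [hk]
    rw [avg_insert hi, avg_insert hi, ih, ih, h, h, add_comm]
    simp

end Averaging

section Paths

/-- `x` and `y` are joined by an `η`-open path in `S` (in particular, both lie in `S`). -/
def Con (η : Config) (S : Set Vertex) (x y : Vertex) : Prop :=
  x ∈ S ∧ connIn (openAdj η) S x y

lemma openAdj_symm {η : Config} {x y : Vertex} (h : openAdj η x y) : openAdj η y x := by
  obtain ⟨e, he, h⟩ := h
  exact ⟨e, he, h.symm⟩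

lemma openAdj_iff {η : Config} {x y : Vertex} : openAdj η x y ↔
    (η (x, false) = true ∧ y = (x.1 + 1, x.2)) ∨ (η (x, true) = true ∧ y = (x.1, x.2 + 1)) ∨
    (η (y, false) = true ∧ x = (y.1 + 1, y.2)) ∨ (η (y, true) = true ∧ x = (y.1, y.2 + 1)) := by
  constructor
  · rintro ⟨⟨v, b⟩, he, ⟨rfl, rfl⟩ | ⟨rfl, rfl⟩⟩ <;> cases b <;> simp_all [ends]
  · rintro (⟨h, rfl⟩ | ⟨h, rfl⟩ | ⟨h, rfl⟩ | ⟨h, rfl⟩)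
    exacts [⟨_, h, by simp [ends]⟩, ⟨_, h, by simp [ends]⟩, ⟨_, h, by simp [ends]⟩,
      ⟨_, h, by simp [ends]⟩]

lemma openAdj_right {η : Config} {x : Vertex} (h : η (x, false) = true) :
    openAdj η x (x.1 + 1, x.2) := openAdj_iff.2 (.inl ⟨h, rfl⟩)

lemma openAdj_up {η : Config} {x : Vertex} (h : η (x, true) = true) :
    openAdj η x (x.1, x.2 + 1) := openAdj_iff.2 (.inr (.inl ⟨h, rfl⟩))

/-- Case analysis on an open edge, up to orientation. -/
lemma openAdj_cases {η : Config} {r : Vertex → Vertex → Prop} (hr : ∀ x y, r x y → r y x)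
    (h1 : ∀ x, η (x, false) = true → r x (x.1 + 1, x.2))
    (h2 : ∀ x, η (x, true) = true → r x (x.1, x.2 + 1)) {x y : Vertex} (h : openAdj η x y) :
    r x y := by
  rw [openAdj_iff] at h
  rcases h with ⟨h, rfl⟩ | ⟨h, rfl⟩ | ⟨h, rfl⟩ | ⟨h, rfl⟩
  exacts [h1 _ h, h2 _ h, hr _ _ (h1 _ h), hr _ _ (h2 _ h)]

variable {η η' : Config} {S S' : Set Vertex} {x y z : Vertex}

lemma Con.left_mem (h : Con η S x y) : x ∈ S := h.1

lemma Con.refl (h : x ∈ S) : Con η S x x := ⟨h, .refl⟩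

lemma Con.tail (h : Con η S x y) (h' : openAdj η y z) (hy : y ∈ S) (hz : z ∈ S) : Con η S x z :=
  ⟨h.1, h.2.tail ⟨h', hy, hz⟩⟩

@[elab_as_elim]
lemma Con.induct {p : Vertex → Prop} (h : Con η S x y) (h0 : p x)
    (hs : ∀ y z, Con η S x y → y ∈ S → z ∈ S → openAdj η y z → p y → p z) : p y := by
  obtain ⟨hx, h⟩ := h
  induction h with
  | refl => exact h0
  | tail hab hbc ih => exact hs _ _ ⟨hx, hab⟩ hbc.2.1 hbc.2.2 hbc.1 ih

lemma Con.right_mem (h : Con η S x y) : y ∈ S :=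
  h.induct h.1 fun _ _ _ _ hz _ _ => hz

lemma Con.step (h : openAdj η x y) (hx : x ∈ S) (hy : y ∈ S) : Con η S x y :=
  (Con.refl hx).tail h hx hy

lemma Con.trans (h : Con η S x y) (h' : Con η S y z) : Con η S x z :=
  ⟨h.1, h.2.trans h'.2⟩

lemma Con.symm (h : Con η S x y) : Con η S y x :=
  h.induct (p := fun y => Con η S y x) (Con.refl h.1) fun _ _ _ hy hz ha ih =>
    (Con.step (openAdj_symm ha) hz hy).trans ih

/-- Connections are monotone; only edges with both ends in the set matter. -/
lemma Con.mono' (h : Con η S x y) (hS : S ⊆ S')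
    (hη : ∀ a ∈ S, ∀ b ∈ S, openAdj η a b → openAdj η' a b) : Con η' S' x y :=
  h.induct (p := fun y => Con η' S' x y) (Con.refl (hS h.1)) fun _ _ _ hy hz ha ih =>
    ih.tail (hη _ hy _ hz ha) (hS hy) (hS hz)

lemma Con.mono_set (h : Con η S x y) (hS : S ⊆ S') : Con η S' x y :=
  h.mono' hS fun _ _ _ _ h => h

lemma Con.mono (h : Con η S x y) (hS : S ⊆ S')
    (hη : ∀ e : Edge, (ends e).1 ∈ S → (ends e).2 ∈ S → η e = true → η' e = true) :
    Con η' S' x y := by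
  refine h.mono' hS ?_
  rintro a ha b hb ⟨e, he, ⟨rfl, rfl⟩ | ⟨rfl, rfl⟩⟩
  exacts [⟨e, hη e ha hb he, by simp⟩, ⟨e, hη e hb ha he, by simp⟩]

/-- The lattice in which all edges are open. -/
def full : Config := fun _ => true

lemma Con.full (h : Con η S x y) : Con full S x y :=
  h.mono le_rfl fun _ _ _ _ => rfl

/-- The connection takes place inside any set that it cannot leave. -/
lemma Con.restrict (h : Con η S x y) (hx : x ∈ S')
    (hS : ∀ a b, a ∈ S → b ∈ S → a ∈ S' → openAdj η a b → b ∈ S') : Con η (S ∩ S') x y :=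
  h.induct (p := fun y => Con η (S ∩ S') x y) (Con.refl ⟨h.1, hx⟩) fun _ _ _ hy hz ha ih =>
    ih.tail ha ⟨hy, ih.right_mem.2⟩ ⟨hz, hS _ _ hy hz ih.right_mem.2 ha⟩

/-- A path from outside `Z` to `Z` has a first entrance edge. -/
lemma Con.first_entry {Z : Set Vertex} (h : Con η S x y) (hx : x ∉ Z) (hy : y ∈ Z) :
    ∃ v w, Con η (S \ Z) x v ∧ openAdj η v w ∧ w ∈ Z ∧ w ∈ S := by
  by_contra hcon
  push Not at hcon
  have : Con η (S \ Z) x y :=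
    h.induct (p := fun y => Con η (S \ Z) x y) (Con.refl ⟨h.1, hx⟩) fun b c _ hb hc ha ih => by
      refine ih.tail ha ih.right_mem ⟨hc, fun hcZ => hcon b c ih ha hcZ hc⟩
  exact this.right_mem.2 hy

/-- A path from `Z₁` to `Z₂` contains a path between neighbours of `Z₁` and `Z₂`,
outside `Z₁ ∪ Z₂`. -/
lemma Con.extract {Z₁ Z₂ : Set Vertex} (h : Con η S x y) (hx : x ∈ Z₁) (hy : y ∈ Z₂)
    (hd : ∀ z ∈ Z₁, z ∉ Z₂) (hadj : ∀ a ∈ Z₁, ∀ b ∈ Z₂, ¬ openAdj η a b) :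
    ∃ v v' w w', Con η (S \ (Z₁ ∪ Z₂)) v v' ∧ openAdj η w v ∧ w ∈ Z₁ ∧ w ∈ S ∧
      openAdj η v' w' ∧ w' ∈ Z₂ ∧ w' ∈ S := by
  obtain ⟨v', w', h1, h2, h3, h4⟩ := h.first_entry (hd x hx) hy
  have hv' : v' ∉ Z₁ := fun hv => hadj v' hv w' h3 h2
  obtain ⟨v, w, h5, h6, h7, h8⟩ := h1.symm.first_entry hv' hx
  refine ⟨v, v', w, w', h5.symm.mono_set ?_, openAdj_symm h6, h7, h8.1, h2, h3, h4⟩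
  rintro z ⟨⟨hz1, hz2⟩, hz3⟩
  exact ⟨hz1, fun hz => hz.elim hz3 hz2⟩

/-- The rectangle `[a,b] × [c,d]`. -/
def Box (a b c d : ℤ) : Set Vertex := {z | a ≤ z.1 ∧ z.1 ≤ b ∧ c ≤ z.2 ∧ z.2 ≤ d}

lemma mem_Box {a b c d : ℤ} : z ∈ Box a b c d ↔ a ≤ z.1 ∧ z.1 ≤ b ∧ c ≤ z.2 ∧ z.2 ≤ d := Iff.rfl

/-- Horizontal crossing of a rectangle. -/
def HC (η : Config) (a b c d : ℤ) : Prop :=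
  ∃ x y : Vertex, x.1 = a ∧ y.1 = b ∧ Con η (Box a b c d) x y

/-- Vertical crossing of a rectangle. -/
def VC (η : Config) (a b c d : ℤ) : Prop :=
  ∃ x y : Vertex, x.2 = c ∧ y.2 = d ∧ Con η (Box a b c d) x y

end Paths

section Symmetries

/-- A symmetry of the lattice: a bijection of the vertices with a compatible map on edges. -/
structure LatticeSym where
  /-- the action on vertices -/
  g : Vertex ≃ Vertex
  /-- the action on edges -/
  j : Edge → Edge
  inj : Function.Injective j
  adj : ∀ (η : Config) x y, openAdj (η ∘ j) x y ↔ openAdj η (g x) (g y)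

lemma LatticeSym.con (σ : LatticeSym) {η : Config} {S : Set Vertex} {x y : Vertex} :
    Con (η ∘ σ.j) (σ.g ⁻¹' S) x y ↔ Con η S (σ.g x) (σ.g y) := by
  constructor
  · intro h
    exact h.induct (p := fun y => Con η S (σ.g x) (σ.g y)) (Con.refl h.1)
      fun _ _ _ hy hz ha ih => ih.tail ((σ.adj _ _ _).1 ha) hy hz
  · intro h
    have := h.induct (p := fun y => Con (η ∘ σ.j) (σ.g ⁻¹' S) x (σ.g.symm y)) ?_ ?_
    · simpa using this
    · rw [Equiv.symm_apply_apply]; exact Con.refl h.1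
    · intro y z _ hy hz ha ih
      exact ih.tail ((σ.adj _ _ _).2 (by simpa using ha)) (by simpa using hy) (by simpa using hz)

lemma LatticeSym.con' (σ : LatticeSym) {η : Config} {S S' : Set Vertex} {x y x' y' : Vertex}
    (hS : ∀ z, z ∈ S' ↔ σ.g z ∈ S) (hx : x = σ.g x') (hy : y = σ.g y') :
    Con η S x y ↔ Con (η ∘ σ.j) S' x' y' := by
  subst hx hy
  have : S' = σ.g ⁻¹' S := Set.ext hS
  rw [this, σ.con]

/-- The transposition `(x, y) ↦ (y, x)`. -/
def transp : LatticeSym where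
  g := Equiv.prodComm ℤ ℤ
  j := fun e => ((e.1.2, e.1.1), !e.2)
  inj := by rintro ⟨⟨a, b⟩, c⟩ ⟨⟨a', b'⟩, c'⟩ h; simp_all
  adj := by
    rintro η ⟨a, b⟩ ⟨c, d⟩
    simp [openAdj_iff]
    tauto

/-- The translation by `t`. -/
def transl (t : Vertex) : LatticeSym where
  g := Equiv.addRight t
  j := fun e => (e.1 + t, e.2)
  inj := by rintro ⟨⟨a, b⟩, c⟩ ⟨⟨a', b'⟩, c'⟩ h; simp_all
  adj := by
    obtain ⟨p, q⟩ := t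
    rintro η ⟨a, b⟩ ⟨c, d⟩
    have h1 : ∀ u v w : ℤ, u + w = v + w + 1 ↔ u = v + 1 := by intros; omega
    simp [openAdj_iff, h1]

/-- The reflection `(x, y) ↦ (m - x, y)`. -/
def reflX (m : ℤ) : LatticeSym where
  g := ⟨fun v => (m - v.1, v.2), fun v => (m - v.1, v.2), fun v => by simp, fun v => by simp⟩
  j := fun e => ((if e.2 then m - e.1.1 else m - e.1.1 - 1, e.1.2), e.2)
  inj := by rintro ⟨⟨a, b⟩, _ | _⟩ ⟨⟨a', b'⟩, _ | _⟩ h <;> simp_all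
  adj := by
    rintro η ⟨a, b⟩ ⟨c, d⟩
    simp only [openAdj_iff, Function.comp_apply, Equiv.coe_fn_mk, Prod.mk.injEq, reduceIte,
      Bool.false_eq_true]
    have h1 : c = a + 1 ∧ d = b → m - a - 1 = m - c := by omega
    have h2 : a = c + 1 ∧ b = d → m - c - 1 = m - a := by omega
    constructor
    · rintro (⟨h, hh⟩ | ⟨h, hh⟩ | ⟨h, hh⟩ | ⟨h, hh⟩)
      · refine .inr (.inr (.inl ⟨?_, ?_, hh.2.symm⟩))
        · rwa [← h1 hh, hh.2]
        · omega
      · exact .inr (.inl ⟨h, by omega, hh.2⟩)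
      · refine .inl ⟨?_, ?_, hh.2.symm⟩
        · rwa [← h2 hh, hh.2]
        · omega
      · exact .inr (.inr (.inr ⟨h, by omega, hh.2⟩))
    · rintro (⟨h, hh⟩ | ⟨h, hh⟩ | ⟨h, hh⟩ | ⟨h, hh⟩)
      · refine .inr (.inr (.inl ⟨?_, ?_, hh.2.symm⟩))
        · rwa [h2 ⟨by omega, hh.2.symm⟩, hh.2]
        · omega
      · exact .inr (.inl ⟨h, by omega, hh.2⟩)
      · refine .inl ⟨?_, ?_, hh.2.symm⟩
        · rwa [h1 ⟨by omega, hh.2.symm⟩, hh.2]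
        · omega
      · exact .inr (.inr (.inr ⟨h, by omega, hh.2⟩))

/-- The planar dual configuration: `w` stands for the face with lower left corner `w`. -/
def star (ω : Config) : Config :=
  fun e => !ω (if e.2 then ((e.1.1, e.1.2 + 1), false) else ((e.1.1 + 1, e.1.2), true))

@[simp] lemma star_false (ω : Config) (w : Vertex) :
    star ω (w, false) = !ω ((w.1 + 1, w.2), true) := rfl

@[simp] lemma star_true (ω : Config) (w : Vertex) :
    star ω (w, true) = !ω ((w.1, w.2 + 1), false) := rfl

lemma dualAdj_eq_star (ω : Config) : dualAdj ω = openAdj (star ω) := by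
  funext ⟨a, b⟩ ⟨c, d⟩
  apply propext
  rw [openAdj_iff]
  constructor
  · rintro ⟨⟨v, _ | _⟩, he, ⟨h1, h2⟩ | ⟨h1, h2⟩⟩ <;> simp [dualEnds] at h1 h2 <;> simp [h2] at he h1
    · exact .inr (.inl ⟨by simp [← h1.1, ← h1.2, he], by simp [← h1.1, ← h1.2]⟩)
    · exact .inr (.inr (.inr ⟨by simp [← h1.1, ← h1.2, he], by simp [← h1.1, ← h1.2]⟩))
    · exact .inl ⟨by simp [← h1.1, ← h1.2, he], by simp [← h1.1, ← h1.2]⟩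
    · exact .inr (.inr (.inl ⟨by simp [← h1.1, ← h1.2, he], by simp [← h1.1, ← h1.2]⟩))
  · rintro (⟨h, h'⟩ | ⟨h, h'⟩ | ⟨h, h'⟩ | ⟨h, h'⟩) <;> simp at h h'
    · exact ⟨((a + 1, b), true), h, by simp [dualEnds, h']⟩
    · exact ⟨((a, b + 1), false), h, by simp [dualEnds, h']⟩
    · exact ⟨((c + 1, d), true), h, by simp [dualEnds, h']⟩
    · exact ⟨((c, d + 1), false), h, by simp [dualEnds, h']⟩

lemma star_star (ω : Config) : star (star ω) = ω ∘ (transl (1, 1)).j := by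
  funext ⟨⟨a, b⟩, c⟩
  cases c <;> simp [star, transl]

lemma star_comp_transp (ω : Config) : star (ω ∘ transp.j) = star ω ∘ transp.j := by
  funext ⟨⟨a, b⟩, c⟩
  cases c <;> simp [star, transp]

lemma star_comp_reflX (ω : Config) (m : ℤ) :
    star (ω ∘ (reflX m).j) = star ω ∘ (reflX (m - 1)).j := by
  funext ⟨⟨a, b⟩, c⟩
  cases c <;> simp [star, reflX] <;> ring_nf

lemma star_anti {ω ω' : Config} (h : ω ≤ ω') : star ω' ≤ star ω := by
  intro e
  have := h (if e.2 then ((e.1.1, e.1.2 + 1), false) else ((e.1.1 + 1, e.1.2), true))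
  revert this
  unfold star
  generalize ω _ = a
  generalize ω' _ = b
  cases a <;> cases b <;> simp

/-- Parity of the number of crossings of a dual path with leftward rays. -/
lemma exists_ray_parity {ω : Config} {Q : Set Vertex} {u u' : Vertex} (h : Con (star ω) Q u u') :
    ∃ s : Vertex → Bool,
      (∀ v : Vertex, ω (v, false) = true → s (v.1 + 1, v.2) = s v) ∧
      (∀ v : Vertex, ω (v, true) = true → s (v.1, v.2 + 1) =
        (s v ^^ (decide (u.2 = v.2 ∧ u.1 < v.1) ^^ decide (u'.2 = v.2 ∧ u'.1 < v.1)))) ∧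
      (∀ v : Vertex, (∀ w ∈ Q, v.1 ≤ w.1) → s v = false) ∧
      (∀ v : Vertex, (∀ w ∈ Q, w.1 < v.1) →
        s v = (decide (v.2 ≤ u.2) ^^ decide (v.2 ≤ u'.2))) := by
  refine h.induct (p := fun u' => ∃ s : Vertex → Bool,
      (∀ v : Vertex, ω (v, false) = true → s (v.1 + 1, v.2) = s v) ∧
      (∀ v : Vertex, ω (v, true) = true → s (v.1, v.2 + 1) =
        (s v ^^ (decide (u.2 = v.2 ∧ u.1 < v.1) ^^ decide (u'.2 = v.2 ∧ u'.1 < v.1)))) ∧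
      (∀ v : Vertex, (∀ w ∈ Q, v.1 ≤ w.1) → s v = false) ∧
      (∀ v : Vertex, (∀ w ∈ Q, w.1 < v.1) →
        s v = (decide (v.2 ≤ u.2) ^^ decide (v.2 ≤ u'.2)))) ?_ ?_
  · exact ⟨fun _ => false, by simp, by simp, by simp, by simp⟩
  · rintro y z _ hy hz ha ⟨s, h1, h2, h3, h4⟩
    rw [openAdj_iff] at ha
    simp only [star_false, star_true, Bool.not_eq_true'] at ha
    rcases ha with ⟨ha, rfl⟩ | ⟨ha, rfl⟩ | ⟨ha, rfl⟩ | ⟨ha, rfl⟩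
    · refine ⟨s, h1, fun v hv => ?_, h3, fun v hv => ?_⟩
      · have : v ≠ (y.1 + 1, y.2) := by rintro rfl; simp_all
        have : (y.2 = v.2 ∧ y.1 < v.1) ↔ (y.2 = v.2 ∧ y.1 + 1 < v.1) := by
          rw [Ne, Prod.ext_iff] at this; simp only at this; omega
        simp [h2 v hv, this]
      · simp [h4 v hv]
    · refine ⟨fun v => s v ^^ decide (v.2 = y.2 + 1 ∧ y.1 < v.1), fun v hv => ?_, fun v hv => ?_,
        fun v hv => ?_, fun v hv => ?_⟩
      · have : v ≠ (y.1, y.2 + 1) := by rintro rfl; simp_all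
        have : (v.2 = y.2 + 1 ∧ y.1 < v.1 + 1) ↔ (v.2 = y.2 + 1 ∧ y.1 < v.1) := by
          rw [Ne, Prod.ext_iff] at this; simp only at this; omega
        simp only [h1 v hv, this]
      · have e1 : (v.2 + 1 = y.2 + 1 ∧ y.1 < v.1) ↔ (y.2 = v.2 ∧ y.1 < v.1) := by omega
        have e2 : (v.2 = y.2 + 1 ∧ y.1 < v.1) ↔ (y.2 + 1 = v.2 ∧ y.1 < v.1) := by omega
        simp only [h2 v hv, e1, e2]
        generalize s v = a, decide (u.2 = v.2 ∧ u.1 < v.1) = b, decide (y.2 = v.2 ∧ y.1 < v.1) = c,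
          decide (y.2 + 1 = v.2 ∧ y.1 < v.1) = d
        cases a <;> cases b <;> cases c <;> cases d <;> rfl
      · have := hv y hy
        simp [h3 v hv, not_lt.2 this]
      · have := hv y hy
        simp only [h4 v hv, this, and_true]
        by_cases h5 : v.2 ≤ y.2
        · have : v.2 ≠ y.2 + 1 := by omega
          have h6 : v.2 ≤ y.2 + 1 := by omega
          simp [h5, this, h6]
        · by_cases h6 : v.2 ≤ y.2 + 1
          · have : v.2 = y.2 + 1 := by omega
            simp [this]
          · have : v.2 ≠ y.2 + 1 := by omega
            simp [h5, this, h6]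
    · refine ⟨s, h1, fun v hv => ?_, h3, fun v hv => ?_⟩
      · have : v ≠ (z.1 + 1, z.2) := by rintro rfl; simp_all
        have : (z.2 = v.2 ∧ z.1 < v.1) ↔ (z.2 = v.2 ∧ z.1 + 1 < v.1) := by
          rw [Ne, Prod.ext_iff] at this; simp only at this; omega
        simp [h2 v hv, this]
      · simp [h4 v hv]
    · refine ⟨fun v => s v ^^ decide (v.2 = z.2 + 1 ∧ z.1 < v.1), fun v hv => ?_, fun v hv => ?_,
        fun v hv => ?_, fun v hv => ?_⟩
      · have : v ≠ (z.1, z.2 + 1) := by rintro rfl; simp_all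
        have : (v.2 = z.2 + 1 ∧ z.1 < v.1 + 1) ↔ (v.2 = z.2 + 1 ∧ z.1 < v.1) := by
          rw [Ne, Prod.ext_iff] at this; simp only at this; omega
        simp only [h1 v hv, this]
      · have e1 : (v.2 + 1 = z.2 + 1 ∧ z.1 < v.1) ↔ (z.2 = v.2 ∧ z.1 < v.1) := by omega
        have e2 : (v.2 = z.2 + 1 ∧ z.1 < v.1) ↔ (z.2 + 1 = v.2 ∧ z.1 < v.1) := by omega
        simp only [h2 v hv, e1, e2]
        generalize s v = a, decide (u.2 = v.2 ∧ u.1 < v.1) = b, decide (z.2 = v.2 ∧ z.1 < v.1) = c,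
          decide (z.2 + 1 = v.2 ∧ z.1 < v.1) = d
        cases a <;> cases b <;> cases c <;> cases d <;> rfl
      · have := hv z hz
        simp [h3 v hv, not_lt.2 this]
      · have := hv z hz
        simp only [h4 v hv, this, and_true]
        by_cases h5 : v.2 ≤ z.2
        · have : v.2 ≠ z.2 + 1 := by omega
          have h6 : v.2 ≤ z.2 + 1 := by omega
          simp [h5, this, h6]
        · by_cases h6 : v.2 ≤ z.2 + 1
          · have : v.2 = z.2 + 1 := by omega
            simp [this]
          · have : v.2 ≠ z.2 + 1 := by omega
            simp [h5, this, h6]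

/-- A horizontal primal crossing and a vertical dual crossing cannot coexist. -/
lemma not_hcross_vcross {ω : Config} {P Q : Set Vertex} {x y u u' : Vertex} {a b c d : ℤ}
    (hp : Con ω P x y) (hq : Con (star ω) Q u u') (hP : ∀ z ∈ P, c ≤ z.2 ∧ z.2 ≤ d)
    (hQ : ∀ z ∈ Q, a ≤ z.1 ∧ z.1 + 1 ≤ b) (hx : x.1 ≤ a) (hy : b ≤ y.1)
    (hu : u.2 + 1 ≤ c) (hu' : d ≤ u'.2) : False := by
  obtain ⟨s, h1, h2, h3, h4⟩ := exists_ray_parity hq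
  have key : ∀ v w, v ∈ P → w ∈ P → openAdj ω v w → s v = s w := by
    intro v w hv hw h
    refine openAdj_cases (r := fun v w => v ∈ P → w ∈ P → s v = s w)
      (fun v w h hw hv => (h hv hw).symm) ?_ ?_ h hv hw
    · intro v hv _ _
      exact (h1 v hv).symm
    · intro v hv hvP hwP
      have e1 : ¬ (u.2 = v.2 ∧ u.1 < v.1) := by have := hP v hvP; omega
      have e2 : ¬ (u'.2 = v.2 ∧ u'.1 < v.1) := by have := hP _ hwP; simp only at this; omega
      simp [h2 v hv, e1, e2]
  have hs : s y = s x := hp.induct (p := fun y => s y = s x) rfl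
    fun y z _ hy hz ha ih => (key _ _ hy hz ha).symm.trans ih
  rw [h3 x fun w hw => hx.trans (hQ w hw).1, h4 y fun w hw => by have := hQ w hw; omega] at hs
  have := hP y hp.right_mem
  have e1 : ¬ y.2 ≤ u.2 := by omega
  have e2 : y.2 ≤ u'.2 := by omega
  simp [e1, e2] at hs

/-- A vertical primal crossing and a horizontal dual crossing cannot coexist. -/
lemma not_vcross_hcross {ω : Config} {P Q : Set Vertex} {x y u u' : Vertex} {a b c d : ℤ}
    (hp : Con ω P x y) (hq : Con (star ω) Q u u') (hP : ∀ z ∈ P, a ≤ z.1 ∧ z.1 ≤ b)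
    (hQ : ∀ z ∈ Q, c ≤ z.2 ∧ z.2 + 1 ≤ d) (hx : x.2 ≤ c) (hy : d ≤ y.2)
    (hu : u.1 + 1 ≤ a) (hu' : b ≤ u'.1) : False := by
  have hp' := (transp.con' (S' := transp.g ⁻¹' P) (x' := (x.2, x.1)) (y' := (y.2, y.1))
    (fun z => Iff.rfl) rfl rfl).1 hp
  have hq' := (transp.con' (S' := transp.g ⁻¹' Q) (x' := (u.2, u.1)) (y' := (u'.2, u'.1))
    (fun z => Iff.rfl) rfl rfl).1 hq
  rw [← star_comp_transp] at hq'
  exact not_hcross_vcross hp' hq' (fun z hz => hP _ hz) (fun z hz => hQ _ hz) hx hy hu hu'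

/-- Horizontal and vertical lattice crossings meet. -/
lemma crossings_meet {η η' : Config} {P Q : Set Vertex} {x y u u' : Vertex} {a b c d : ℤ}
    (hp : Con η P x y) (hq : Con η' Q u u') (hP : ∀ z ∈ P, c ≤ z.2 ∧ z.2 ≤ d)
    (hQ : ∀ z ∈ Q, a ≤ z.1 ∧ z.1 ≤ b) (hx : x.1 ≤ a) (hy : b ≤ y.1)
    (hu : u.2 ≤ c) (hu' : d ≤ u'.2) : ∃ z ∈ P, z ∈ Q := by
  classical
  by_contra hcon
  push Not at hcon
  set P' : Set Vertex := insert (y.1 + 1, y.2) P with hP'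
  set Q' : Set Vertex := insert (u.1, u.2 - 1) Q with hQ'
  set ω : Config := fun e => decide ((ends e).1 ∈ P' ∧ (ends e).2 ∈ P') with hω
  have hdisj : ∀ z ∈ Q, z ∉ P' := by
    rintro z hz (rfl | hz')
    · have := hQ _ hz; simp only at this; omega
    · exact hcon z hz' hz
  have hp1 : Con ω P' x (y.1 + 1, y.2) := by
    refine (hp.mono (η' := ω) (Set.subset_insert _ _) ?_).tail (openAdj_right ?_)
      (Set.subset_insert _ _ hp.right_mem) (Set.mem_insert _ _)
    · intro e h1 h2 _
      simp [hω, hP', h1, h2]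
    · simp [hω, hP', hp.right_mem, ends]
  have hq1 : Con (star ω) Q' (u.1, u.2 - 1) u' := by
    refine (Con.step ?_ (Set.mem_insert _ _) (Set.subset_insert _ _ hq.left_mem)).trans
      (hq.mono (Set.subset_insert _ _) ?_)
    · have := openAdj_up (η := star ω) (x := (u.1, u.2 - 1)) ?_
      · simpa using this
      · have := hdisj u hq.left_mem
        simp [hω, ends, this]
    · rintro ⟨v, b⟩ h1 h2 _
      cases b <;> simp [ends] at h1 h2 <;> simp [hω, ends, hdisj _ h2]
  refine not_hcross_vcross (a := a) (b := b + 1) (c := c) (d := d) hp1 hq1 ?_ ?_ hx ?_ ?_ hu'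
  · rintro z (rfl | hz)
    · exact hP y hp.right_mem
    · exact hP z hz
  · rintro z (rfl | hz)
    · have := hQ u hq.left_mem; simp only; omega
    · have := hQ z hz; omega
  · simp only; omega
  · simp only; omega

end Symmetries

section Cut

/-- The four corners of a face are not all on the same side of `N`. -/
def Mixed (N : Set Vertex) (w : Vertex) : Prop :=
  (w ∈ N ∨ (w.1 + 1, w.2) ∈ N ∨ (w.1, w.2 + 1) ∈ N ∨ (w.1 + 1, w.2 + 1) ∈ N) ∧
    (w ∉ N ∨ (w.1 + 1, w.2) ∉ N ∨ (w.1, w.2 + 1) ∉ N ∨ (w.1 + 1, w.2 + 1) ∉ N)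

lemma exists_prefix_parity (h : ℕ → ℤ → Bool) :
    ∃ c : ℕ → ℤ → Bool, (∀ y, c 0 y = false) ∧ ∀ k y, c (k + 1) y = (c k y ^^ h k y) :=
  ⟨fun k y => Nat.rec false (fun k r => r ^^ h k y) k, fun _ => rfl, fun _ _ => rfl⟩

/-- The faces along a closed interface between two connected sets are connected in the dual. -/
lemma cut_connected {ω : Config} {a b c d : ℤ} {N : Set Vertex} (hNQ : N ⊆ Box a b c d)
    (hN : ∀ x ∈ N, ∀ y ∈ N, Con full N x y)
    (hM : ∀ x ∈ Box a b c d \ N, ∀ y ∈ Box a b c d \ N, Con full (Box a b c d \ N) x y)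
    (hcol : (∀ z ∈ Box a b c d, z.1 = a → z ∈ N) ∨ (∀ z ∈ Box a b c d, z.1 = a → z ∉ N))
    (hcl : ∀ x ∈ N, ∀ y ∈ Box a b c d, y ∉ N → ¬ openAdj ω x y)
    {f g : Vertex} (hf : f ∈ Box a (b - 1) c (d - 1)) (hg : g ∈ Box a (b - 1) c (d - 1))
    (hfN : Mixed N f) (hgN : Mixed N g) : Con (star ω) (Box a (b - 1) c (d - 1)) f g := by
  classical
  by_contra hcon
  set W : Vertex → Prop := fun w => Con (star ω) (Box a (b - 1) c (d - 1)) f w with hW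
  have hWQ : ∀ w, W w → w ∈ Box a (b - 1) c (d - 1) := fun w hw => hw.right_mem
  set n : Vertex → Bool := fun v => decide (v ∈ N) with hn
  -- edges of the interface next to a face of `W`
  set hE : ℤ → ℤ → Bool := fun i j => (n (i, j) ^^ n (i + 1, j)) && decide (W (i, j) ∨ W (i, j - 1))
    with hhE
  set vE : ℤ → ℤ → Bool := fun i j => (n (i, j) ^^ n (i, j + 1)) && decide (W (i, j) ∨ W (i - 1, j))
    with hvE
  have hclb : ∀ x ∈ Box a b c d, ∀ y ∈ Box a b c d, n x ≠ n y → ¬ openAdj ω x y := by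
    intro x hx y hy hxy h
    by_cases h1 : x ∈ N
    · exact hcl x h1 y hy (by simp [hn, h1] at hxy; exact hxy) h
    · exact hcl y (by simp [hn, h1] at hxy; exact hxy) x hx h1 (openAdj_symm h)
  have stepH : ∀ i j, (i, j) ∈ Box a b c d → (i + 1, j) ∈ Box a b c d → n (i, j) ≠ n (i + 1, j) →
      openAdj (star ω) (i, j - 1) (i, j) := by
    intro i j h1 h2 h3
    have := openAdj_up (η := star ω) (x := (i, j - 1)) ?_
    · simpa using this
    · have := hclb _ h1 _ h2 h3
      simp only [star_true, Bool.not_eq_true', sub_add_cancel]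
      by_contra h
      exact this (openAdj_right (x := (i, j)) (by simpa using h))
  have stepV : ∀ i j, (i, j) ∈ Box a b c d → (i, j + 1) ∈ Box a b c d → n (i, j) ≠ n (i, j + 1) →
      openAdj (star ω) (i - 1, j) (i, j) := by
    intro i j h1 h2 h3
    have := openAdj_right (η := star ω) (x := (i - 1, j)) ?_
    · simpa using this
    · have := hclb _ h1 _ h2 h3
      simp only [star_false, Bool.not_eq_true', sub_add_cancel]
      by_contra h
      exact this (openAdj_up (x := (i, j)) (by simpa using h))
  have face1 : ∀ i j, W (i, j) → hE i j = (n (i, j) ^^ n (i + 1, j)) ∧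
      hE i (j + 1) = (n (i, j + 1) ^^ n (i + 1, j + 1)) ∧ vE i j = (n (i, j) ^^ n (i, j + 1)) ∧
      vE (i + 1) j = (n (i + 1, j) ^^ n (i + 1, j + 1)) := by
    intro i j h
    simp [hhE, hvE, h]
  have face2 : ∀ i j, (i, j) ∈ Box a (b - 1) c (d - 1) → ¬ W (i, j) → hE i j = false ∧
      hE i (j + 1) = false ∧ vE i j = false ∧ vE (i + 1) j = false := by
    intro i j hij h
    simp only [mem_Box] at hij
    have key : ∀ w, W w → openAdj (star ω) w (i, j) → False := fun w hw ha =>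
      h (Con.tail hw ha (hWQ w hw) (by simp only [mem_Box]; omega))
    refine ⟨?_, ?_, ?_, ?_⟩
    · by_contra hh
      simp only [hhE, Bool.not_eq_false, Bool.and_eq_true, decide_eq_true_eq, h, false_or,
        bne_iff_ne] at hh
      exact key _ hh.2
        (stepH _ _ (by simp only [mem_Box]; omega) (by simp only [mem_Box]; omega) hh.1)
    · by_contra hh
      simp only [hhE, Bool.not_eq_false, Bool.and_eq_true, decide_eq_true_eq, h, or_false,
        bne_iff_ne, add_sub_cancel_right] at hh
      have := stepH i (j + 1) (by simp only [mem_Box]; omega) (by simp only [mem_Box]; omega) hh.1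
      exact key _ hh.2 (openAdj_symm (by simpa using this))
    · by_contra hh
      simp only [hvE, Bool.not_eq_false, Bool.and_eq_true, decide_eq_true_eq, h, false_or,
        bne_iff_ne] at hh
      exact key _ hh.2
        (stepV _ _ (by simp only [mem_Box]; omega) (by simp only [mem_Box]; omega) hh.1)
    · by_contra hh
      simp only [hvE, Bool.not_eq_false, Bool.and_eq_true, decide_eq_true_eq, h, or_false,
        bne_iff_ne, add_sub_cancel_right] at hh
      have := stepV (i + 1) j (by simp only [mem_Box]; omega) (by simp only [mem_Box]; omega) hh.1
      exact key _ hh.2 (openAdj_symm (by simpa using this))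
  obtain ⟨C, hC0, hC⟩ := exists_prefix_parity fun k y => hE (a + k) y
  have hCv : ∀ k : ℕ, a + k ≤ b → ∀ y, c ≤ y → y + 1 ≤ d →
      C k (y + 1) = (C k y ^^ vE (a + k) y) := by
    intro k
    induction k with
    | zero =>
      intro hk y hy hy'
      have : n (a, y) = n (a, y + 1) := by
        have h1 : (a, y) ∈ Box a b c d := by simp only [mem_Box]; simp at hk; omega
        have h2 : (a, y + 1) ∈ Box a b c d := by simp only [mem_Box]; simp at hk; omega
        rcases hcol with h | h
        · simp [hn, h _ h1 rfl, h _ h2 rfl]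
        · simp [hn, h _ h1 rfl, h _ h2 rfl]
      simp [hC0, hvE, this]
    | succ k ih =>
      intro hk y hy hy'
      push_cast at hk
      have hface : (hE (a + k) y ^^ hE (a + k) (y + 1)) = (vE (a + k) y ^^ vE (a + k + 1) y) := by
        by_cases h : W (a + k, y)
        · obtain ⟨e1, e2, e3, e4⟩ := face1 _ _ h
          rw [e1, e2, e3, e4]
          generalize n _ = p, n (a + k + 1, y) = q, n (a + k, y + 1) = r,
            n (a + k + 1, y + 1) = s
          cases p <;> cases q <;> cases r <;> cases s <;> rfl
        · obtain ⟨e1, e2, e3, e4⟩ := face2 (a + k) y (by simp only [mem_Box]; omega) h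
          rw [e1, e2, e3, e4]
      have h1 := ih (by omega) y hy hy'
      rw [hC, hC, h1]
      push_cast
      rw [← add_assoc]
      revert hface
      generalize C k y = p, vE (a + k) y = q, vE (a + k + 1) y = r, hE (a + k) y = s,
        hE (a + k) (y + 1) = t
      cases p <;> cases q <;> cases r <;> cases s <;> cases t <;> simp
  set F : Vertex → Bool := fun v => C (v.1 - a).toNat v.2 with hF
  have hFh : ∀ i j, (i, j) ∈ Box a b c d → (i + 1, j) ∈ Box a b c d →
      F (i + 1, j) = (F (i, j) ^^ hE i j) := by
    intro i j h1 h2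
    simp only [mem_Box] at h1 h2
    obtain ⟨k, rfl⟩ : ∃ k : ℕ, i = a + k := ⟨(i - a).toNat, by omega⟩
    have e1 : (a + k + 1 - a).toNat = k + 1 := by omega
    have e2 : (a + k - a).toNat = k := by omega
    simp only [hF, e1, e2, hC]
  have hFv : ∀ i j, (i, j) ∈ Box a b c d → (i, j + 1) ∈ Box a b c d →
      F (i, j + 1) = (F (i, j) ^^ vE i j) := by
    intro i j h1 h2
    simp only [mem_Box] at h1 h2
    obtain ⟨k, rfl⟩ : ∃ k : ℕ, i = a + k := ⟨(i - a).toNat, by omega⟩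
    have e2 : (a + k - a).toNat = k := by omega
    simp only [hF, e2]
    exact hCv k (by omega) j (by omega) (by omega)
  have hFmono : ∀ x ∈ Box a b c d, ∀ y ∈ Box a b c d, n x = n y → openAdj full x y → F x = F y := by
    intro x hx y hy hxy h
    refine openAdj_cases (r := fun x y => x ∈ Box a b c d → y ∈ Box a b c d → n x = n y → F x = F y)
      (fun x y h hy hx h' => (h hx hy h'.symm).symm) ?_ ?_ h hx hy hxy
    · rintro ⟨i, j⟩ _ h1 h2 h3
      rw [hFh i j h1 h2]
      simp [hhE, h3]
    · rintro ⟨i, j⟩ _ h1 h2 h3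
      rw [hFv i j h1 h2]
      simp [hvE, h3]
  have hFN : ∀ x ∈ N, ∀ y ∈ N, F x = F y := fun x hx y hy =>
    (hN x hx y hy).induct (p := fun y => F x = F y) rfl fun y z _ hy hz ha ih =>
      ih.trans (hFmono _ (hNQ hy) _ (hNQ hz) (by simp [hn, hy, hz]) ha)
  have hFM : ∀ x ∈ Box a b c d \ N, ∀ y ∈ Box a b c d \ N, F x = F y := fun x hx y hy =>
    (hM x hx y hy).induct (p := fun y => F x = F y) rfl fun y z _ hy hz ha ih =>
      ih.trans (hFmono _ hy.1 _ hz.1 (by simp [hn, hy.2, hz.2]) ha)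
  -- the parity is a function of the side
  have hFn : ∀ x ∈ Box a b c d, ∀ y ∈ Box a b c d, n x = n y → F x = F y := by
    intro x hx y hy h
    by_cases h1 : x ∈ N
    · exact hFN x h1 y (by simpa [hn, h1] using h)
    · exact hFM x ⟨hx, h1⟩ y ⟨hy, by simpa [hn, h1] using h⟩
  -- a mixed face has an edge of the interface
  have hmix : ∀ i j, Mixed N (i, j) → n (i, j) ≠ n (i + 1, j) ∨ n (i, j) ≠ n (i, j + 1) ∨
      n (i + 1, j) ≠ n (i + 1, j + 1) := by
    rintro i j ⟨h1, h2⟩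
    by_contra hh
    push Not at hh
    simp only [hn, decide_eq_decide] at hh
    simp only at h1 h2
    tauto
  obtain ⟨i, j⟩ := f
  obtain ⟨i', j'⟩ := g
  have corners : ∀ i j, (i, j) ∈ Box a (b - 1) c (d - 1) → (i, j) ∈ Box a b c d ∧
      (i + 1, j) ∈ Box a b c d ∧ (i, j + 1) ∈ Box a b c d ∧ (i + 1, j + 1) ∈ Box a b c d := by
    intro i j h
    simp only [mem_Box] at h ⊢
    omega
  obtain ⟨p1, p2, p3, p4⟩ := corners i j hf
  obtain ⟨q1, q2, q3, q4⟩ := corners i' j' hg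
  have hWf : W (i, j) := Con.refl hf
  obtain ⟨e1, e2, e3, e4⟩ := face1 i j hWf
  obtain ⟨r1, r2, r3, r4⟩ := face2 i' j' hg hcon
  have hxor : ∀ p q r : Bool, p ≠ q → r ≠ (r ^^ (p ^^ q)) := by decide
  have hdiff : ∃ x ∈ Box a b c d, ∃ y ∈ Box a b c d, n x ≠ n y ∧ F x ≠ F y := by
    rcases hmix i j hfN with h | h | h
    · exact ⟨_, p1, _, p2, h, by rw [hFh i j p1 p2, e1]; exact hxor _ _ _ h⟩
    · exact ⟨_, p1, _, p3, h, by rw [hFv i j p1 p3, e3]; exact hxor _ _ _ h⟩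
    · exact ⟨_, p2, _, p4, h, by rw [hFv (i + 1) j p2 p4, e4]; exact hxor _ _ _ h⟩
  have hsame : ∃ x ∈ Box a b c d, ∃ y ∈ Box a b c d, n x ≠ n y ∧ F x = F y := by
    rcases hmix i' j' hgN with h | h | h
    · exact ⟨_, q1, _, q2, h, by rw [hFh i' j' q1 q2, r1]; simp⟩
    · exact ⟨_, q1, _, q3, h, by rw [hFv i' j' q1 q3, r3]; simp⟩
    · exact ⟨_, q2, _, q4, h, by rw [hFv (i' + 1) j' q2 q4, r4]; simp⟩
  obtain ⟨x, hx, y, hy, hxy, hFxy⟩ := hdiff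
  obtain ⟨x', hx', y', hy', hxy', hFxy'⟩ := hsame
  by_cases h : n x = n x'
  · have h' : n y = n y' := by
      revert hxy hxy' h
      cases n x <;> cases n y <;> cases n x' <;> cases n y' <;> simp
    exact hFxy ((hFn _ hx _ hx' h).trans (hFxy'.trans (hFn _ hy' _ hy h'.symm)))
  · have h1 : n x = n y' := by
      revert hxy hxy' h
      cases n x <;> cases n y <;> cases n x' <;> cases n y' <;> simp
    have h2 : n y = n x' := by
      revert hxy hxy' h
      cases n x <;> cases n y <;> cases n x' <;> cases n y' <;> simp
    exact hFxy ((hFn _ hx _ hy' h1).trans (hFxy'.symm.trans (hFn _ hx' _ hy h2.symm)))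

end Cut

section Barrier

lemma Box_connected {a b c d : ℤ} {x y : Vertex} (hx : x ∈ Box a b c d) (hy : y ∈ Box a b c d) :
    Con full (Box a b c d) x y := by
  have hor : ∀ k : ℕ, ∀ i j, (i, j) ∈ Box a b c d → (i + k, j) ∈ Box a b c d →
      Con full (Box a b c d) (i, j) (i + k, j) := by
    intro k
    induction k with
    | zero => intro i j h _; simpa using Con.refl h
    | succ k ih =>
      intro i j h h'
      have h1 : (i + k, j) ∈ Box a b c d := by
        simp only [mem_Box] at h h' ⊢; push_cast at h'; omega
      have := (ih i j h h1).tail (openAdj_right rfl) h1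
        (by convert h' using 2; push_cast; ring)
      convert this using 2
      push_cast; ring
  have ver : ∀ k : ℕ, ∀ i j, (i, j) ∈ Box a b c d → (i, j + k) ∈ Box a b c d →
      Con full (Box a b c d) (i, j) (i, j + k) := by
    intro k
    induction k with
    | zero => intro i j h _; simpa using Con.refl h
    | succ k ih =>
      intro i j h h'
      have h1 : (i, j + k) ∈ Box a b c d := by
        simp only [mem_Box] at h h' ⊢; push_cast at h'; omega
      have := (ih i j h h1).tail (openAdj_up rfl) h1
        (by convert h' using 2; push_cast; ring)
      convert this using 2
      push_cast; ring
  have key : ∀ x ∈ Box a b c d, Con full (Box a b c d) (a, c) x := by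
    rintro ⟨i, j⟩ h
    have h' := h
    simp only [mem_Box] at h
    have h1 := hor (i - a).toNat a c (by simp only [mem_Box]; omega) (by simp only [mem_Box]; omega)
    have h2 := ver (j - c).toNat i c (by simp only [mem_Box]; omega) (by simp only [mem_Box]; omega)
    have e1 : a + ((i - a).toNat : ℤ) = i := by omega
    have e2 : c + ((j - c).toNat : ℤ) = j := by omega
    rw [e1] at h1
    rw [e2] at h2
    exact h1.trans h2
  exact (key x hx).symm.trans (key y hy)

/-- The set `A` together with the `η`-clusters in `Q` of the points of `L`. -/
def grown (η : Config) (Q A L : Set Vertex) : Set Vertex := A ∪ {z | ∃ x ∈ L, Con η Q x z}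

/-- The part of `Q` that is lattice-connected to `R` off `grown η Q A L`. -/
def unexplored (η : Config) (Q A L R : Set Vertex) : Set Vertex :=
  {v | ∃ r ∈ R, Con full (Q \ grown η Q A L) r v}

/-- The geometric setting of an exploration in `Q` started from `L ⊆ A` and watched from `R`. -/
structure Explores (η : Config) (Q A L R : Set Vertex) : Prop where
  hA : A ⊆ Q
  hL : L ⊆ A
  hR : R ⊆ Q
  neA : A.Nonempty
  conA : ∀ x ∈ A, ∀ y ∈ A, Con full A x y
  conR : ∀ x ∈ R, ∀ y ∈ R, Con full R x y
  exit : ∀ x ∈ A, ∀ y ∈ Q, y ∉ A → openAdj full x y → x ∈ L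
  disj : ∀ x ∈ R, x ∉ A
  noCon : ∀ x ∈ L, ∀ y ∈ R, ¬ Con η Q x y

namespace Explores

variable {η : Config} {Q A L R : Set Vertex}

lemma sub (_ : Explores η Q A L R) : unexplored η Q A L R ⊆ Q := by
  rintro v ⟨r, _, hv⟩
  exact hv.right_mem.1

lemma R_sub (h : Explores η Q A L R) : R ⊆ unexplored η Q A L R := fun r hr =>
  ⟨r, hr, Con.refl ⟨h.hR hr, fun hg => hg.elim (h.disj r hr) fun ⟨x, hx, hxr⟩ =>
    h.noCon x hx r hr hxr⟩⟩

lemma notMem_grown {v : Vertex} (hv : v ∈ unexplored η Q A L R) : v ∉ grown η Q A L := by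
  obtain ⟨r, _, hv⟩ := hv
  exact hv.right_mem.2

lemma notMem_of_mem (hx : x ∈ A) : x ∉ unexplored η Q A L R :=
  fun h => notMem_grown h (.inl hx)

lemma con_unexplored (h : Explores η Q A L R) :
    ∀ x ∈ unexplored η Q A L R, ∀ y ∈ unexplored η Q A L R,
      Con full (unexplored η Q A L R) x y := by
  have key : ∀ r ∈ R, ∀ x, Con full (Q \ grown η Q A L) r x →
      Con full (unexplored η Q A L R) r x := by
    intro r hr x hx
    have := hx.restrict (S' := unexplored η Q A L R) (h.R_sub hr)
      fun a b ha hb ⟨r', hr', hra⟩ hab =>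
      ⟨r', hr', hra.tail hab ha hb⟩
    exact this.mono_set fun z hz => hz.2
  rintro x ⟨r, hr, hx⟩ y ⟨r', hr', hy⟩
  exact ((key r hr x hx).symm.trans ((h.conR r hr r' hr').mono_set h.R_sub)).trans (key r' hr' y hy)

lemma closed (h : Explores η Q A L R) : ∀ x ∈ unexplored η Q A L R, ∀ y ∈ Q,
    y ∉ unexplored η Q A L R → ¬ openAdj η x y := by
  rintro x hx y hyQ hy hxy
  have hfull : openAdj full x y := by
    obtain ⟨e, _, he⟩ := hxy
    exact ⟨e, rfl, he⟩
  have hyg : y ∈ grown η Q A L := by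
    by_contra hyg
    obtain ⟨r, hr, hrx⟩ := hx
    exact hy ⟨r, hr, hrx.tail hfull hrx.right_mem ⟨hyQ, hyg⟩⟩
  have hxQ := h.sub hx
  have hxg := notMem_grown hx
  have : ∃ l ∈ L, Con η Q l y := by
    rcases hyg with hyA | hy
    · have hyL := h.exit y hyA x hxQ (fun hxA => hxg (.inl hxA)) (openAdj_symm hfull)
      exact ⟨y, hyL, Con.refl hyQ⟩
    · exact hy
  obtain ⟨l, hl, hly⟩ := this
  exact hxg (.inr ⟨l, hl, hly.tail (openAdj_symm hxy) hyQ hxQ⟩)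

lemma con_explored (h : Explores η Q A L R) (hQ : ∀ x ∈ Q, ∀ y ∈ Q, Con full Q x y) :
    ∀ x ∈ Q \ unexplored η Q A L R, ∀ y ∈ Q \ unexplored η Q A L R,
      Con full (Q \ unexplored η Q A L R) x y := by
  obtain ⟨a₀, ha₀⟩ := h.neA
  have hgN : ∀ z ∈ Q, z ∈ grown η Q A L → z ∈ Q \ unexplored η Q A L R :=
    fun z hzQ hz => ⟨hzQ, fun hz' => notMem_grown hz' hz⟩
  have hAa : ∀ x ∈ A, Con full (Q \ unexplored η Q A L R) x a₀ := fun x hx =>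
    (h.conA x hx a₀ ha₀).mono_set fun z hz => hgN z (h.hA hz) (.inl hz)
  have hga : ∀ x ∈ Q, x ∈ grown η Q A L → Con full (Q \ unexplored η Q A L R) x a₀ := by
    rintro x hxQ (hx | ⟨l, hl, hlx⟩)
    · exact hAa x hx
    · have h1 : Con η (Q ∩ {z | ∃ l ∈ L, Con η Q l z}) l x :=
        hlx.restrict ⟨l, hl, Con.refl hlx.left_mem⟩ fun a b ha hb ⟨l', hl', hla⟩ hab =>
          ⟨l', hl', hla.tail hab ha hb⟩
      exact (h1.full.mono_set fun z hz => hgN z hz.1 (.inr hz.2)).symm.trans (hAa l (h.hL hl))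
  have key : ∀ x ∈ Q \ unexplored η Q A L R, Con full (Q \ unexplored η Q A L R) x a₀ := by
    rintro x ⟨hxQ, hx⟩
    by_cases hxg : x ∈ grown η Q A L
    · exact hga x hxQ hxg
    · obtain ⟨v, w, h1, h2, h3, h4⟩ := (hQ x hxQ a₀ (h.hA ha₀)).first_entry hxg (.inl ha₀)
      have h5 : Con full (Q \ grown η Q A L ∩ (unexplored η Q A L R)ᶜ) x v := by
        refine h1.restrict hx ?_
        rintro a b ha hb ha' hab ⟨r, hr, hrb⟩
        exact ha' ⟨r, hr, hrb.tail (openAdj_symm hab) hb ha⟩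
      have h6 : Con full (Q \ unexplored η Q A L R) x v := h5.mono_set fun z hz => ⟨hz.1.1, hz.2⟩
      exact (h6.tail h2 h6.right_mem (hgN w h4 h3)).trans (hga w h4 h3)
  exact fun x hx y hy => (key x hx).trans (key y hy).symm

/-- The faces along the boundary of the unexplored region are connected in the dual. -/
lemma wall_connected {a b c d : ℤ} (h : Explores η (Box a b c d) A L R)
    (hcol : (∀ z ∈ Box a b c d, z.1 = a → z ∈ A) ∨ (∀ z ∈ Box a b c d, z.1 = a → z ∈ R))
    {f g : Vertex} (hf : f ∈ Box a (b - 1) c (d - 1)) (hg : g ∈ Box a (b - 1) c (d - 1))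
    (hfN : Mixed (unexplored η (Box a b c d) A L R) f)
    (hgN : Mixed (unexplored η (Box a b c d) A L R) g) :
    Con (star η) (Box a (b - 1) c (d - 1)) f g :=
  cut_connected h.sub h.con_unexplored (h.con_explored fun _ hx _ hy => Box_connected hx hy)
    (hcol.symm.imp (fun h' z hz hza => h.R_sub (h' z hz hza))
      fun h' z hz hza => notMem_of_mem (h' z hz hza)) h.closed hf hg hfN hgN

end Explores

/-- The unexplored region does not change when edges inside it are modified. -/
lemma unexplored_congr {η η' : Config} {Q A L R : Set Vertex}
    (h : Explores η Q A L R)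
    (hη : ∀ e : Edge, (ends e).1 ∈ Q → (ends e).2 ∈ Q →
      ((ends e).1 ∉ unexplored η Q A L R ∨ (ends e).2 ∉ unexplored η Q A L R) → η e = η' e) :
    unexplored η' Q A L R = unexplored η Q A L R ∧ Explores η' Q A L R := by
  have hcl : ∀ l ∈ L, ∀ z, Con η' Q l z → Con η Q l z := by
    intro l hl z hz
    refine hz.induct (p := fun z => Con η Q l z) (Con.refl hz.left_mem) ?_
    intro y z _ hy hz hyz ih
    have hyN : y ∉ unexplored η Q A L R := fun h' => Explores.notMem_grown h' (.inr ⟨l, hl, ih⟩)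
    refine ih.tail ?_ hy hz
    obtain ⟨e, he, ⟨rfl, rfl⟩ | ⟨rfl, rfl⟩⟩ := hyz
    · exact ⟨e, (hη e hy hz (.inl hyN)).trans he, by simp⟩
    · exact ⟨e, (hη e hz hy (.inr hyN)).trans he, by simp⟩
  have hcl' : ∀ l ∈ L, ∀ z, Con η Q l z → Con η' Q l z := by
    intro l hl z hz
    refine hz.induct (p := fun z => Con η' Q l z) (Con.refl hz.left_mem) ?_
    intro y z hly hy hz hyz ih
    have hyN : y ∉ unexplored η Q A L R := fun h' => Explores.notMem_grown h' (.inr ⟨l, hl, hly⟩)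
    refine ih.tail ?_ hy hz
    obtain ⟨e, he, ⟨rfl, rfl⟩ | ⟨rfl, rfl⟩⟩ := hyz
    · exact ⟨e, (hη e hy hz (.inl hyN)).symm.trans he, by simp⟩
    · exact ⟨e, (hη e hz hy (.inr hyN)).symm.trans he, by simp⟩
  have hg : grown η' Q A L = grown η Q A L := by
    unfold grown
    congr 1
    ext z
    exact ⟨fun ⟨l, hl, hz⟩ => ⟨l, hl, hcl l hl z hz⟩, fun ⟨l, hl, hz⟩ => ⟨l, hl, hcl' l hl z hz⟩⟩
  exact ⟨by unfold unexplored; rw [hg], ⟨h.hA, h.hL, h.hR, h.neA, h.conA, h.conR, h.exit, h.disj,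
    fun x hx y hy hxy => h.noCon x hx y hy (hcl x hx y hxy)⟩⟩

end Barrier

section Events

variable {ι κ α : Type*}

open Classical in
/-- The indicator function of an event. -/
noncomputable def ind (E : (ι → Bool) → Prop) : (ι → Bool) → ℝ := fun ω => if E ω then 1 else 0

/-- The event `E` only depends on the coordinates in `F`. -/
def Dep (F : Set ι) (E : (ι → Bool) → Prop) : Prop :=
  ∀ ω σ : ι → Bool, (∀ i ∈ F, ω i = σ i) → E ω → E σ

/-- The event `E` is increasing. -/
def Incr (E : (ι → Bool) → Prop) : Prop := ∀ ω σ : ι → Bool, ω ≤ σ → E ω → E σ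

/-- The event `E` is decreasing. -/
def Decr (E : (ι → Bool) → Prop) : Prop := ∀ ω ω' : ι → Bool, ω ≤ ω' → E ω' → E ω

lemma ind_nonneg (E : (ι → Bool) → Prop) (ω : ι → Bool) : 0 ≤ ind E ω := by
  unfold ind; split_ifs <;> norm_num

lemma ind_le_one (E : (ι → Bool) → Prop) (ω : ι → Bool) : ind E ω ≤ 1 := by
  unfold ind; split_ifs <;> norm_num

lemma ind_of {E : (ι → Bool) → Prop} {ω : ι → Bool} (h : E ω) : ind E ω = 1 := if_pos h

lemma ind_of_not {E : (ι → Bool) → Prop} {ω : ι → Bool} (h : ¬ E ω) : ind E ω = 0 := if_neg h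

lemma ind_mono {E E' : (ι → Bool) → Prop} {ω ω' : ι → Bool} (h : E ω → E' ω') :
    ind E ω ≤ ind E' ω' := by
  by_cases hE : E ω
  · rw [ind_of hE, ind_of (h hE)]
  · rw [ind_of_not hE]; exact ind_nonneg _ _

lemma ind_congr {E E' : (ι → Bool) → Prop} {ω ω' : ι → Bool} (h : E ω ↔ E' ω') :
    ind E ω = ind E' ω' := le_antisymm (ind_mono h.1) (ind_mono h.2)

lemma ind_and (E E' : (ι → Bool) → Prop) (ω : ι → Bool) :
    ind (fun ω => E ω ∧ E' ω) ω = ind E ω * ind E' ω := by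
  unfold ind; split_ifs <;> simp_all

lemma ind_not (E : (ι → Bool) → Prop) (ω : ι → Bool) : ind (fun ω => ¬ E ω) ω = 1 - ind E ω := by
  unfold ind; split_ifs <;> simp_all

lemma Dep.mono {F G : Set ι} {E : (ι → Bool) → Prop} (h : Dep F E) (hFG : F ⊆ G) : Dep G E :=
  fun ω ω' hω => h ω ω' fun i hi => hω i (hFG hi)

lemma Dep.iff {F : Set ι} {E : (ι → Bool) → Prop} (h : Dep F E) {ω ω' : ι → Bool}
    (hω : ∀ i ∈ F, ω i = ω' i) : E ω ↔ E ω' :=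
  ⟨h _ _ hω, h _ _ fun i hi => (hω i hi).symm⟩

lemma Dep.and {F : Set ι} {E E' : (ι → Bool) → Prop} (h : Dep F E) (h' : Dep F E') :
    Dep F (fun ω => E ω ∧ E' ω) :=
  fun ω ω' hω hE => ⟨h ω ω' hω hE.1, h' ω ω' hω hE.2⟩

lemma Decr.and {E E' : (ι → Bool) → Prop} (h : Decr E) (h' : Decr E') :
    Decr fun ω => E ω ∧ E' ω :=
  fun ω ω' hω hE => ⟨h ω ω' hω hE.1, h' ω ω' hω hE.2⟩

lemma Dep.not {F : Set ι} {E : (ι → Bool) → Prop} (h : Dep F E) : Dep F (fun ω => ¬ E ω) :=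
  fun _ _ hω hE hE' => hE (h _ _ (fun i hi => (hω i hi).symm) hE')

lemma Dep.inv {F G : Set ι} {E : (ι → Bool) → Prop} (h : Dep F E) (hFG : Disjoint F G) :
    Inv G (ind E) :=
  fun _ _ hω => ind_congr (h.iff fun i hi => hω i fun hG => Set.disjoint_left.1 hFG hi hG)

lemma Incr.and {E E' : (ι → Bool) → Prop} (h : Incr E) (h' : Incr E') :
    Incr (fun ω => E ω ∧ E' ω) :=
  fun ω ω' hω hE => ⟨h ω ω' hω hE.1, h' ω ω' hω hE.2⟩

lemma Incr.monoOn {E : (ι → Bool) → Prop} (h : Incr E) (F : Set ι) : MonoOn F (ind E) :=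
  fun _ _ hω _ => ind_mono (h _ _ hω)

lemma Decr.antiOn {E : (ι → Bool) → Prop} (h : Decr E) (F : Set ι) : AntiOn F (ind E) :=
  fun _ _ hω _ => neg_le_neg (ind_mono (h _ _ hω))

/-- A local event depends on finitely many coordinates. -/
def IsLocal (E : (ι → Bool) → Prop) : Prop := ∃ F : Finset ι, Dep (F : Set ι) E

lemma IsLocal.compl {E : (ι → Bool) → Prop} (hE : IsLocal E) :
    IsLocal (fun ω : ι → Bool => E (fun i => !ω i)) := by
  obtain ⟨F, hF⟩ := hE
  exact ⟨F, fun ω ω' hω => hF _ _ fun i hi => by simp only [hω i hi]⟩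

variable [DecidableEq ι]

/-- The probability of a local event under independent fair coin flips. -/
noncomputable def pr (E : (ι → Bool) → Prop) : ℝ :=
  open Classical in
  if h : ∃ F : Finset ι, Dep (F : Set ι) E then avg h.choose (ind E) (fun _ => false) else 0

lemma avg_ind_eq_pr {F : Finset ι} {E : (ι → Bool) → Prop} (h : Dep (F : Set ι) E)
    (ω : ι → Bool) : avg F (ind E) ω = pr E := by
  have hex : ∃ F : Finset ι, Dep (F : Set ι) E := ⟨F, h⟩
  unfold pr
  rw [dif_pos hex]
  have h0 := hex.choose_spec
  set F₀ := hex.choose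
  have h1 := avg_eq_of_subset (F := F) (G := F ∪ F₀) Finset.subset_union_left
    (h.inv (by rw [Finset.disjoint_coe]; exact Finset.disjoint_sdiff)) ω
  have h2 := avg_eq_of_subset (F := F₀) (G := F ∪ F₀) Finset.subset_union_right
    (h0.inv (by rw [Finset.disjoint_coe]; exact Finset.disjoint_sdiff)) ω
  rw [← h1, h2]
  have h3 : Inv (F₀ : Set ι)ᶜ (avg F₀ (ind E)) := (h0.inv disjoint_compl_right).avg
  have h4 := inv_avg F₀ (ind E)
  rw [h3 ω (fun i => if i ∈ F₀ then ω i else false) fun i hi => by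
    simp at hi; simp [hi], h4 _ (fun _ => false) fun i hi => by simp at hi; simp [hi]]

lemma IsLocal.and {E E' : (ι → Bool) → Prop} (h : IsLocal E) (h' : IsLocal E') :
    IsLocal (fun ω => E ω ∧ E' ω) := by
  obtain ⟨F, h⟩ := h
  obtain ⟨F', h'⟩ := h'
  exact ⟨F ∪ F', (h.mono (by simp)).and (h'.mono (by simp))⟩

lemma IsLocal.or {E E' : (ι → Bool) → Prop} (h : IsLocal E) (h' : IsLocal E') :
    IsLocal (fun ω => E ω ∨ E' ω) := by
  obtain ⟨F, h⟩ := h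
  obtain ⟨F', h'⟩ := h'
  exact ⟨F ∪ F', fun ω ω' hω => Or.imp (h.mono (by simp) ω ω' hω) (h'.mono (by simp) ω ω' hω)⟩

lemma pr_nonneg (E : (ι → Bool) → Prop) : 0 ≤ pr E := by
  unfold pr
  split_ifs with h
  · exact avg_nonneg (ind_nonneg E) _
  · exact le_rfl

lemma pr_mono {E E' : (ι → Bool) → Prop} (hE : IsLocal E) (hE' : IsLocal E')
    (h : ∀ ω, E ω → E' ω) : pr E ≤ pr E' := by
  obtain ⟨F, hF⟩ := hE
  obtain ⟨F', hF'⟩ := hE'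
  rw [← avg_ind_eq_pr (F := F ∪ F') (hF.mono (by simp)) (fun _ => false),
    ← avg_ind_eq_pr (F := F ∪ F') (hF'.mono (by simp)) (fun _ => false)]
  exact avg_mono (fun ω => ind_mono (h ω)) _

lemma pr_not {E : (ι → Bool) → Prop} (hE : IsLocal E) : pr (fun ω => ¬ E ω) = 1 - pr E := by
  obtain ⟨F, hF⟩ := hE
  rw [← avg_ind_eq_pr hF (fun _ => false), ← avg_ind_eq_pr hF.not (fun _ => false)]
  have : ind (fun ω => ¬ E ω) = fun ω => 1 - ind E ω := funext (ind_not E)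
  rw [this, avg_sub F (fun _ => 1), avg_const]

lemma pr_or_le {E E' : (ι → Bool) → Prop} (hE : IsLocal E) (hE' : IsLocal E') :
    pr (fun ω => E ω ∨ E' ω) ≤ pr E + pr E' := by
  obtain ⟨F, hF⟩ := hE
  obtain ⟨F', hF'⟩ := hE'
  have h1 : Dep ((F ∪ F' : Finset ι) : Set ι) E := hF.mono (by simp)
  have h2 : Dep ((F ∪ F' : Finset ι) : Set ι) E' := hF'.mono (by simp)
  rw [← avg_ind_eq_pr h1 (fun _ => false), ← avg_ind_eq_pr h2 (fun _ => false),
    ← avg_ind_eq_pr (E := fun ω => E ω ∨ E' ω) (F := F ∪ F')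
      (fun ω ω' hω => Or.imp (h1 ω ω' hω) (h2 ω ω' hω)) (fun _ => false), ← avg_add]
  refine avg_mono (fun ω => ?_) _
  by_cases hE : E ω
  · rw [ind_of (E := fun ω => E ω ∨ E' ω) (.inl hE), ind_of hE]
    linarith [ind_nonneg E' ω]
  · rw [ind_of_not hE, zero_add]
    exact ind_mono fun h => h.resolve_left hE

/-- Harris' inequality for local increasing events. -/
lemma pr_and_ge {E E' : (ι → Bool) → Prop} (hE : IsLocal E) (hE' : IsLocal E')
    (h : Incr E) (h' : Incr E') : pr E * pr E' ≤ pr (fun ω => E ω ∧ E' ω) := by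
  obtain ⟨F, hF⟩ := hE
  obtain ⟨F', hF'⟩ := hE'
  have h1 : Dep ((F ∪ F' : Finset ι) : Set ι) E := hF.mono (by simp)
  have h2 : Dep ((F ∪ F' : Finset ι) : Set ι) E' := hF'.mono (by simp)
  rw [← avg_ind_eq_pr h1 (fun _ => false), ← avg_ind_eq_pr h2 (fun _ => false),
    ← avg_ind_eq_pr (h1.and h2) (fun _ => false)]
  refine (avg_mul_ge (h.monoOn _) (h'.monoOn _) _).trans_eq ?_
  congr 1
  exact (funext (ind_and E E')).symm

lemma IsLocal.comp {E : (κ → Bool) → Prop} (hE : IsLocal E) (j : κ → ι) :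
    IsLocal (fun ω : ι → Bool => E (ω ∘ j)) := by
  obtain ⟨F, hF⟩ := hE
  exact ⟨F.image j, fun ω ω' hω => hF _ _ fun i hi => hω _ (by simpa using ⟨i, hi, rfl⟩)⟩

variable [DecidableEq κ] in
lemma pr_comp {j : κ → ι} (hj : Function.Injective j) {E : (κ → Bool) → Prop} (hE : IsLocal E) :
    pr (fun ω : ι → Bool => E (ω ∘ j)) = pr E := by
  obtain ⟨F, hF⟩ := hE
  have h1 : Dep ((F.image j : Finset ι) : Set ι) (fun ω : ι → Bool => E (ω ∘ j)) :=
    fun ω ω' hω => hF _ _ fun i hi => hω _ (by simpa using ⟨i, hi, rfl⟩)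
  rw [← avg_ind_eq_pr h1 (fun _ => false)]
  refine (avg_comp hj (F.image j) (ind E) _).trans ?_
  rw [avg_ind_eq_pr (hF.mono ?_)]
  intro i hi
  simpa using ⟨i, hi, rfl⟩

lemma pr_compl {E : (ι → Bool) → Prop} (hE : IsLocal E) :
    pr (fun ω : ι → Bool => E (fun i => !ω i)) = pr E := by
  obtain ⟨F, hF⟩ := hE
  have h1 : Dep (F : Set ι) (fun ω : ι → Bool => E (fun i => !ω i)) :=
    fun ω ω' hω => hF _ _ fun i hi => by simp only [hω i hi]
  rw [← avg_ind_eq_pr h1 (fun _ => false)]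
  refine (avg_not F (ind E) _).trans ?_
  rw [avg_ind_eq_pr hF]

/-- Conditioning on the value of an exploration. -/
lemma avg_explore {F : Finset ι} {T : Finset α} {N : (ι → Bool) → α} {E : (ι → Bool) → Prop}
    {Y : α → (ι → Bool) → Prop} {G : α → Finset ι} {p : ℝ} {ω : ι → Bool}
    (hN : ∀ ω, E ω → N ω ∈ T) (hG : ∀ n ∈ T, G n ⊆ F)
    (hE : ∀ n ∈ T, Inv ((F \ G n : Finset ι) : Set ι) (ind fun ω => E ω ∧ N ω = n))
    (hY : ∀ n ∈ T, Inv ((G n : Finset ι) : Set ι) (ind (Y n)))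
    (hp : ∀ n ∈ T, p ≤ avg F (ind (Y n)) ω) :
    p * avg F (ind E) ω ≤ avg F (ind fun ω => E ω ∧ Y (N ω) ω) ω := by
  classical
  have h1 : ind E = fun ω => ∑ n ∈ T, ind (fun ω => E ω ∧ N ω = n) ω := by
    funext ω
    by_cases h : E ω
    · rw [ind_of h, Finset.sum_eq_single (N ω)]
      · rw [ind_of ⟨h, rfl⟩]
      · intro n _ hn
        exact ind_of_not fun h' => hn h'.2.symm
      · intro h'
        exact absurd (hN ω h) h'
    · rw [ind_of_not h]
      exact (Finset.sum_eq_zero fun n _ => ind_of_not fun h' => h h'.1).symm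
  have h2 : ∀ ω, ∑ n ∈ T, ind (fun ω => E ω ∧ N ω = n) ω * ind (Y n) ω ≤
      ind (fun ω => E ω ∧ Y (N ω) ω) ω := by
    intro ω
    by_cases h : E ω
    · rw [Finset.sum_eq_single (N ω)]
      · rw [← ind_and]
        exact ind_mono fun h' => ⟨h'.1.1, h'.2⟩
      · intro n _ hn
        rw [ind_of_not fun h' => hn h'.2.symm, zero_mul]
      · intro h'
        exact absurd (hN ω h) h'
    · refine (Finset.sum_eq_zero fun n _ => ?_).trans_le (ind_nonneg _ _)
      rw [ind_of_not fun h' => h h'.1, zero_mul]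
  refine le_trans ?_ (avg_mono h2 ω)
  rw [avg_sum, h1, avg_sum, Finset.mul_sum]
  refine Finset.sum_le_sum fun n hn => ?_
  have h3 := avg_mul_of_disjoint (F := G n) (G := F \ G n) Finset.disjoint_sdiff (hE n hn)
    (hY n hn) ω
  rw [Finset.union_sdiff_of_subset (hG n hn)] at h3
  rw [h3, mul_comm]
  exact mul_le_mul_of_nonneg_left (hp n hn) (avg_nonneg (ind_nonneg _) _)

end Events

section Crossings

variable {a b c d : ℤ} {ω ω' η : Config} {S : Set Vertex} {x y : Vertex}

/-- The edges whose lower left endpoint lies in a rectangle. -/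
noncomputable def bx (a b c d : ℤ) : Finset Edge :=
  (Finset.Icc a b ×ˢ Finset.Icc c d) ×ˢ Finset.univ

lemma mem_bx {e : Edge} : e ∈ bx a b c d ↔ e.1 ∈ Box a b c d := by
  simp [bx, Box, and_assoc]

/-- The edges located in a set of vertices. -/
def loc (Z : Set Vertex) : Set Edge := {e | e.1 ∈ Z}

lemma coe_bx : (bx a b c d : Set Edge) = loc (Box a b c d) := by
  ext e
  simp [mem_bx, loc]

lemma loc_mono {Z Z' : Set Vertex} (h : Z ⊆ Z') : loc Z ⊆ loc Z' := fun _ he => h he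

lemma dep_con : Dep (loc S) (fun ω => Con ω S x y) :=
  fun _ _ hω h => h.mono le_rfl fun e h1 _ h3 => by rw [← hω e h1, h3]

lemma Con.incr (h : Con ω S x y) (hω : ω ≤ ω') : Con ω' S x y :=
  h.mono le_rfl fun e _ _ h3 => by
    have := hω e; rw [h3] at this; revert this; cases ω' e <;> simp

lemma dep_HC : Dep (loc (Box a b c d)) (fun ω => HC ω a b c d) :=
  fun _ _ hω ⟨x, y, hx, hy, h⟩ => ⟨x, y, hx, hy, dep_con _ _ hω h⟩

lemma dep_VC : Dep (loc (Box a b c d)) (fun ω => VC ω a b c d) :=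
  fun _ _ hω ⟨x, y, hx, hy, h⟩ => ⟨x, y, hx, hy, dep_con _ _ hω h⟩

lemma incr_HC : Incr (fun ω => HC ω a b c d) :=
  fun _ _ hω ⟨x, y, hx, hy, h⟩ => ⟨x, y, hx, hy, h.incr hω⟩

lemma incr_VC : Incr (fun ω => VC ω a b c d) :=
  fun _ _ hω ⟨x, y, hx, hy, h⟩ => ⟨x, y, hx, hy, h.incr hω⟩

lemma Incr.star {E : Config → Prop} (h : Incr E) : Decr (fun ω => E (star ω)) :=
  fun _ _ hω hE => h _ _ (star_anti hω) hE

/-- The primal edge crossed by a dual edge. -/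
def crossed (e : Edge) : Edge :=
  if e.2 then ((e.1.1, e.1.2 + 1), false) else ((e.1.1 + 1, e.1.2), true)

lemma crossed_injective : Function.Injective crossed := by
  rintro ⟨⟨a, b⟩, _ | _⟩ ⟨⟨a', b'⟩, _ | _⟩ h <;> simp_all [crossed]

lemma Dep.star {E : Config → Prop} {Z Z' : Set Vertex} (h : Dep (loc Z) E)
    (hZ : ∀ z ∈ Z, (z.1 + 1, z.2) ∈ Z' ∧ (z.1, z.2 + 1) ∈ Z') :
    Dep (loc Z') (fun ω => E (FKArm.star ω)) := by
  refine fun ω ω' hω => h _ _ ?_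
  rintro ⟨v, _ | _⟩ he
  · simp [hω ((v.1 + 1, v.2), true) (hZ v he).1]
  · simp [hω ((v.1, v.2 + 1), false) (hZ v he).2]

lemma Dep.star_box {E : Config → Prop} (h : Dep (loc (Box a b c d)) E) :
    Dep (loc (Box a (b + 1) c (d + 1))) (fun ω => E (FKArm.star ω)) :=
  h.star fun z hz => by simp only [mem_Box] at hz ⊢; omega

lemma Dep.isLocal {E : Config → Prop} (h : Dep (loc (Box a b c d)) E) : IsLocal E :=
  ⟨bx a b c d, by rwa [coe_bx]⟩

lemma IsLocal.star {E : Config → Prop} (h : IsLocal E) : IsLocal (fun ω => E (FKArm.star ω)) :=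
  (h.compl).comp crossed

lemma pr_star {E : Config → Prop} (h : IsLocal E) : pr (fun ω => E (star ω)) = pr E :=
  (pr_comp crossed_injective h.compl).trans (pr_compl h)

lemma pr_sym (σ : LatticeSym) {E : Config → Prop} (h : IsLocal E) :
    pr (fun ω => E (ω ∘ σ.j)) = pr E := pr_comp σ.inj h

lemma HC_transl (t : Vertex) :
    HC ω a b c d ↔ HC (ω ∘ (transl t).j) (a - t.1) (b - t.1) (c - t.2) (d - t.2) := by
  have key : ∀ x y : Vertex, Con ω (Box a b c d) (x + t) (y + t) ↔
      Con (ω ∘ (transl t).j) (Box (a - t.1) (b - t.1) (c - t.2) (d - t.2)) x y := fun x y =>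
    (transl t).con' (fun z => by
      simp only [mem_Box, transl, Equiv.coe_addRight, Prod.fst_add, Prod.snd_add]
      omega) rfl rfl
  constructor
  · rintro ⟨x, y, hx, hy, h⟩
    exact ⟨x - t, y - t, by simp [hx], by simp [hy], (key _ _).1 (by simpa using h)⟩
  · rintro ⟨x, y, hx, hy, h⟩
    exact ⟨x + t, y + t, by simp [hx], by simp [hy], (key _ _).2 h⟩

lemma VC_transp : VC ω a b c d ↔ HC (ω ∘ transp.j) c d a b := by
  have key : ∀ x y : Vertex, Con ω (Box a b c d) (x.2, x.1) (y.2, y.1) ↔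
      Con (ω ∘ transp.j) (Box c d a b) x y := fun x y =>
    transp.con' (fun z => by
      simp only [mem_Box, transp, Equiv.coe_prodComm, Prod.fst_swap, Prod.snd_swap]
      omega) rfl rfl
  constructor
  · rintro ⟨x, y, hx, hy, h⟩
    exact ⟨(x.2, x.1), (y.2, y.1), hx, hy, (key _ _).1 h⟩
  · rintro ⟨x, y, hx, hy, h⟩
    exact ⟨(x.2, x.1), (y.2, y.1), hx, hy, (key _ _).2 h⟩

/-- The probability of a horizontal crossing of a `w × h` rectangle. -/
noncomputable def hp (w h : ℤ) : ℝ := pr (fun ω => HC ω 0 w 0 h)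

lemma pr_HC (a b c d : ℤ) : pr (fun ω => HC ω a b c d) = hp (b - a) (d - c) := by
  have : (fun ω => HC ω a b c d) = fun ω => HC (ω ∘ (transl (a, c)).j) 0 (b - a) 0 (d - c) := by
    funext ω
    apply propext
    rw [HC_transl (a, c)]
    simp
  rw [this, pr_sym (transl (a, c)) (E := fun ω => HC ω 0 (b - a) 0 (d - c)) dep_HC.isLocal, hp]

lemma pr_VC (a b c d : ℤ) : pr (fun ω => VC ω a b c d) = hp (d - c) (b - a) := by
  have : (fun ω => VC ω a b c d) = fun ω => HC (ω ∘ transp.j) c d a b := by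
    funext ω
    exact propext VC_transp
  rw [this, pr_sym transp (E := fun ω => HC ω c d a b) dep_HC.isLocal, pr_HC]

lemma pr_HC_star (a b c d : ℤ) : pr (fun ω => HC (star ω) a b c d) = hp (b - a) (d - c) := by
  rw [pr_star (E := fun ω => HC ω a b c d) dep_HC.isLocal, pr_HC]

lemma pr_VC_star (a b c d : ℤ) : pr (fun ω => VC (star ω) a b c d) = hp (d - c) (b - a) := by
  rw [pr_star (E := fun ω => VC ω a b c d) dep_VC.isLocal, pr_VC]

lemma openAdj_near (h : openAdj η x y) : x.1 ≤ y.1 + 1 ∧ y.1 ≤ x.1 + 1 ∧ x.2 ≤ y.2 + 1 ∧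
    y.2 ≤ x.2 + 1 ∧ (x.1 = y.1 ∨ x.2 = y.2) := by
  rw [openAdj_iff] at h
  rcases h with ⟨_, rfl⟩ | ⟨_, rfl⟩ | ⟨_, rfl⟩ | ⟨_, rfl⟩ <;> dsimp only <;> omega

/-- A path across a vertical strip contains a crossing of it. -/
lemma Con.trim (h : Con η S x y) (hab : a ≤ b) (hx : x.1 ≤ a) (hy : b ≤ y.1) :
    ∃ x' y', x'.1 = a ∧ y'.1 = b ∧ Con η (S ∩ {z | a ≤ z.1 ∧ z.1 ≤ b}) x' y' := by
  obtain ⟨y', hy', h1⟩ : ∃ y', y'.1 = b ∧ Con η (S ∩ {z | z.1 ≤ b}) x y' := by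
    rcases hab.trans' hx |>.lt_or_eq with hlt | heq
    · obtain ⟨v, w, h1, h2, h3, h4⟩ := h.first_entry (Z := {z | b ≤ z.1}) (not_le.2 hlt) hy
      have h5 := h1.right_mem.2
      have h6 := openAdj_near h2
      simp only [Set.mem_ofPred_eq, not_le] at h3 h5
      refine ⟨w, by omega, (h1.mono_set ?_).tail h2 ⟨h1.right_mem.1, h5.le⟩ ⟨h4, ?_⟩⟩
      · rintro z ⟨hz, hz'⟩
        exact ⟨hz, le_of_not_ge (α := ℤ) hz'⟩
      · simp only [Set.mem_ofPred_eq]; omega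
    · exact ⟨x, heq, Con.refl ⟨h.left_mem, heq.le⟩⟩
  rcases (hab.trans_eq hy'.symm).lt_or_eq with hlt | heq
  · rcases hx.lt_or_eq with hlx | hex
    · obtain ⟨v, w, h2, h3, h4, h5⟩ := h1.symm.first_entry (Z := {z | z.1 ≤ a}) (not_le.2 hlt) hx
      have h6 := h2.right_mem.2
      have h7 := openAdj_near h3
      simp only [Set.mem_ofPred_eq, not_le] at h4 h6
      refine ⟨w, y', by omega, hy', Con.symm ((h2.mono_set ?_).tail h3 ?_ ?_)⟩
      · rintro z ⟨⟨hz, hz'⟩, hz''⟩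
        exact ⟨hz, le_of_not_ge (α := ℤ) hz'', hz'⟩
      · exact ⟨h2.right_mem.1.1, h6.le, h2.right_mem.1.2⟩
      · have := h5.2
        simp only [Set.mem_ofPred_eq] at this
        exact ⟨h5.1, by omega, this⟩
    · obtain ⟨v, w, h2, h3, h4, h5⟩ := h1.symm.first_entry (Z := {z | z.1 ≤ a}) (not_le.2 hlt) hx
      have h6 := h2.right_mem.2
      have h7 := openAdj_near h3
      simp only [Set.mem_ofPred_eq, not_le] at h4 h6
      refine ⟨w, y', by omega, hy', Con.symm ((h2.mono_set ?_).tail h3 ?_ ?_)⟩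
      · rintro z ⟨⟨hz, hz'⟩, hz''⟩
        exact ⟨hz, le_of_not_ge (α := ℤ) hz'', hz'⟩
      · exact ⟨h2.right_mem.1.1, h6.le, h2.right_mem.1.2⟩
      · have := h5.2
        simp only [Set.mem_ofPred_eq] at this
        exact ⟨h5.1, by omega, this⟩
  · exact ⟨y', y', heq.symm, hy', Con.refl ⟨h1.right_mem.1, heq.le, hy'.le⟩⟩

lemma Con.trim_vert (h : Con η S x y) (hcd : c ≤ d) (hx : x.2 ≤ c) (hy : d ≤ y.2) :
    ∃ x' y', x'.2 = c ∧ y'.2 = d ∧ Con η (S ∩ {z | c ≤ z.2 ∧ z.2 ≤ d}) x' y' := by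
  have h' := (transp.con' (S' := transp.g ⁻¹' S) (x' := (x.2, x.1)) (y' := (y.2, y.1))
    (fun z => Iff.rfl) rfl rfl).1 h
  obtain ⟨x', y', hx', hy', h''⟩ := h'.trim hcd hx hy
  refine ⟨(x'.2, x'.1), (y'.2, y'.1), hx', hy', ?_⟩
  exact (transp.con' (S' := transp.g ⁻¹' S ∩ {z | c ≤ z.1 ∧ z.1 ≤ d}) (x' := x') (y' := y')
    (fun z => Iff.rfl) rfl rfl).2 h''

lemma HC_of_con (h : Con η S x y) (hS : ∀ z ∈ S, c ≤ z.2 ∧ z.2 ≤ d) (hab : a ≤ b)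
    (hx : x.1 ≤ a) (hy : b ≤ y.1) : HC η a b c d := by
  obtain ⟨x', y', hx', hy', h'⟩ := h.trim hab hx hy
  exact ⟨x', y', hx', hy', h'.mono_set fun z hz =>
    ⟨hz.2.1, hz.2.2, (hS z hz.1).1, (hS z hz.1).2⟩⟩

lemma VC_of_con (h : Con η S x y) (hS : ∀ z ∈ S, a ≤ z.1 ∧ z.1 ≤ b) (hcd : c ≤ d)
    (hx : x.2 ≤ c) (hy : d ≤ y.2) : VC η a b c d := by
  obtain ⟨x', y', hx', hy', h'⟩ := h.trim_vert hcd hx hy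
  exact ⟨x', y', hx', hy', h'.mono_set fun z hz =>
    ⟨(hS z hz.1).1, (hS z hz.1).2, hz.2.1, hz.2.2⟩⟩

lemma HC.mono {a' b' c' d' : ℤ} (h : HC η a b c d) (ha : a ≤ a') (hb : b' ≤ b) (hab : a' ≤ b')
    (hc : c' ≤ c) (hd : d ≤ d') : HC η a' b' c' d' := by
  obtain ⟨x, y, hx, hy, h⟩ := h
  refine HC_of_con h (fun z hz => ?_) hab (by omega) (by omega)
  simp only [mem_Box] at hz
  omega

lemma hp_mono {w w' h h' : ℤ} (hw : w' ≤ w) (hw' : 0 ≤ w') (hh : h ≤ h') : hp w h ≤ hp w' h' :=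
  pr_mono dep_HC.isLocal dep_HC.isLocal fun _ hc => hc.mono le_rfl hw hw' le_rfl hh

/-- A column of a rectangle. -/
def Col (a b c d i : ℤ) : Set Vertex := {z ∈ Box a b c d | z.1 = i}

lemma mem_Col {i : ℤ} {z : Vertex} : z ∈ Col a b c d i ↔ z ∈ Box a b c d ∧ z.1 = i := Iff.rfl

lemma Col_connected {i : ℤ} (hi : a ≤ i ∧ i ≤ b) :
    ∀ x ∈ Col a b c d i, ∀ y ∈ Col a b c d i, Con full (Col a b c d i) x y := by
  have : Col a b c d i = Box i i c d := by
    ext z; simp only [mem_Col, mem_Box]; omega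
  rw [this]
  exact fun x hx y hy => Box_connected hx hy

/-- Exploration of a rectangle from one of its sides. -/
lemma explores_col {i j : ℤ} (hij : i = a ∧ j = b ∨ i = b ∧ j = a) (hab : a < b) (hcd : c ≤ d)
    (hno : ¬ HC ω a b c d) :
    Explores ω (Box a b c d) (Col a b c d i) (Col a b c d i) (Col a b c d j) where
  hA := fun z hz => hz.1
  hL := le_rfl
  hR := fun z hz => hz.1
  neA := ⟨(i, c), by
    refine mem_Col.2 ⟨?_, rfl⟩
    simp only [mem_Box]
    rcases hij with ⟨rfl, rfl⟩ | ⟨rfl, rfl⟩ <;> omega⟩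
  conA := Col_connected (by omega)
  conR := Col_connected (by omega)
  exit := fun x hx _ _ _ _ => hx
  disj := fun x hx hx' => by have h1 := hx.2; have h2 := hx'.2; omega
  noCon := fun x hx y hy h => by
    rcases hij with ⟨rfl, rfl⟩ | ⟨rfl, rfl⟩
    · exact hno ⟨x, y, hx.2, hy.2, h⟩
    · exact hno ⟨y, x, hy.2, hx.2, h.symm⟩

/-- In each row there is a transition between the two sides of the interface. -/
lemma exists_transition {i j : ℤ} {N : Set Vertex} (hij : i = a ∧ j = b ∨ i = b ∧ j = a)
    (hab : a < b) (hi : ∀ z ∈ Col a b c d i, z ∉ N) (hj : ∀ z ∈ Col a b c d j, z ∈ N) {r : ℤ}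
    (hr : c ≤ r ∧ r ≤ d) :
    ∃ k, a ≤ k ∧ k ≤ b - 1 ∧ (((k, r) ∈ N ∧ (k + 1, r) ∉ N) ∨ ((k, r) ∉ N ∧ (k + 1, r) ∈ N)) := by
  by_contra hcon
  push Not at hcon
  have key : ∀ n : ℕ, a + n ≤ b → ((a + n, r) ∈ N ↔ (a, r) ∈ N) := by
    intro n
    induction n with
    | zero => simp
    | succ n ih =>
      intro hn
      push_cast at hn ⊢
      have h1 := hcon (a + n) (by omega) (by omega)
      rw [← ih (by omega), ← add_assoc]
      tauto
  have h1 := key (b - a).toNat (by omega)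
  have e1 : a + ((b - a).toNat : ℤ) = b := by omega
  rw [e1] at h1
  have h2 := hi (i, r) (by
    refine mem_Col.2 ⟨?_, rfl⟩
    simp only [mem_Box]
    rcases hij with ⟨rfl, rfl⟩ | ⟨rfl, rfl⟩ <;> omega)
  have h3 := hj (j, r) (by
    refine mem_Col.2 ⟨?_, rfl⟩
    simp only [mem_Box]
    rcases hij with ⟨rfl, rfl⟩ | ⟨rfl, rfl⟩ <;> omega)
  rcases hij with ⟨rfl, rfl⟩ | ⟨rfl, rfl⟩ <;> tauto

/-- The region not explored from column `i` of a rectangle, seen from column `j`. -/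
def colN (ω : Config) (a b c d i j : ℤ) : Set Vertex :=
  unexplored ω (Box a b c d) (Col a b c d i) (Col a b c d i) (Col a b c d j)

lemma colN_wall {i j : ℤ} (hij : i = a ∧ j = b ∨ i = b ∧ j = a) (hab : a < b) (hcd : c ≤ d)
    (hno : ¬ HC ω a b c d) {f g : Vertex} (hf : f ∈ Box a (b - 1) c (d - 1))
    (hg : g ∈ Box a (b - 1) c (d - 1)) (hfN : Mixed (colN ω a b c d i j) f)
    (hgN : Mixed (colN ω a b c d i j) g) : Con (star ω) (Box a (b - 1) c (d - 1)) f g := by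
  refine (explores_col hij hab hcd hno).wall_connected ?_ hf hg hfN hgN
  rcases hij with ⟨rfl, rfl⟩ | ⟨rfl, rfl⟩
  · exact .inl fun z hz hz' => ⟨hz, hz'⟩
  · exact .inr fun z hz hz' => ⟨hz, hz'⟩

lemma colN_transition {i j : ℤ} (hij : i = a ∧ j = b ∨ i = b ∧ j = a) (hab : a < b) (hcd : c ≤ d)
    (hno : ¬ HC ω a b c d) {r : ℤ} (hr : c ≤ r ∧ r ≤ d) :
    ∃ k, a ≤ k ∧ k ≤ b - 1 ∧ (((k, r) ∈ colN ω a b c d i j ∧ (k + 1, r) ∉ colN ω a b c d i j) ∨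
      ((k, r) ∉ colN ω a b c d i j ∧ (k + 1, r) ∈ colN ω a b c d i j)) :=
  exists_transition hij hab (fun _ hz => Explores.notMem_of_mem hz)
    (fun _ hz => (explores_col hij hab hcd hno).R_sub hz) hr

lemma colN_mixed {i j : ℤ} (hij : i = a ∧ j = b ∨ i = b ∧ j = a) (hab : a < b) (hcd : c ≤ d)
    (hno : ¬ HC ω a b c d) {r : ℤ} (hr : c ≤ r ∧ r ≤ d) :
    ∃ k, a ≤ k ∧ k ≤ b - 1 ∧ Mixed (colN ω a b c d i j) (k, r) ∧
      Mixed (colN ω a b c d i j) (k, r - 1) ∧ ω ((k, r), false) = false := by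
  obtain ⟨k, h1, h2, h3⟩ := colN_transition hij hab hcd hno hr
  refine ⟨k, h1, h2, ?_, ?_, ?_⟩
  · simp only [Mixed]; tauto
  · simp only [Mixed, sub_add_cancel]; tauto
  · have hcl := (explores_col hij hab hcd hno).closed
    have m1 : (k, r) ∈ Box a b c d := by simp only [mem_Box]; omega
    have m2 : (k + 1, r) ∈ Box a b c d := by simp only [mem_Box]; omega
    rw [← Bool.not_eq_true]
    intro h
    rcases h3 with ⟨h3, h4⟩ | ⟨h3, h4⟩
    · exact hcl _ h3 _ m2 h4 (openAdj_right (x := (k, r)) h)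
    · exact hcl _ h4 _ m1 h3 (openAdj_symm (openAdj_right (x := (k, r)) h))

/-- Without a horizontal primal crossing there is a vertical dual one. -/
lemma VC_star_of_not_HC (hab : a < b) (hcd : c < d) (hno : ¬ HC ω a b c d) :
    VC (star ω) a (b - 1) (c - 1) d := by
  obtain ⟨k, h1, h2, h3, h3', h4⟩ := colN_mixed (.inl ⟨rfl, rfl⟩) hab hcd.le hno (r := c) (by omega)
  obtain ⟨l, g1, g2, g3, g3', g4⟩ := colN_mixed (.inl ⟨rfl, rfl⟩) hab hcd.le hno (r := d) (by omega)
  have h5 := colN_wall (.inl ⟨rfl, rfl⟩) hab hcd.le hno (f := (k, c)) (g := (l, d - 1))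
    (by simp only [mem_Box]; omega) (by simp only [mem_Box]; omega) h3 g3'
  refine ⟨(k, c - 1), (l, d), rfl, rfl, ?_⟩
  have h6 : Con (star ω) (Box a (b - 1) (c - 1) d) (k, c) (l, d - 1) := h5.mono_set fun z hz => by
    simp only [mem_Box] at hz ⊢; omega
  have s1 : openAdj (star ω) (k, c - 1) (k, c) := by
    simpa using openAdj_up (η := star ω) (x := (k, c - 1)) (by simp [h4])
  have s2 : openAdj (star ω) (l, d - 1) (l, d) := by
    simpa using openAdj_up (η := star ω) (x := (l, d - 1)) (by simp [g4])
  exact ((Con.step s1 (by simp only [mem_Box]; omega) h6.left_mem).trans h6).tail s2 h6.right_mem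
    (by simp only [mem_Box]; omega)

lemma not_HC_of_VC_star (h : VC (star ω) a (b - 1) (c - 1) d) : ¬ HC ω a b c d := by
  rintro ⟨x, y, hx, hy, hc⟩
  obtain ⟨u, v, hu, hv, hd⟩ := h
  refine not_hcross_vcross (a := a) (b := b) (c := c) (d := d) hc hd ?_ ?_ hx.le hy.ge (by omega)
    hv.ge
  · intro z hz; simp only [mem_Box] at hz; omega
  · intro z hz; simp only [mem_Box] at hz; omega

lemma hp_dual {n : ℤ} (hn : 0 < n) : hp (n + 1) n = 1 / 2 := by
  have h1 := pr_not (E := fun ω => HC ω 0 (n + 1) 0 n) dep_HC.isLocal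
  have h2 : (fun ω => ¬ HC ω 0 (n + 1) 0 n) = fun ω => VC (star ω) 0 (n + 1 - 1) (0 - 1) n := by
    funext ω
    exact propext ⟨VC_star_of_not_HC (by omega) hn, not_HC_of_VC_star⟩
  rw [h2, pr_VC_star] at h1
  have e1 : n - (0 - 1) = n + 1 := by ring
  have e2 : n + 1 - 1 - 0 = n := by ring
  rw [e1, e2] at h1
  have h3 : hp (n + 1) n = pr (fun ω => HC ω 0 (n + 1) 0 n) := rfl
  linarith

lemma hp_ge_half {w h : ℤ} (hw : 0 ≤ w) (hh : 0 < h) (hwh : w ≤ h + 1) : 1 / 2 ≤ hp w h := by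
  rw [← hp_dual hh]
  exact hp_mono hwh hw le_rfl

end Crossings

section RSW

/-- The composition of two lattice symmetries. -/
def LatticeSym.comp (σ τ : LatticeSym) : LatticeSym where
  g := τ.g.trans σ.g
  j := σ.j ∘ τ.j
  inj := σ.inj.comp τ.inj
  adj := fun η x y => (τ.adj (η ∘ σ.j) x y).trans (σ.adj η _ _)

/-- The reflection `(x, y) ↦ (x, m - y)`. -/
def reflY (m : ℤ) : LatticeSym := transp.comp ((reflX m).comp transp)

lemma reflY_g (m : ℤ) (v : Vertex) : (reflY m).g v = (v.1, m - v.2) := rfl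

lemma reflX_g (m : ℤ) (v : Vertex) : (reflX m).g v = (m - v.1, v.2) := rfl

lemma star_comp_reflY (ω : Config) (m : ℤ) :
    star (ω ∘ (reflY m).j) = star ω ∘ (reflY (m - 1)).j := by
  change star (((ω ∘ transp.j) ∘ (reflX m).j) ∘ transp.j) =
    ((star ω ∘ transp.j) ∘ (reflX (m - 1)).j) ∘ transp.j
  rw [star_comp_transp, star_comp_reflX, star_comp_transp]

/-- The faces having a corner in `Z`. -/
def touch (Z : Set Vertex) : Set Vertex :=
  {f | f ∈ Z ∨ (f.1 + 1, f.2) ∈ Z ∨ (f.1, f.2 + 1) ∈ Z ∨ (f.1 + 1, f.2 + 1) ∈ Z}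

lemma mem_touch {Z : Set Vertex} {f : Vertex} : f ∈ touch Z ↔
    f ∈ Z ∨ (f.1 + 1, f.2) ∈ Z ∨ (f.1, f.2 + 1) ∈ Z ∨ (f.1 + 1, f.2 + 1) ∈ Z := Iff.rfl

/-- The edges that have no endpoint in `Z`. -/
def off (Z : Set Vertex) : Set Edge := {e | (ends e).1 ∉ Z ∧ (ends e).2 ∉ Z}

variable {ω ω' : Config} {Z : Set Vertex} {x y : Vertex}

lemma openAdj_star_congr (hω : ∀ e ∈ off Z, ω e = ω' e) (hx : x ∉ touch Z)
    (h : openAdj (star ω) x y) : openAdj (star ω') x y := by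
  rw [mem_touch] at hx
  push Not at hx
  obtain ⟨h1, h2, h3, h4⟩ := hx
  rw [openAdj_iff] at h ⊢
  simp only [star_false, star_true] at h ⊢
  rcases h with ⟨h, rfl⟩ | ⟨h, rfl⟩ | ⟨h, rfl⟩ | ⟨h, rfl⟩
  · rw [hω _ (by simp [off, ends, *])] at h; simp [h]
  · rw [hω _ (by simp [off, ends, *])] at h; simp [h]
  · rw [hω _ (by simp_all [off, ends])] at h; simp [h]
  · rw [hω _ (by simp_all [off, ends])] at h; simp [h]

lemma Con.star_congr {B : Set Vertex} (hω : ∀ e ∈ off Z, ω e = ω' e)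
    (h : Con (star ω) (B \ touch Z) x y) : Con (star ω') (B \ touch Z) x y :=
  h.mono' le_rfl fun _ ha _ _ hab => openAdj_star_congr hω ha.2 hab

/-- Crossing a boundary between faces touching `Z` and faces not touching `Z`. -/
lemma exists_corner_notMem (h : openAdj (star ω) x y) (hx : x ∉ touch Z) :
    y ∉ Z ∨ (y.1 + 1, y.2) ∉ Z ∨ (y.1, y.2 + 1) ∉ Z ∨ (y.1 + 1, y.2 + 1) ∉ Z := by
  rw [mem_touch] at hx
  push Not at hx
  obtain ⟨h1, h2, h3, h4⟩ := hx
  rw [openAdj_iff] at h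
  rcases h with ⟨h, rfl⟩ | ⟨h, rfl⟩ | ⟨h, rfl⟩ | ⟨h, rfl⟩ <;> simp_all

/-- The complement of `N` in a rectangle, together with its reflection. -/
def mirror (n : ℤ) (N : Set Vertex) : Set Vertex :=
  {z | (z ∈ Box 0 (n + 1) 0 n ∧ z ∉ N) ∨
    ((z.1, 2 * n - z.2) ∈ Box 0 (n + 1) 0 n ∧ (z.1, 2 * n - z.2) ∉ N)}

lemma mirror_refl {n : ℤ} {N : Set Vertex} (a b : ℤ) :
    (a, 2 * n - b) ∈ mirror n N ↔ (a, b) ∈ mirror n N := by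
  have e : 2 * n - (2 * n - b) = b := by ring
  simp only [mirror, Set.mem_ofPred_eq]
  rw [e]
  exact or_comm

lemma touch_mirror_refl {n : ℤ} {N : Set Vertex} (a b : ℤ) :
    (a, 2 * n - 1 - b) ∈ touch (mirror n N) ↔ (a, b) ∈ touch (mirror n N) := by
  simp only [mem_touch]
  have e1 : 2 * n - 1 - b = 2 * n - (b + 1) := by ring
  have e2 : 2 * n - (b + 1) + 1 = 2 * n - b := by ring
  rw [e1, e2, mirror_refl, mirror_refl, mirror_refl, mirror_refl]
  tauto

lemma mirror_low {n : ℤ} {N : Set Vertex} {z : Vertex} (hz : z ∈ Box 0 (n + 1) 0 n) :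
    z ∈ mirror n N ↔ z ∉ N := by
  refine ⟨fun h => ?_, fun h => .inl ⟨hz, h⟩⟩
  rcases h with h | ⟨h, hm⟩
  · exact h.2
  · simp only [mem_Box] at h hz
    have : 2 * n - z.2 = z.2 := by omega
    rwa [this] at hm

/-- The path leaving the lower half of the mirrored region. -/
def LowArm (n : ℤ) (N : Set Vertex) (ω : Config) : Prop :=
  ∃ f g y : Vertex, f ∈ Box 0 n 0 (n - 1) ∧ Mixed N f ∧ openAdj (star ω) f g ∧ y.1 = 2 * n - 1 ∧
    Con (star ω) (Box (-1) (2 * n - 1) 0 (2 * n - 1) \ touch (mirror n N)) g y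

lemma dep_lowArm {n : ℤ} {N : Set Vertex} : Dep (off (mirror n N)) (LowArm n N) := by
  rintro ω ω' hω ⟨f, g, y, h1, h2, h3, h4, h5⟩
  exact ⟨f, g, y, h1, h2, openAdj_symm (openAdj_star_congr hω h5.left_mem.2 (openAdj_symm h3)), h4,
    h5.star_congr hω⟩

lemma mixed_of_touch_mirror {n : ℤ} {N : Set Vertex} {f g : Vertex} (hf : f ∈ Box 0 n 0 (n - 1))
    (hft : f ∈ touch (mirror n N)) (hg : g ∉ touch (mirror n N)) (h : openAdj (star ω) f g) :
    Mixed N f := by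
  have h1 := exists_corner_notMem (openAdj_symm h) hg
  rw [mem_touch] at hft
  have c1 : f ∈ Box 0 (n + 1) 0 n := by simp only [mem_Box] at hf ⊢; omega
  have c2 : (f.1 + 1, f.2) ∈ Box 0 (n + 1) 0 n := by simp only [mem_Box] at hf ⊢; omega
  have c3 : (f.1, f.2 + 1) ∈ Box 0 (n + 1) 0 n := by simp only [mem_Box] at hf ⊢; omega
  have c4 : (f.1 + 1, f.2 + 1) ∈ Box 0 (n + 1) 0 n := by simp only [mem_Box] at hf ⊢; omega
  rw [mirror_low c1, mirror_low c2, mirror_low c3, mirror_low c4] at h1 hft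
  push Not at h1
  exact ⟨h1, hft⟩

lemma lowArm_or {n : ℤ} {N : Set Vertex} (hn : 2 ≤ n)
    (h0 : ∀ z ∈ Col 0 (n + 1) 0 n 0, z ∉ N) (h1 : ∀ z ∈ Col 0 (n + 1) 0 n (n + 1), z ∈ N)
    (h : HC (star ω) (-1) (2 * n - 1) 0 (2 * n - 1)) :
    LowArm n N ω ∨ LowArm n N (ω ∘ (reflY (2 * n)).j) := by
  obtain ⟨x, y, hx, hy, h⟩ := h
  have hZ : ∀ z ∈ mirror n N, z.1 ≤ n := by
    rintro z hz
    by_contra hcon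
    rcases hz with ⟨hz, hz'⟩ | ⟨hz, hz'⟩
    · simp only [mem_Box] at hz
      exact hz' (h1 z ⟨by simp only [mem_Box]; omega, by omega⟩)
    · simp only [mem_Box] at hz
      exact hz' (h1 _ ⟨by simp only [mem_Box]; omega, by dsimp only; omega⟩)
  have hZ0 : ∀ b, 0 ≤ b → b ≤ 2 * n → ((0, b) : Vertex) ∈ mirror n N := by
    intro b hb hb'
    by_cases hbn : b ≤ n
    · exact .inl ⟨by simp only [mem_Box]; omega, h0 _ ⟨by simp only [mem_Box]; omega, rfl⟩⟩
    · exact .inr ⟨by simp only [mem_Box]; omega, h0 _ ⟨by simp only [mem_Box]; omega, rfl⟩⟩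
  have htx : ∀ v ∈ Box (-1) (2 * n - 1) 0 (2 * n - 1), v.1 ≤ 0 → v ∈ touch (mirror n N) := by
    rintro ⟨a, b⟩ hv hv0
    simp only [mem_Box] at hv hv0
    rw [mem_touch]
    have : a = -1 ∨ a = 0 := by omega
    rcases this with rfl | rfl
    · exact .inr (.inl (by simpa using hZ0 b (by omega) (by omega)))
    · exact .inl (hZ0 b (by omega) (by omega))
  have hty : ∀ v ∈ touch (mirror n N), v.1 ≤ n := by
    intro v hv
    rw [mem_touch] at hv
    rcases hv with hv | hv | hv | hv <;> have h3 := hZ _ hv <;> omega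
  obtain ⟨v, w, g1, g2, g3, g4⟩ := h.symm.first_entry (Z := touch (mirror n N))
    (fun hyt => by have := hty y hyt; omega) (htx x h.left_mem (by omega))
  have hv0 : 0 < v.1 := by
    by_contra hcon
    exact g1.right_mem.2 (htx v g1.right_mem.1 (by omega))
  have hnear := openAdj_near g2
  have hwn := hty w g3
  have g4' := g4
  rw [mem_Box] at g4'
  by_cases hlow : w.2 ≤ n - 1
  · have hwb : w ∈ Box 0 n 0 (n - 1) := by simp only [mem_Box]; omega
    exact .inl ⟨w, v, y, hwb, mixed_of_touch_mirror hwb g3 g1.right_mem.2 (openAdj_symm g2),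
      openAdj_symm g2, hy, g1.symm⟩
  · right
    set σ := reflY (2 * n - 1) with hσ
    have e1 : star (ω ∘ (reflY (2 * n)).j) = star ω ∘ σ.j := star_comp_reflY _ _
    have key : ∀ u : Vertex, σ.g (u.1, 2 * n - 1 - u.2) = u := by
      intro u; rw [hσ, reflY_g]; simp
    have hwb : ((w.1, 2 * n - 1 - w.2) : Vertex) ∈ Box 0 n 0 (n - 1) := by
      simp only [mem_Box]; omega
    have hadj : openAdj (star (ω ∘ (reflY (2 * n)).j)) (w.1, 2 * n - 1 - w.2)
        (v.1, 2 * n - 1 - v.2) := by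
      rw [e1, σ.adj, key, key]; exact openAdj_symm g2
    refine ⟨(w.1, 2 * n - 1 - w.2), (v.1, 2 * n - 1 - v.2), (y.1, 2 * n - 1 - y.2), hwb,
      mixed_of_touch_mirror hwb ((touch_mirror_refl _ _).2 g3)
        (mt (touch_mirror_refl _ _).1 g1.right_mem.2) hadj, hadj, hy, ?_⟩
    rw [e1]
    refine (σ.con' (fun z => ?_) (key v).symm (key y).symm).1 g1.symm
    have e2 : σ.g z = (z.1, 2 * n - 1 - z.2) := rfl
    rw [e2, Set.mem_sdiff, Set.mem_sdiff, touch_mirror_refl]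
    refine and_congr_left fun _ => ?_
    simp only [mem_Box]
    omega

lemma pr_lowArm {n : ℤ} {N : Set Vertex} (hn : 2 ≤ n)
    (h0 : ∀ z ∈ Col 0 (n + 1) 0 n 0, z ∉ N) (h1 : ∀ z ∈ Col 0 (n + 1) 0 n (n + 1), z ∈ N)
    (hloc : IsLocal (LowArm n N)) : 1 / 4 ≤ pr (LowArm n N) := by
  have h2 : 1 / 2 ≤ pr (fun ω => HC (star ω) (-1) (2 * n - 1) 0 (2 * n - 1)) := by
    rw [pr_HC_star]
    exact hp_ge_half (by omega) (by omega) (by omega)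
  have hloc' : IsLocal (fun ω => LowArm n N (ω ∘ (reflY (2 * n)).j)) := hloc.comp _
  have h3 := pr_mono (E := fun ω => HC (star ω) (-1) (2 * n - 1) 0 (2 * n - 1))
    (E' := fun ω => LowArm n N ω ∨ LowArm n N (ω ∘ (reflY (2 * n)).j))
    (dep_HC.isLocal.star (E := fun ω => HC ω (-1) (2 * n - 1) 0 (2 * n - 1)))
    (hloc.or hloc') fun ω h => lowArm_or hn h0 h1 h
  have h4 := pr_or_le hloc hloc'
  rw [pr_sym _ hloc] at h4
  linarith

/-- A vertical crossing of a rectangle connected to the right side of a larger one. -/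
def Hook (n : ℤ) (η : Config) : Prop :=
  ∃ t b f y : Vertex, t.2 = n - 1 ∧ b.2 = 0 ∧ y.1 = 2 * n - 1 ∧
    Con η (Box 0 n 0 (n - 1)) b t ∧ Con η (Box 0 n 0 (n - 1)) b f ∧
    Con η (Box (-1) (2 * n - 1) 0 (2 * n - 1)) f y

lemma dep_hook {n : ℤ} (hn : 2 ≤ n) :
    Dep (loc (Box (-1) (2 * n - 1) 0 (2 * n - 1))) (Hook n) := by
  rintro ω ω' hω ⟨t, b, f, y, h1, h2, h3, h4, h5, h6⟩
  have hs : loc (Box 0 n 0 (n - 1)) ⊆ loc (Box (-1) (2 * n - 1) 0 (2 * n - 1)) :=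
    loc_mono fun z hz => by simp only [mem_Box] at hz ⊢; omega
  exact ⟨t, b, f, y, h1, h2, h3, dep_con.mono hs _ _ hω h4, dep_con.mono hs _ _ hω h5,
    dep_con _ _ hω h6⟩

lemma incr_hook {n : ℤ} : Incr (Hook n) := by
  rintro ω ω' hω ⟨t, b, f, y, h1, h2, h3, h4, h5, h6⟩
  exact ⟨t, b, f, y, h1, h2, h3, h4.incr hω, h5.incr hω, h6.incr hω⟩

lemma hook_of_lowArm {n : ℤ} (hn : 2 ≤ n) (hno : ¬ HC ω 0 (n + 1) 0 n)
    (h : LowArm n (colN ω 0 (n + 1) 0 n 0 (n + 1)) ω) : Hook n (star ω) := by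
  have hij : (0 : ℤ) = 0 ∧ n + 1 = n + 1 ∨ (0 : ℤ) = n + 1 ∧ n + 1 = 0 := .inl ⟨rfl, rfl⟩
  obtain ⟨f, g, y, hf, hfm, hfg, hy, hc⟩ := h
  obtain ⟨k, k1, k2, k3, k3', -⟩ := colN_mixed hij (by omega) (by omega) hno (r := 0) (by omega)
  obtain ⟨l, l1, l2, l3, l3', -⟩ := colN_mixed hij (by omega) (by omega) hno (r := n) (by omega)
  have e : n + 1 - 1 = n := by ring
  have hb : (k, (0 : ℤ)) ∈ Box 0 (n + 1 - 1) 0 (n - 1) := by simp only [mem_Box]; omega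
  have ht : (l, n - 1) ∈ Box 0 (n + 1 - 1) 0 (n - 1) := by simp only [mem_Box]; omega
  have w1 := colN_wall hij (by omega) (by omega) hno hb ht k3 l3'
  have w2 := colN_wall hij (by omega) (by omega) hno hb (e.symm ▸ hf) k3 hfm
  rw [e] at w1 w2
  refine ⟨_, _, f, y, rfl, rfl, hy, w1, w2, ?_⟩
  have hc' := hc.mono_set (S' := Box (-1) (2 * n - 1) 0 (2 * n - 1)) fun z hz => hz.1
  exact (Con.step hfg (by simp only [mem_Box] at hf ⊢; omega) hc'.left_mem).trans hc'

lemma Box_finite (a b c d : ℤ) : (Box a b c d).Finite :=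
  ((Set.finite_Icc a b).prod (Set.finite_Icc c d)).subset fun z hz => by
    simp only [mem_Box] at hz; simp only [Set.mem_prod, Set.mem_Icc]; omega

/-- The values of the exploration of a rectangle from column `i`. -/
lemma exists_colValues (a b c d i j : ℤ) : ∃ T : Finset (Set Vertex), ∀ N, N ∈ T ↔
    N ⊆ Box a b c d ∧ (∀ z ∈ Col a b c d i, z ∉ N) ∧ (∀ z ∈ Col a b c d j, z ∈ N) := by
  refine ⟨(Set.Finite.subset (Box_finite a b c d).finite_subsets (t := {N | N ⊆ Box a b c d ∧
    (∀ z ∈ Col a b c d i, z ∉ N) ∧ (∀ z ∈ Col a b c d j, z ∈ N)}) fun N hN => hN.1).toFinset,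
    fun N => ?_⟩
  simp

lemma colN_values {a b c d i j : ℤ} (hij : i = a ∧ j = b ∨ i = b ∧ j = a) (hab : a < b)
    (hcd : c ≤ d) (hno : ¬ HC ω a b c d) : colN ω a b c d i j ⊆ Box a b c d ∧
      (∀ z ∈ Col a b c d i, z ∉ colN ω a b c d i j) ∧
      (∀ z ∈ Col a b c d j, z ∈ colN ω a b c d i j) :=
  ⟨(explores_col hij hab hcd hno).sub, fun _ hz => Explores.notMem_of_mem hz,
    fun _ hz => (explores_col hij hab hcd hno).R_sub hz⟩

lemma colN_congr {a b c d i j : ℤ} (hij : i = a ∧ j = b ∨ i = b ∧ j = a) (hab : a < b)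
    (hcd : c ≤ d) (hno : ¬ HC ω a b c d)
    (hω : ∀ e : Edge, (ends e).1 ∈ Box a b c d → (ends e).2 ∈ Box a b c d →
      ((ends e).1 ∉ colN ω a b c d i j ∨ (ends e).2 ∉ colN ω a b c d i j) → ω e = ω' e) :
    ¬ HC ω' a b c d ∧ colN ω' a b c d i j = colN ω a b c d i j := by
  obtain ⟨h1, h2⟩ := unexplored_congr (explores_col hij hab hcd hno) hω
  refine ⟨?_, h1⟩
  rintro ⟨x, y, hx, hy, h⟩
  rcases hij with ⟨rfl, rfl⟩ | ⟨rfl, rfl⟩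
  · exact h2.noCon x ⟨h.left_mem, hx⟩ y ⟨h.right_mem, hy⟩ h
  · exact h2.noCon y ⟨h.right_mem, hy⟩ x ⟨h.left_mem, hx⟩ h.symm

/-- The event that an exploration takes a given value depends on the explored edges only. -/
lemma inv_colN {a b c d i j : ℤ} (hij : i = a ∧ j = b ∨ i = b ∧ j = a) (hab : a < b)
    (hcd : c ≤ d) {N : Set Vertex} {G : Set Edge}
    (hG : ∀ e ∈ G, ¬ ((ends e).1 ∈ Box a b c d ∧ (ends e).2 ∈ Box a b c d ∧
      ((ends e).1 ∉ N ∨ (ends e).2 ∉ N))) :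
    Inv G (ind fun ω => ¬ HC ω a b c d ∧ colN ω a b c d i j = N) := by
  have key : ∀ ω ω' : Config, (∀ e ∉ G, ω e = ω' e) →
      (¬ HC ω a b c d ∧ colN ω a b c d i j = N) → ¬ HC ω' a b c d ∧ colN ω' a b c d i j = N := by
    rintro ω ω' hω ⟨h1, rfl⟩
    exact colN_congr hij hab hcd h1 fun e e1 e2 e3 => hω e fun he => hG e he ⟨e1, e2, e3⟩
  exact fun ω ω' hω => ind_congr ⟨key ω ω' hω, key ω' ω fun e he => (hω e he).symm⟩

lemma dep_lowArm_loc {n : ℤ} {N : Set Vertex} :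
    Dep (loc (Box (-1) (2 * n) 0 (2 * n))) (LowArm n N) := by
  have h : Dep (loc (Box (-1) (2 * n - 1) 0 (2 * n - 1))) (fun η => ∃ f g y : Vertex,
      f ∈ Box 0 n 0 (n - 1) ∧ Mixed N f ∧ openAdj η f g ∧ y.1 = 2 * n - 1 ∧
      Con η (Box (-1) (2 * n - 1) 0 (2 * n - 1) \ touch (mirror n N)) g y) := by
    rintro η η' hη ⟨f, g, y, h1, h2, h3, h4, h5⟩
    refine ⟨f, g, y, h1, h2, ?_, h4, dep_con.mono (loc_mono fun z hz => hz.1) _ _ hη h5⟩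
    have hc := Con.step (S := Box (-1) (2 * n - 1) 0 (2 * n - 1)) h3
      (by simp only [mem_Box] at h1 ⊢; omega) h5.left_mem.1
    obtain ⟨e, he, h⟩ := h3
    refine ⟨e, ?_, h⟩
    rw [← hη e, he]
    change e.1 ∈ Box (-1) (2 * n - 1) 0 (2 * n - 1)
    rcases h with ⟨h, -⟩ | ⟨h, -⟩
    · have : e.1 = f := h
      rw [this]; exact hc.left_mem
    · have : e.1 = g := h
      rw [this]; exact hc.right_mem
  have := h.star_box
  rwa [sub_add_cancel] at this

lemma pr_hook {n : ℤ} (hn : 2 ≤ n) : 1 / 8 ≤ pr (Hook n) := by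
  classical
  have hij : (0 : ℤ) = 0 ∧ n + 1 = n + 1 ∨ (0 : ℤ) = n + 1 ∧ n + 1 = 0 := .inl ⟨rfl, rfl⟩
  have hloc : IsLocal (Hook n) := (dep_hook hn).isLocal
  rw [← pr_star hloc]
  set F := bx (-1) (2 * n) 0 (2 * n) with hF
  have hdE : Dep (F : Set Edge) (fun ω => ¬ HC ω 0 (n + 1) 0 n) := by
    rw [hF, coe_bx]
    exact (dep_HC.mono (loc_mono fun z hz => by simp only [mem_Box] at hz ⊢; omega)).not
  have hdX : Dep (F : Set Edge) (fun ω => Hook n (star ω)) := by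
    rw [hF, coe_bx]
    have := (dep_hook hn).star_box
    rwa [sub_add_cancel] at this
  obtain ⟨T, hT⟩ := exists_colValues 0 (n + 1) 0 n 0 (n + 1)
  have hdY : ∀ N, Dep (F : Set Edge) (LowArm n N) := fun N => by
    rw [hF, coe_bx]; exact dep_lowArm_loc
  have key := avg_explore (F := F) (T := T) (N := fun ω => colN ω 0 (n + 1) 0 n 0 (n + 1))
    (E := fun ω => ¬ HC ω 0 (n + 1) 0 n) (Y := LowArm n)
    (G := fun N => F.filter fun e => e ∉ off (mirror n N)) (p := 1 / 4) (ω := fun _ => false)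
    (fun ω h => (hT _).2 (colN_values hij (by omega) (by omega) h))
    (fun N _ => Finset.filter_subset _ _) ?_ ?_ ?_
  · rw [avg_ind_eq_pr hdE, pr_not dep_HC.isLocal] at key
    have h2 : pr (fun ω => HC ω 0 (n + 1) 0 n) = 1 / 2 := hp_dual (by omega)
    rw [h2] at key
    rw [← avg_ind_eq_pr hdX fun _ => false]
    have h3 := key.trans (avg_mono (fun ω => ind_mono (E' := fun ω => Hook n (star ω))
      fun h => hook_of_lowArm hn h.1 h.2) _)
    linarith
  · refine fun N _ => inv_colN hij (by omega) (by omega) ?_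
    rintro e he ⟨h1, h2, h3⟩
    simp only [Finset.coe_sdiff, Finset.coe_filter, Set.mem_sdiff, Finset.mem_coe,
      Set.mem_ofPred_eq, not_and, not_not] at he
    have h4 := he.2 he.1
    rcases h3 with h3 | h3
    · exact h4.1 (.inl ⟨h1, h3⟩)
    · exact h4.2 (.inl ⟨h2, h3⟩)
  · refine fun N _ => (dep_lowArm (n := n) (N := N)).inv (Set.disjoint_left.2 fun e he he' => ?_)
    simp only [Finset.coe_filter, Set.mem_ofPred_eq] at he'
    exact he'.2 he
  · intro N hN
    obtain ⟨-, h0, h1⟩ := (hT N).1 hN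
    rw [avg_ind_eq_pr (hdY N)]
    exact pr_lowArm hn h0 h1 ⟨F, hdY N⟩

/-- A path stays in the cluster of its starting point. -/
lemma Con.cluster {η : Config} {S : Set Vertex} (h : Con η S x y) :
    Con η {z | Con η S x z} x y :=
  h.induct (p := fun y => Con η {z | Con η S x z} x y) (Con.refl (Con.refl h.left_mem))
    fun _ _ hxy hy hz ha ih => ih.tail ha hxy (hxy.tail ha hy hz)

/-- Two crossing paths have a common vertex. -/
lemma Con.meet {η η' : Config} {P Q : Set Vertex} {x y u u' : Vertex} {a b c d : ℤ}
    (hp : Con η P x y) (hq : Con η' Q u u') (hP : ∀ z ∈ P, c ≤ z.2 ∧ z.2 ≤ d)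
    (hQ : ∀ z ∈ Q, a ≤ z.1 ∧ z.1 ≤ b) (hx : x.1 ≤ a) (hy : b ≤ y.1)
    (hu : u.2 ≤ c) (hu' : d ≤ u'.2) : ∃ z, Con η P x z ∧ Con η' Q u z :=
  crossings_meet hp.cluster hq.cluster (fun z (hz : Con η P x z) => hP z hz.right_mem)
    (fun z (hz : Con η' Q u z) => hQ z hz.right_mem) hx hy hu hu'

lemma HC_of_hooks {n : ℤ} {η : Config} (hn : 2 ≤ n) (h1 : Hook n η)
    (h2 : Hook n (η ∘ (reflX n).j)) (h3 : HC η 0 n 0 (n - 1)) :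
    HC η (1 - n) (2 * n - 1) 0 (2 * n - 1) := by
  obtain ⟨t, b, f, y, ht, hb, hy, c1, c2, c3⟩ := h1
  obtain ⟨t', b', f', y', ht', hb', hy', c1', c2', c3'⟩ := h2
  obtain ⟨p, q, hp, hq, c4⟩ := h3
  have key : ∀ {a b c d a' b' x y}, a' = n - b → b' = n - a →
      Con (η ∘ (reflX n).j) (Box a b c d) x y →
      Con η (Box a' b' c d) ((reflX n).g x) ((reflX n).g y) := by
    rintro a b c d a' b' x y rfl rfl h
    refine ((reflX n).con' (fun z => ?_) rfl rfl).2 h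
    simp only [mem_Box, reflX_g]
    omega
  replace c1' := key (a' := 0) (b' := n) (by ring) (by ring) c1'
  replace c2' := key (a' := 0) (b' := n) (by ring) (by ring) c2'
  replace c3' := key (a' := 1 - n) (b' := n + 1) (by ring) (by ring) c3'
  simp only [reflX_g] at c1' c2' c3'
  have hr : ∀ z ∈ Box 0 n 0 (n - 1), 0 ≤ z.2 ∧ z.2 ≤ n - 1 := fun z hz => hz.2.2
  have hr' : ∀ z ∈ Box 0 n 0 (n - 1), 0 ≤ z.1 ∧ z.1 ≤ n := fun z hz => ⟨hz.1, hz.2.1⟩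
  obtain ⟨v, v1, v2⟩ := c4.meet c1 hr hr' hp.le hq.ge hb.le ht.ge
  obtain ⟨v', v1', v2'⟩ := c4.meet c1' hr hr' hp.le hq.ge hb'.le ht'.ge
  have s0 : ∀ {x y}, Con η (Box 0 n 0 (n - 1)) x y →
      Con η (Box (1 - n) (2 * n - 1) 0 (2 * n - 1)) x y := fun h =>
    h.mono_set fun z hz => by simp only [mem_Box] at hz ⊢; omega
  have d1 := (s0 ((c2'.symm.trans v2').trans ((v1'.symm.trans v1).trans (v2.symm.trans c2))))
  have d2 : Con η (Box (1 - n) (2 * n - 1) 0 (2 * n - 1)) f y :=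
    c3.mono_set fun z hz => by simp only [mem_Box] at hz ⊢; omega
  have d3 := c3'.mono_set (S' := Box (1 - n) (2 * n - 1) 0 (2 * n - 1))
    fun z hz => by simp only [mem_Box] at hz ⊢; omega
  exact ⟨_, y, by dsimp only; omega, hy, d3.symm.trans (d1.trans d2)⟩

lemma hp_hooks {n : ℤ} (hn : 2 ≤ n) : 1 / 128 ≤ hp (3 * n - 2) (2 * n - 1) := by
  have hloc : IsLocal (Hook n) := (dep_hook hn).isLocal
  have hloc' : IsLocal (fun η => Hook n (η ∘ (reflX n).j)) := hloc.comp _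
  have hH : IsLocal (fun η => HC η 0 n 0 (n - 1)) := dep_HC.isLocal
  have hi : Incr (fun η => Hook n (η ∘ (reflX n).j)) :=
    fun _ _ hω => incr_hook _ _ fun e => hω _
  have h1 := pr_and_ge hloc hloc' incr_hook hi
  have h2 := pr_and_ge (hloc.and hloc') hH (incr_hook.and hi) incr_HC
  have h3 := pr_mono (E' := fun η => HC η (1 - n) (2 * n - 1) 0 (2 * n - 1))
    ((hloc.and hloc').and hH) dep_HC.isLocal fun η h => HC_of_hooks hn h.1.1 h.1.2 h.2
  rw [pr_sym _ hloc] at h1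
  rw [pr_HC] at h2 h3
  have h4 := pr_hook hn
  have h5 : 1 / 2 ≤ hp (n - 0) (n - 1 - 0) := hp_ge_half (by omega) (by omega) (by omega)
  have e1 : 2 * n - 1 - (1 - n) = 3 * n - 2 := by ring
  rw [e1, sub_zero] at h3
  nlinarith [mul_le_mul h4 h4 (by norm_num) (by linarith)]

/-- Gluing two horizontal crossings with a vertical one. -/
lemma HC_glue {η : Config} {a b a' b' c d : ℤ} (h1 : HC η a b c d) (h2 : HC η a' b' c d)
    (h3 : VC η a' b c d) (haa : a ≤ a') (hbb : b ≤ b') : HC η a b' c d := by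
  obtain ⟨x, y, hx, hy, c1⟩ := h1
  obtain ⟨x', y', hx', hy', c2⟩ := h2
  obtain ⟨u, v, hu, hv, c3⟩ := h3
  have hab : a' ≤ b := by have := c3.left_mem; simp only [mem_Box] at this; omega
  have hr' : ∀ z ∈ Box a' b c d, a' ≤ z.1 ∧ z.1 ≤ b := fun z hz => ⟨hz.1, hz.2.1⟩
  obtain ⟨w, w1, w2⟩ := c1.meet c3 (fun z hz => hz.2.2) hr' (by omega) hy.ge hu.le hv.ge
  obtain ⟨w', w1', w2'⟩ := c2.meet c3 (fun z hz => hz.2.2) hr' hx'.le (by omega) hu.le hv.ge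
  have s : ∀ {p q a₁ b₁}, Con η (Box a₁ b₁ c d) p q → a ≤ a₁ → b₁ ≤ b' →
      Con η (Box a b' c d) p q := fun h _ _ =>
    h.mono_set fun z hz => by simp only [mem_Box] at hz ⊢; omega
  exact ⟨x, y', hx, hy', (s w1 le_rfl hbb).trans ((s (w2.symm.trans w2') haa hbb).trans
    (s (w1'.symm.trans c2) haa le_rfl))⟩

lemma hp_glue {w w' h o : ℤ} (hw : o ≤ w) (hw' : o ≤ w') :
    hp w h * hp w' h * hp h o ≤ hp (w + w' - o) h := by
  have i1 : IsLocal (fun η => HC η 0 w 0 h) := dep_HC.isLocal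
  have i2 : IsLocal (fun η => HC η (w - o) (w - o + w') 0 h) := dep_HC.isLocal
  have i3 : IsLocal (fun η => VC η (w - o) w 0 h) := dep_VC.isLocal
  have h1 := pr_and_ge i1 i2 incr_HC incr_HC
  have h2 := pr_and_ge (i1.and i2) i3 (incr_HC.and incr_HC) incr_VC
  have h3 := pr_mono (E' := fun η => HC η 0 (w - o + w') 0 h) ((i1.and i2).and i3)
    dep_HC.isLocal fun η h => HC_glue h.1.1 h.1.2 h.2 (by omega) (by omega)
  simp only [pr_HC, pr_VC] at h1 h2 h3
  have e1 : w - (w - o) = o := by ring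
  have e2 : w - o + w' - (w - o) = w' := by ring
  have e3 : w - o + w' - 0 = w + w' - o := by ring
  rw [e2, sub_zero, sub_zero] at h1
  rw [e1, sub_zero] at h2
  rw [e3, sub_zero] at h3
  have h4 : 0 ≤ hp h o := pr_nonneg _
  exact (mul_le_mul_of_nonneg_right h1 h4).trans (h2.trans h3)

lemma hp_nonneg (w h : ℤ) : 0 ≤ hp w h := pr_nonneg _

lemma hp_long {n : ℤ} (hn : 2 ≤ n) (k : ℕ) :
    (1 / 2) * (1 / 256) ^ k ≤ hp (2 * n - 1 + k * (n - 1)) (2 * n - 1) := by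
  induction k with
  | zero =>
    simpa using hp_ge_half (w := 2 * n - 1) (h := 2 * n - 1) (by omega) (by omega) (by omega)
  | succ k ih =>
    have h0 : 0 ≤ (k : ℤ) * (n - 1) := mul_nonneg (Int.natCast_nonneg k) (by omega)
    have h1 := hp_glue (w := 2 * n - 1 + k * (n - 1)) (w' := 3 * n - 2) (h := 2 * n - 1)
      (o := 2 * n - 1) (by omega) (by omega)
    have h2 := hp_hooks hn
    have h3 : 1 / 2 ≤ hp (2 * n - 1) (2 * n - 1) := hp_ge_half (by omega) (by omega) (by omega)
    have e : 2 * n - 1 + k * (n - 1) + (3 * n - 2) - (2 * n - 1) =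
      2 * n - 1 + ((k + 1 : ℕ) : ℤ) * (n - 1) := by push_cast; ring
    rw [e] at h1
    refine le_trans ?_ h1
    have hk : (0 : ℝ) ≤ (1 / 2) * (1 / 256) ^ k := by positivity
    calc (1 / 2 : ℝ) * (1 / 256) ^ (k + 1)
        = (1 / 2) * (1 / 256) ^ k * (1 / 128) * (1 / 2) := by ring
      _ ≤ _ := mul_le_mul (mul_le_mul ih h2 (by norm_num) (hp_nonneg _ _)) h3 (by norm_num)
        (mul_nonneg (hp_nonneg _ _) (hp_nonneg _ _))

/-- The Russo–Seymour–Welsh theorem. -/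
theorem rsw (k : ℕ) : ∃ c : ℝ, 0 < c ∧ ∀ w h : ℤ, 3 ≤ h → 0 ≤ w → w ≤ k * h → c ≤ hp w h := by
  refine ⟨(1 / 2) * (1 / 256) ^ (4 * k), by positivity, fun w h hh hw hwk => ?_⟩
  obtain ⟨n, hn1, hn2⟩ : ∃ n : ℤ, 2 * n - 1 ≤ h ∧ h ≤ 2 * n := ⟨(h + 1) / 2, by omega, by omega⟩
  refine (hp_long (n := n) (by omega) (4 * k)).trans (hp_mono ?_ hw hn1)
  push_cast
  have hk : (0 : ℤ) ≤ k := Int.natCast_nonneg k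
  nlinarith [mul_le_mul_of_nonneg_left hn2 hk, mul_nonneg hk (by omega : 0 ≤ n - 2)]

end RSW

section Circuits

variable {ω η η' : Config} {S : Set Vertex} {x y : Vertex} {a b c d : ℤ}

/-- A path leaving a rectangle leaves it through one of its four sides. -/
lemma Con.exit_box (h : Con η S x y) (hx : x ∈ Box a b c d) (hy : y ∉ Box a b c d) :
    ∃ w, (w.1 = b + 1 ∧ Con η (S ∩ Box a (b + 1) c d) x w) ∨
      (w.1 = a - 1 ∧ Con η (S ∩ Box (a - 1) b c d) x w) ∨
      (w.2 = d + 1 ∧ Con η (S ∩ Box a b c (d + 1)) x w) ∨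
      (w.2 = c - 1 ∧ Con η (S ∩ Box a b (c - 1) d) x w) := by
  obtain ⟨v, w, h1, h2, h3, h4⟩ := h.first_entry (Z := (Box a b c d)ᶜ) (fun hx' => hx' hx) hy
  have h5 : v ∈ Box a b c d := by_contra fun h => h1.right_mem.2 h
  have h6 := openAdj_near h2
  have ext : ∀ {a' b' c' d'}, w ∈ Box a' b' c' d' → Box a b c d ⊆ Box a' b' c' d' →
      Con η (S ∩ Box a' b' c' d') x w := fun hw hs =>
    (h1.mono_set (fun z hz => ⟨hz.1, hs (by_contra fun h => hz.2 h)⟩ :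
      S \ (Box a b c d)ᶜ ⊆ S ∩ Box _ _ _ _)).tail h2
      ⟨h1.right_mem.1, hs h5⟩ ⟨h4, hw⟩
  simp only [Set.mem_compl_iff, mem_Box] at h3 h5
  refine ⟨w, ?_⟩
  have h7 : w.1 = b + 1 ∨ w.1 = a - 1 ∨ w.2 = d + 1 ∨ w.2 = c - 1 := by omega
  rcases h7 with h7 | h7 | h7 | h7
  · exact .inl ⟨h7, ext (by simp only [mem_Box]; omega)
      fun z hz => by simp only [mem_Box] at hz ⊢; omega⟩
  · exact .inr (.inl ⟨h7, ext (by simp only [mem_Box]; omega)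
      fun z hz => by simp only [mem_Box] at hz ⊢; omega⟩)
  · exact .inr (.inr (.inl ⟨h7, ext (by simp only [mem_Box]; omega)
      fun z hz => by simp only [mem_Box] at hz ⊢; omega⟩))
  · exact .inr (.inr (.inr ⟨h7, ext (by simp only [mem_Box]; omega)
      fun z hz => by simp only [mem_Box] at hz ⊢; omega⟩))

/-- Four dual crossings around a vertex prevent it from being connected to infinity. -/
lemma mem_Box_of_blocked (h : Con ω S x y) (hx : x ∈ Box a b c d)
    {l l' lc ld r r' rc rd t t' ta tb s s' sa sb : ℤ}
    (hl : VC (star ω) l l' lc ld) (hl1 : a - 1 ≤ l) (hl2 : l' + 1 ≤ x.1) (hl3 : lc + 1 ≤ c)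
    (hl4 : d ≤ ld)
    (hr : VC (star ω) r r' rc rd) (hr1 : x.1 ≤ r) (hr2 : r' ≤ b) (hr3 : rc + 1 ≤ c) (hr4 : d ≤ rd)
    (ht : HC (star ω) ta tb t t') (ht1 : x.2 ≤ t) (ht2 : t' ≤ d) (ht3 : ta + 1 ≤ a) (ht4 : b ≤ tb)
    (hs : HC (star ω) sa sb s s') (hs1 : c - 1 ≤ s) (hs2 : s' + 1 ≤ x.2) (hs3 : sa + 1 ≤ a)
    (hs4 : b ≤ sb) : y ∈ Box a b c d := by
  by_contra hy
  obtain ⟨w, ⟨hw, h⟩ | ⟨hw, h⟩ | ⟨hw, h⟩ | ⟨hw, h⟩⟩ := h.exit_box hx hy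
  · obtain ⟨p, q, hp, hq, h'⟩ := hr
    refine not_hcross_vcross (a := x.1) (b := b + 1) (c := c) (d := d) h h'
      (fun z hz => hz.2.2.2) (fun z hz => ?_) le_rfl (by omega) (by omega) (by omega)
    simp only [mem_Box] at hz; omega
  · obtain ⟨p, q, hp, hq, h'⟩ := hl
    refine not_hcross_vcross (a := a - 1) (b := x.1) (c := c) (d := d) h.symm h'
      (fun z hz => hz.2.2.2) (fun z hz => ?_) (by omega) le_rfl (by omega) (by omega)
    simp only [mem_Box] at hz; omega
  · obtain ⟨p, q, hp, hq, h'⟩ := ht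
    refine not_vcross_hcross (a := a) (b := b) (c := x.2) (d := d + 1) h h'
      (fun z hz => ⟨hz.2.1, hz.2.2.1⟩) (fun z hz => ?_) le_rfl (by omega) (by omega) (by omega)
    simp only [mem_Box] at hz; omega
  · obtain ⟨p, q, hp, hq, h'⟩ := hs
    refine not_vcross_hcross (a := a) (b := b) (c := c - 1) (d := x.2) h.symm h'
      (fun z hz => ⟨hz.2.1, hz.2.2.1⟩) (fun z hz => ?_) (by omega) le_rfl (by omega) (by omega)
    simp only [mem_Box] at hz; omega

lemma vnorm_le {k : ℤ} {z : Vertex} : vnorm z ≤ k ↔ -k ≤ z.1 ∧ z.1 ≤ k ∧ -k ≤ z.2 ∧ z.2 ≤ k := by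
  simp only [vnorm, max_le_iff, abs_le]; tauto

lemma le_vnorm {k : ℤ} {z : Vertex} :
    k ≤ vnorm z ↔ z.1 ≤ -k ∨ k ≤ z.1 ∨ z.2 ≤ -k ∨ k ≤ z.2 := by
  simp only [vnorm, le_max_iff, le_abs]; omega

/-- Four crossings forming a circuit in an annulus. -/
def Circuit (η : Config) (a b : ℤ) : Prop :=
  (VC η a b (-b) b ∧ VC η (-b) (-a) (-b) b) ∧ HC η (-b) b a b ∧ HC η (-b) b (-b) (-a)

/-- The annulus `a ≤ ‖·‖ ≤ b`. -/
def Annulus (a b : ℤ) : Set Vertex := {z | a ≤ vnorm z ∧ vnorm z ≤ b}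

lemma mem_Annulus {z : Vertex} : z ∈ Annulus a b ↔ a ≤ vnorm z ∧ vnorm z ≤ b := Iff.rfl

/-- A circuit is connected and meets all paths crossing its annulus, horizontal crossings of the
right part and vertical crossings of the upper part. -/
lemma Circuit.meets (h : Circuit η a b) (hab : a < b) (ha : 0 < a) : ∃ p,
    (∀ {S η' x y}, Con η' S x y → vnorm x ≤ a → b ≤ vnorm y →
      ∃ z, Con η' S x z ∧ Con η (Annulus a b) p z) ∧
    (∀ {S η' x y}, Con η' S x y → (∀ z ∈ S, -b ≤ z.2 ∧ z.2 ≤ b) → x.1 ≤ a → b ≤ y.1 →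
      ∃ z, Con η' S x z ∧ Con η (Annulus a b) p z) ∧
    (∀ {S η' x y}, Con η' S x y → (∀ z ∈ S, -b ≤ z.1 ∧ z.1 ≤ b) → x.2 ≤ a → b ≤ y.2 →
      ∃ z, Con η' S x z ∧ Con η (Annulus a b) p z) := by
  obtain ⟨⟨⟨r, r', hr, hr', cr⟩, ⟨l, l', hl, hl', cl⟩⟩, ⟨t, t', ht, ht', ct⟩,
    ⟨s, s', hs, hs', cs⟩⟩ := h
  have er : Box a b (-b) b ⊆ Annulus a b := fun z hz => by
    simp only [mem_Box] at hz; rw [mem_Annulus, vnorm_le, le_vnorm]; omega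
  have el : Box (-b) (-a) (-b) b ⊆ Annulus a b := fun z hz => by
    simp only [mem_Box] at hz; rw [mem_Annulus, vnorm_le, le_vnorm]; omega
  have et : Box (-b) b a b ⊆ Annulus a b := fun z hz => by
    simp only [mem_Box] at hz; rw [mem_Annulus, vnorm_le, le_vnorm]; omega
  have es : Box (-b) b (-b) (-a) ⊆ Annulus a b := fun z hz => by
    simp only [mem_Box] at hz; rw [mem_Annulus, vnorm_le, le_vnorm]; omega
  obtain ⟨z1, m1, n1⟩ := ct.meet cr (fun z hz => hz.2.2) (fun z hz => ⟨hz.1, hz.2.1⟩)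
    (by omega) (by omega) (by omega) (by omega)
  obtain ⟨z2, m2, n2⟩ := ct.meet cl (fun z hz => hz.2.2) (fun z hz => ⟨hz.1, hz.2.1⟩)
    (by omega) (by omega) (by omega) (by omega)
  obtain ⟨z3, m3, n3⟩ := cs.meet cr (fun z hz => hz.2.2) (fun z hz => ⟨hz.1, hz.2.1⟩)
    (by omega) (by omega) (by omega) (by omega)
  have ktr : Con η (Annulus a b) t r := (m1.mono_set et).trans (n1.symm.mono_set er)
  have ktl : Con η (Annulus a b) t l := (m2.mono_set et).trans (n2.symm.mono_set el)
  have kts : Con η (Annulus a b) t s := ktr.trans ((n3.mono_set er).trans (m3.symm.mono_set es))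
  have hor : ∀ {S η' x y}, Con η' S x y → (∀ z ∈ S, -b ≤ z.2 ∧ z.2 ≤ b) → x.1 ≤ a → b ≤ y.1 →
      ∃ z, Con η' S x z ∧ Con η (Annulus a b) t z := fun h hS hx hy => by
    obtain ⟨z, hz, hz'⟩ := h.meet cr hS (fun z hz => ⟨hz.1, hz.2.1⟩) hx hy hr.le hr'.ge
    exact ⟨z, hz, ktr.trans (hz'.mono_set er)⟩
  have ver : ∀ {S η' x y}, Con η' S x y → (∀ z ∈ S, -b ≤ z.1 ∧ z.1 ≤ b) → x.2 ≤ a → b ≤ y.2 →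
      ∃ z, Con η' S x z ∧ Con η (Annulus a b) t z := fun h hS hx hy => by
    obtain ⟨z, hz, hz'⟩ := ct.meet h (fun z hz => hz.2.2) hS ht.le ht'.ge hx hy
    exact ⟨z, hz', hz.mono_set et⟩
  refine ⟨t, ?_, hor, ver⟩
  intro S η' x y h hx hy
  rw [vnorm_le] at hx
  have hxb : x ∈ Box (-b + 1) (b - 1) (-b + 1) (b - 1) := by simp only [mem_Box]; omega
  obtain ⟨w, ⟨hw, h⟩ | ⟨hw, h⟩ | ⟨hw, h⟩ | ⟨hw, h⟩⟩ := h.exit_box hxb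
    (by rw [le_vnorm] at hy; simp only [mem_Box]; omega)
  · obtain ⟨z, hz, hz'⟩ := hor h (fun z hz => by have := hz.2; simp only [mem_Box] at this; omega)
      (by omega) (by omega)
    exact ⟨z, hz.mono_set Set.inter_subset_left, hz'⟩
  · obtain ⟨z, hz, hz'⟩ := h.symm.meet cl (c := -b) (d := b) (a := -b) (b := -a)
      (fun z hz => by have := hz.2; simp only [mem_Box] at this; omega)
      (fun z hz => ⟨hz.1, hz.2.1⟩) (by omega) (by omega) (by omega) (by omega)
    exact ⟨z, (h.trans hz).mono_set Set.inter_subset_left, ktl.trans (hz'.mono_set el)⟩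
  · obtain ⟨z, hz, hz'⟩ := ver h (fun z hz => by have := hz.2; simp only [mem_Box] at this; omega)
      (by omega) (by omega)
    exact ⟨z, hz.mono_set Set.inter_subset_left, hz'⟩
  · obtain ⟨z, hz, hz'⟩ := cs.meet h.symm (c := -b) (d := -a) (a := -b) (b := b)
      (fun z hz => hz.2.2)
      (fun z hz => by have := hz.2; simp only [mem_Box] at this; omega)
      (by omega) (by omega) (by omega) (by omega)
    exact ⟨z, (h.trans hz').mono_set Set.inter_subset_left, kts.trans (hz.mono_set es)⟩

end Circuits

section Arms

variable {η η' : Config} {I O D : Set Vertex} {u : ℤ}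

/-- There is a path in `D` from `I` to `O`. -/
def Arm (I O D : Set Vertex) (η : Config) : Prop := ∃ x ∈ I, ∃ y ∈ O, Con η D x y

/-- The sets `I`, `O`, `D` delimit an annulus containing the one at scale `u`. -/
structure Spans (I O D : Set Vertex) (u : ℤ) : Prop where
  inner : ∀ x ∈ I, vnorm x ≤ 4 * u
  outer : ∀ y ∈ O, 26 * u ≤ vnorm y
  mid : ∀ z, u ≤ vnorm z → vnorm z ≤ 30 * u → z ∈ D

/-- The edges of the middle part of the annulus at scale `u`. -/
def middle (u : ℤ) : Set Edge := {e | 6 * u ≤ vnorm e.1 ∧ vnorm e.1 ≤ 24 * u}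

open Classical in
/-- The configuration in which the edges of `M` have been opened. -/
noncomputable def opened (M : Set Edge) (η : Config) : Config :=
  fun e => if e ∈ M then true else η e

/-- The arm reaches the middle part of the annulus from both sides, and is surrounded by
circuits there. -/
def Joinable (I O D : Set Vertex) (u : ℤ) (η : Config) : Prop :=
  (Circuit η (4 * u) (5 * u) ∧ Circuit η (25 * u) (26 * u)) ∧ Arm I O D (opened (middle u) η)

lemma Arm.incr : Incr (Arm I O D) := fun _ _ h ⟨x, hx, y, hy, hc⟩ => ⟨x, hx, y, hy, hc.incr h⟩

lemma Circuit.incr {a b : ℤ} : Incr fun η => Circuit η a b :=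
  (Incr.and (incr_VC.and incr_VC) (incr_HC.and incr_HC))

lemma opened_of_notMem {M : Set Edge} {e : Edge} (h : e ∉ M) : opened M η e = η e := if_neg h

lemma opened_mono {M : Set Edge} (h : η ≤ η') : opened M η ≤ opened M η' := fun e => by
  unfold opened; split_ifs
  · exact le_rfl
  · exact h e

lemma le_opened {M : Set Edge} : η ≤ opened M η := fun e => by
  unfold opened; split_ifs
  · exact Bool.le_true _
  · exact le_rfl

lemma Joinable.incr : Incr (Joinable I O D u) :=
  (Circuit.incr.and Circuit.incr).and fun _ _ h h' => Arm.incr _ _ (opened_mono h) h'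

lemma Joinable.of_arm (h : Circuit η (4 * u) (5 * u) ∧ Circuit η (25 * u) (26 * u))
    (h' : Arm I O D η) : Joinable I O D u η := ⟨h, Arm.incr _ _ le_opened h'⟩

lemma dep_Arm : Dep (loc D) (Arm I O D) := fun ω ω' h ⟨x, hx, y, hy, hc⟩ =>
  ⟨x, hx, y, hy, dep_con ω ω' h hc⟩

lemma dep_Circuit {a b : ℤ} (ha : 0 ≤ a) :
    Dep (loc (Annulus a b)) fun η => Circuit η a b := by
  refine Dep.and (Dep.and ?_ ?_) (Dep.and ?_ ?_)
  · exact dep_VC.mono (loc_mono fun z hz => by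
      simp only [mem_Box] at hz; rw [mem_Annulus, vnorm_le, le_vnorm]; omega)
  · exact dep_VC.mono (loc_mono fun z hz => by
      simp only [mem_Box] at hz; rw [mem_Annulus, vnorm_le, le_vnorm]; omega)
  · exact dep_HC.mono (loc_mono fun z hz => by
      simp only [mem_Box] at hz; rw [mem_Annulus, vnorm_le, le_vnorm]; omega)
  · exact dep_HC.mono (loc_mono fun z hz => by
      simp only [mem_Box] at hz; rw [mem_Annulus, vnorm_le, le_vnorm]; omega)

lemma dep_Joinable (hu : 0 < u) (hs : Spans I O D u) :
    Dep (loc D \ middle u) (Joinable I O D u) := by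
  refine Dep.and (Dep.and ?_ ?_) ?_
  · refine (dep_Circuit (by omega)).mono fun e he => ⟨hs.mid _ ?_ ?_, fun hm => ?_⟩
    · have := he.1; omega
    · have := he.2; omega
    · have := he.2; have := hm.1; omega
  · refine (dep_Circuit (by omega)).mono fun e he => ⟨hs.mid _ ?_ ?_, fun hm => ?_⟩
    · have := he.1; omega
    · have := he.2; omega
    · have := he.1; have := hm.2; omega
  · refine fun ω ω' h h' => dep_Arm _ _ (fun e he => ?_) h'
    by_cases hm : e ∈ middle u
    · simp [opened, hm]
    · rw [opened_of_notMem hm, opened_of_notMem hm]; exact h e ⟨he, hm⟩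

lemma vnorm_near {x y : Vertex} (h : openAdj η x y) : vnorm x ≤ vnorm y + 1 := by
  have h1 := openAdj_near h
  have h2 := (vnorm_le (z := y) (k := vnorm y)).1 le_rfl
  rw [vnorm_le]; omega

/-- The two circuits, once joined inside the annulus, complete the arm. -/
lemma Joinable.arm (h : Joinable I O D u η) (hs : Spans I O D u) (hu : 0 < u)
    (hj : (HC η 0 (16 * u) u (3 * u) ∧ VC η (14 * u) (16 * u) 0 (30 * u)) ∨
      (VC η u (3 * u) 0 (16 * u) ∧ HC η 0 (30 * u) (14 * u) (16 * u))) : Arm I O D η := by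
  obtain ⟨⟨h1, h2⟩, x, hx, y, hy, hc⟩ := h
  obtain ⟨p, pr, ph, pv⟩ := h1.meets (by omega) (by omega)
  obtain ⟨q, qr, qh, qv⟩ := h2.meets (by omega) (by omega)
  have hx' := hs.inner x hx
  have hy' := hs.outer y hy
  have hxp : Con η D x p := by
    obtain ⟨v, w, c1, c2, c3, c4⟩ := hc.first_entry (Z := {z | 6 * u ≤ vnorm z})
      (fun h => by have : 6 * u ≤ vnorm x := h; omega) (show 6 * u ≤ vnorm y by omega)
    have c3' : 6 * u ≤ vnorm w := c3
    have c1' : Con η D x v := c1.mono Set.sdiff_subset fun e he _ h => by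
      rwa [opened_of_notMem] at h
      exact fun hm => he.2 hm.1
    obtain ⟨z, hz, hz'⟩ := pr c1' hx' (by have := vnorm_near (openAdj_symm c2); omega)
    refine hz.trans (hz'.symm.mono_set fun z hz => hs.mid z ?_ ?_)
    · have := hz.1; omega
    · have := hz.2; omega
  have hyq : Con η D y q := by
    obtain ⟨v, w, c1, c2, c3, c4⟩ := hc.symm.first_entry (Z := {z | vnorm z ≤ 24 * u})
      (fun h => by have : vnorm y ≤ 24 * u := h; omega) (show vnorm x ≤ 24 * u by omega)
    have c3' : vnorm w ≤ 24 * u := c3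
    have c1' : Con η D y v := c1.mono Set.sdiff_subset fun e he _ h => by
      rwa [opened_of_notMem] at h
      exact fun hm => he.2 hm.2
    obtain ⟨z, hz, hz'⟩ := qr c1'.symm (by have := vnorm_near c2; omega) hy'
    refine (c1'.trans hz).trans (hz'.symm.mono_set fun z hz => hs.mid z ?_ ?_)
    · have := hz.1; omega
    · have := hz.2; omega
  refine ⟨x, hx, y, hy, (hxp.trans ?_).trans hyq.symm⟩
  have core : ∀ {P Q : Set Vertex} {a b c : Vertex}, (∀ z ∈ P, u ≤ vnorm z ∧ vnorm z ≤ 30 * u) →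
      (∀ z ∈ Q, u ≤ vnorm z ∧ vnorm z ≤ 30 * u) → Con η P a c → Con η (Annulus (4 * u) (5 * u)) p a
      → Con η Q c b → Con η (Annulus (25 * u) (26 * u)) q b → Con η D p q := by
    intro P Q a b c hP hQ k1 k2 k3 k4
    have e1 : Annulus (4 * u) (5 * u) ⊆ D := fun z hz => hs.mid z (by have := hz.1; omega)
      (by have := hz.2; omega)
    have e2 : Annulus (25 * u) (26 * u) ⊆ D := fun z hz => hs.mid z (by have := hz.1; omega)
      (by have := hz.2; omega)
    exact (k2.mono_set e1).trans ((k1.mono_set fun z hz => hs.mid z (hP z hz).1 (hP z hz).2).trans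
      ((k3.mono_set fun z hz => hs.mid z (hQ z hz).1 (hQ z hz).2).trans (k4.symm.mono_set e2)))
  rcases hj with ⟨⟨s, s', hs1, hs2, cs⟩, ⟨t, t', ht1, ht2, ct⟩⟩ |
    ⟨⟨s, s', hs1, hs2, cs⟩, ⟨t, t', ht1, ht2, ct⟩⟩
  · obtain ⟨a, a1, a2⟩ := ph cs (fun z hz => by simp only [mem_Box] at hz; omega)
      (by omega) (by omega)
    obtain ⟨b, b1, b2⟩ := qv ct (fun z hz => by simp only [mem_Box] at hz; omega)
      (by omega) (by omega)
    obtain ⟨c, c1, c2⟩ := cs.meet ct (fun z hz => hz.2.2) (fun z hz => ⟨hz.1, hz.2.1⟩)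
      (by omega) (by omega) (by omega) (by omega)
    refine core (P := Box 0 (16 * u) u (3 * u)) (Q := Box (14 * u) (16 * u) 0 (30 * u))
      (fun z hz => ?_) (fun z hz => ?_) (a1.symm.trans c1) a2 (c2.symm.trans b1) b2
    · simp only [mem_Box] at hz; rw [vnorm_le, le_vnorm]; omega
    · simp only [mem_Box] at hz; rw [vnorm_le, le_vnorm]; omega
  · obtain ⟨a, a1, a2⟩ := pv cs (fun z hz => by simp only [mem_Box] at hz; omega)
      (by omega) (by omega)
    obtain ⟨b, b1, b2⟩ := qh ct (fun z hz => by simp only [mem_Box] at hz; omega)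
      (by omega) (by omega)
    obtain ⟨c, c1, c2⟩ := ct.meet cs (fun z hz => hz.2.2) (fun z hz => ⟨hz.1, hz.2.1⟩)
      (by omega) (by omega) (by omega) (by omega)
    refine core (P := Box u (3 * u) 0 (16 * u)) (Q := Box 0 (30 * u) (14 * u) (16 * u))
      (fun z hz => ?_) (fun z hz => ?_) (a1.symm.trans c2) a2 (c1.symm.trans b1) b2
    · simp only [mem_Box] at hz; rw [vnorm_le, le_vnorm]; omega
    · simp only [mem_Box] at hz; rw [vnorm_le, le_vnorm]; omega

end Arms

section Dichotomy

variable {ω ω' η : Config} {a b a' b' c d c₁ d₁ c₂ d₂ : ℤ} {Z Z₁ Z₂ : Set Vertex}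

lemma mem_touch_iff {f : Vertex} :
    f ∈ touch Z ↔ ∃ z ∈ Z, f ∈ Box (z.1 - 1) z.1 (z.2 - 1) z.2 := by
  constructor
  · rintro (h | h | h | h)
    all_goals exact ⟨_, h, by simp only [mem_Box]; omega⟩
  · rintro ⟨⟨x, y⟩, h, h'⟩
    obtain ⟨p, q⟩ := f
    simp only [mem_Box] at h'
    have hp : p = x ∨ p + 1 = x := by omega
    have hq : q = y ∨ q + 1 = y := by omega
    rcases hp with rfl | rfl <;> rcases hq with rfl | rfl
    · exact .inl h
    · exact .inr (.inr (.inl h))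
    · exact .inr (.inl h)
    · exact .inr (.inr (.inr h))

/-- The faces touching a connected set form a connected set. -/
lemma touch_connected (hZ : ∀ x ∈ Z, ∀ y ∈ Z, Con full Z x y) (hb : Z ⊆ Box a b c d)
    (hab : a < b) (hcd : c < d) : ∀ f ∈ Box a (b - 1) c (d - 1) ∩ touch Z,
    ∀ g ∈ Box a (b - 1) c (d - 1) ∩ touch Z,
      Con full (Box a (b - 1) c (d - 1) ∩ touch Z) f g := by
  rintro f ⟨hf, hf'⟩ g ⟨hg, hg'⟩
  obtain ⟨x, hx, hfx⟩ := mem_touch_iff.1 hf'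
  obtain ⟨y, hy, hgy⟩ := mem_touch_iff.1 hg'
  have around : ∀ z ∈ Z, ∀ p q, p ∈ Box a (b - 1) c (d - 1) → q ∈ Box a (b - 1) c (d - 1) →
      p ∈ Box (z.1 - 1) z.1 (z.2 - 1) z.2 → q ∈ Box (z.1 - 1) z.1 (z.2 - 1) z.2 →
      Con full (Box a (b - 1) c (d - 1) ∩ touch Z) p q := by
    intro z hz p q hp hq hp' hq'
    simp only [mem_Box] at hp hq hp' hq'
    refine (Box_connected (a := max a (z.1 - 1)) (b := min (b - 1) z.1) (c := max c (z.2 - 1))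
      (d := min (d - 1) z.2) ?_ ?_).mono_set fun r hr => ?_
    · simp only [mem_Box]; omega
    · simp only [mem_Box]; omega
    · simp only [mem_Box] at hr
      refine ⟨by simp only [mem_Box]; omega, mem_touch_iff.2 ⟨z, hz, by simp only [mem_Box]; omega⟩⟩
  have := (hZ x hx y hy).induct (p := fun z => ∀ r ∈ Box a (b - 1) c (d - 1),
    r ∈ Box (z.1 - 1) z.1 (z.2 - 1) z.2 → Con full (Box a (b - 1) c (d - 1) ∩ touch Z) f r)
    (fun r hr hr' => around x hx f r hf hr hfx hr') fun z z' _ hz hz' ha ih r hr hr' => by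
      have hn := openAdj_near ha
      have h1 := hb hz
      have h2 := hb hz'
      simp only [mem_Box] at h1 h2
      obtain ⟨s, hs⟩ : ∃ s, s ∈ Box a (b - 1) c (d - 1) ∧ s ∈ Box (z.1 - 1) z.1 (z.2 - 1) z.2 ∧
          s ∈ Box (z'.1 - 1) z'.1 (z'.2 - 1) z'.2 :=
        ⟨(min (min z.1 z'.1) (b - 1), min (min z.2 z'.2) (d - 1)), by simp only [mem_Box]; omega⟩
      exact (ih s hs.1 hs.2.1).trans (around z' hz' s r hs.1 hr hs.2.2 hr')
  exact this g hg hgy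

/-- A path in a strip between neighbours of `Z₁` and of `Z₂`, avoiding these sets. -/
def Link (Z₁ Z₂ : Set Vertex) (a b c d : ℤ) (ω : Config) : Prop :=
  ∃ v v' w w', Con ω (Box a b c d \ (Z₁ ∪ Z₂)) v v' ∧ openAdj full w v ∧ w ∈ Z₁ ∧
    openAdj full v' w' ∧ w' ∈ Z₂

lemma openAdj.full {x y : Vertex} (h : openAdj η x y) : openAdj full x y := by
  obtain ⟨e, _, h⟩ := h
  exact ⟨e, rfl, h⟩

lemma mixed_iff {N : Set Vertex} {f : Vertex} : Mixed N f ↔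
    (∃ z ∈ N, f ∈ Box (z.1 - 1) z.1 (z.2 - 1) z.2) ∧
      ∃ z, z ∉ N ∧ f ∈ Box (z.1 - 1) z.1 (z.2 - 1) z.2 :=
  and_congr (mem_touch_iff (Z := N)) (mem_touch_iff (Z := Nᶜ))

/-- A path from the outside to the inside of a set of faces has a vertex whose faces are mixed. -/
lemma Link.mixed (h : Link Z₁ Z₂ a b c₁ d₁ ω) (hc : c < c₁) (hd : d₁ < d) (hab : a < b)
    (h₁ : Z₁ ⊆ Box a b c d) (h₂ : Z₂ ⊆ Box a b c d)
    (ha : ∀ y, c ≤ y → y ≤ d → (a, y) ∈ Z₁) (hb : ∀ y, c ≤ y → y ≤ d → (b, y) ∈ Z₂)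
    {N : Set Vertex} (hN₁ : ∀ f ∈ Box a (b - 1) c (d - 1), f ∈ touch Z₁ → f ∉ N)
    (hN₂ : ∀ f ∈ Box a (b - 1) c (d - 1), f ∈ touch Z₂ → f ∈ N) :
    ∃ v v' w w' m, Con ω (Box (a + 1) (b - 1) c₁ d₁) v v' ∧
      Con ω (Box (a + 1) (b - 1) c₁ d₁) v m ∧ openAdj full w v ∧ w ∈ Z₁ ∧
      openAdj full v' w' ∧ w' ∈ Z₂ ∧ Mixed N (m.1 - 1, m.2 - 1) ∧
      m ∈ Box (a + 1) (b - 1) c₁ d₁ := by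
  obtain ⟨v, v', w, w', hv, hwv, hw, hv', hw'⟩ := h
  have sub : Box a b c₁ d₁ \ (Z₁ ∪ Z₂) ⊆ Box (a + 1) (b - 1) c₁ d₁ := by
    rintro ⟨x, y⟩ ⟨hz, hz'⟩
    simp only [mem_Box, Set.mem_union, not_or] at hz hz' ⊢
    have e1 : x ≠ a := fun h => hz'.1 (h ▸ ha y (by omega) (by omega))
    have e2 : x ≠ b := fun h => hz'.2 (h ▸ hb y (by omega) (by omega))
    omega
  have hv := hv.mono_set sub
  have share : ∀ x y, openAdj full x y → x ∈ Box (a + 1) (b - 1) c₁ d₁ → y ∈ Box a b c d →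
      ∃ f ∈ Box a (b - 1) c (d - 1), f ∈ Box (x.1 - 1) x.1 (x.2 - 1) x.2 ∧
        f ∈ Box (y.1 - 1) y.1 (y.2 - 1) y.2 := by
    intro x y hxy hx hy
    have := openAdj_near hxy
    simp only [mem_Box] at hx hy
    exact ⟨(min x.1 y.1, min x.2 y.2), by simp only [mem_Box]; omega, by simp only [mem_Box]; omega,
      by simp only [mem_Box]; omega⟩
  by_contra hcon
  have nm : ∀ m, Con ω (Box (a + 1) (b - 1) c₁ d₁) v m → ¬ Mixed N (m.1 - 1, m.2 - 1) :=
    fun m hm hx => hcon ⟨v, v', w, w', m, hv, hm, hwv, hw, hv', hw', hx, hm.right_mem⟩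
  have unif : ∀ m, Con ω (Box (a + 1) (b - 1) c₁ d₁) v m → ∀ f g,
      f ∈ Box (m.1 - 1) m.1 (m.2 - 1) m.2 → g ∈ Box (m.1 - 1) m.1 (m.2 - 1) m.2 → f ∉ N →
      g ∉ N := fun m hm f g hf hg hfN hgN => nm m hm (mixed_iff.2
    ⟨⟨g, hgN, by simp only [mem_Box] at hg ⊢; omega⟩,
      ⟨f, hfN, by simp only [mem_Box] at hf ⊢; omega⟩⟩)
  obtain ⟨f, f1, f2, f3⟩ := share v w (openAdj_symm hwv) hv.left_mem (h₁ hw)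
  have fN := hN₁ f f1 (mem_touch_iff.2 ⟨w, hw, f3⟩)
  have key := hv.induct (p := fun m => ∀ g ∈ Box (m.1 - 1) m.1 (m.2 - 1) m.2, g ∉ N)
    (fun g hg => unif v (Con.refl hv.left_mem) f g f2 hg fN) fun y z hy hyS hzS hyz ih g hg => by
      obtain ⟨k, k1, k2, k3⟩ := share y z hyz.full hyS (by
        simp only [mem_Box] at hzS ⊢; omega)
      exact unif z (hy.tail hyz hyS hzS) k g k3 hg (ih k k2)
  obtain ⟨g, g1, g2, g3⟩ := share v' w' hv' hv.right_mem (h₂ hw')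
  exact key g g2 (hN₂ g g1 (mem_touch_iff.2 ⟨w', hw', g3⟩))

/-- A face touching `Z` next to a face not touching `Z` is mixed, inside a rectangle. -/
lemma mixed_of_exit {N : Set Vertex} {f g : Vertex} (hf : f ∈ touch (Box a b c d \ N))
    (hg : g ∉ touch (Box a b c d \ N)) (hfg : openAdj full f g)
    (hfb : f ∈ Box a (b - 1) c (d - 1)) : Mixed N f := by
  obtain ⟨z, hz, hfz⟩ := mem_touch_iff.1 hf
  refine mixed_iff.2 ⟨?_, z, hz.2, hfz⟩
  have hn := openAdj_near hfg
  by_contra hcon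
  push Not at hcon
  simp only [mem_Box] at hfb
  obtain ⟨s, hs1, hs2, hs3⟩ : ∃ s, s ∈ Box a b c d ∧ f ∈ Box (s.1 - 1) s.1 (s.2 - 1) s.2 ∧
      g ∈ Box (s.1 - 1) s.1 (s.2 - 1) s.2 :=
    ⟨(max f.1 g.1, max f.2 g.2), by simp only [mem_Box]; omega⟩
  exact hg (mem_touch_iff.2 ⟨s, ⟨hs1, fun h => hcon s h hs2⟩, hs3⟩)

/-- The part of a strip explored from its side `i`. -/
def explored (ω : Config) (a b c d i j : ℤ) : Set Vertex := Box a b c d \ colN ω a b c d i j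

/-- Either the walls of two strips are joined by a dual path, or all links between the two strips
are connected to one another. -/
theorem links_or_dual {ω : Config} {a b a' b' c d c₁ d₁ c₂ d₂ : ℤ} (hab : a < b) (hba : b < a')
    (hab' : a' < b') (hcd : c < d) (hL : ¬HC ω a b c d) (hR : ¬HC ω a' b' c d)
    (h₁ : Link (explored ω a b c d a b) (explored ω a' b' c d b' a') a b' c₁ d₁ ω)
    (h₂ : Link (explored ω a b c d a b) (explored ω a' b' c d b' a') a b' c₂ d₂ ω)
    (hc₁ : c < c₁) (hd₁ : d₁ < d) (hc₂ : c < c₂) (hd₂ : d₂ < d) :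
    (∃ f g, f ∈ Box a (b - 1) c (d - 1) ∧ g ∈ Box a' (b' - 1) c (d - 1) ∧
      Mixed (colN ω a b c d a b) f ∧ Mixed (colN ω a' b' c d b' a') g ∧
      Con (star ω) (Box a (b' - 1) c (d - 1)) f g) ∨
    ∃ v v' s s', v.1 ≤ b ∧ a' ≤ v'.1 ∧ s.1 ≤ b ∧ a' ≤ s'.1 ∧ Con ω (Box a b' c₁ d₁) v v' ∧
      Con ω (Box a b' c₂ d₂) s s' ∧ Con ω (Box a b' c d) v s := by
  have eL : a = a ∧ b = b ∨ a = b ∧ b = a := .inl ⟨rfl, rfl⟩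
  have eR : b' = a' ∧ a' = b' ∨ b' = b' ∧ a' = a' := .inr ⟨rfl, rfl⟩
  set N₁ := colN ω a b c d a b with hN₁
  set N₂ := colN ω a' b' c d b' a' with hN₂
  set Z₁ := explored ω a b c d a b with hZ₁
  set Z₂ := explored ω a' b' c d b' a' with hZ₂
  obtain ⟨sub₁, in₁, out₁⟩ := colN_values eL hab hcd.le hL
  obtain ⟨sub₂, in₂, out₂⟩ := colN_values eR hab' hcd.le hR
  have zs₁ : Z₁ ⊆ Box a b c d := Set.sdiff_subset
  have zs₂ : Z₂ ⊆ Box a' b' c d := Set.sdiff_subset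
  have zt₁ : Z₁ ⊆ Box a b' c d := fun z hz => by
    have := zs₁ hz; simp only [mem_Box] at this ⊢; omega
  have zt₂ : Z₂ ⊆ Box a b' c d := fun z hz => by
    have := zs₂ hz; simp only [mem_Box] at this ⊢; omega
  have zlt : ∀ z ∈ Z₁, z.1 < b := fun z hz => by
    have h := zs₁ hz
    have : z.1 ≠ b := fun h' => hz.2 (out₁ z ⟨h, h'⟩)
    simp only [mem_Box] at h; omega
  have zgt : ∀ z ∈ Z₂, a' < z.1 := fun z hz => by
    have h := zs₂ hz
    have : z.1 ≠ a' := fun h' => hz.2 (out₂ z ⟨h, h'⟩)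
    simp only [mem_Box] at h; omega
  have col₁ : ∀ y, c ≤ y → y ≤ d → (a, y) ∈ Z₁ := fun y h h' => by
    have : (a, y) ∈ Box a b c d := by simp only [mem_Box]; omega
    exact ⟨this, in₁ _ ⟨this, rfl⟩⟩
  have col₂ : ∀ y, c ≤ y → y ≤ d → (b', y) ∈ Z₂ := fun y h h' => by
    have : (b', y) ∈ Box a' b' c d := by simp only [mem_Box]; omega
    exact ⟨this, in₂ _ ⟨this, rfl⟩⟩
  have con₁ : ∀ x ∈ Z₁, ∀ y ∈ Z₁, Con full Z₁ x y :=
    (explores_col eL hab hcd.le hL).con_explored fun x hx y hy => Box_connected hx hy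
  have con₂ : ∀ x ∈ Z₂, ∀ y ∈ Z₂, Con full Z₂ x y :=
    (explores_col eR hab' hcd.le hR).con_explored fun x hx y hy => Box_connected hx hy
  have t₁ : ∀ f ∈ touch Z₁, f.1 < b ∧ f.1 + 1 ≤ b := fun f hf => by
    obtain ⟨z, hz, hz'⟩ := mem_touch_iff.1 hf
    have := zlt z hz; simp only [mem_Box] at hz'; omega
  have t₂ : ∀ f ∈ touch Z₂, a' ≤ f.1 := fun f hf => by
    obtain ⟨z, hz, hz'⟩ := mem_touch_iff.1 hf
    have := zgt z hz; simp only [mem_Box] at hz'; omega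
  set Q := Box a (b' - 1) c (d - 1) with hQ
  by_cases hdual : ∃ f ∈ Q, ∃ g ∈ Q, f ∈ Box a (b - 1) c (d - 1) ∧ Mixed N₁ f ∧ g ∈ touch Z₂ ∧
      Con (star ω) Q f g
  · obtain ⟨f, hf, g, hg, hfb, hfm, hgt, hfg⟩ := hdual
    obtain ⟨v, w, k1, k2, k3, k4⟩ := hfg.first_entry (Z := touch Z₂) (fun h => by
      have := t₂ f h; simp only [mem_Box] at hfb; omega) hgt
    have hw : w ∈ Box a' (b' - 1) c (d - 1) := by
      have := t₂ w k3; simp only [hQ, mem_Box] at k4 ⊢; omega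
    exact .inl ⟨f, w, hfb, hw, hfm,
      mixed_of_exit k3 k1.right_mem.2 (openAdj_symm k2).full hw,
      (k1.mono_set Set.sdiff_subset).tail k2 k1.right_mem.1 k4⟩
  · right
    have ex : Explores (star ω) Q (Q ∩ touch Z₁) {f ∈ Q ∩ touch Z₁ | f ∈ Box a (b - 1) c (d - 1) ∧
        Mixed N₁ f} (Q ∩ touch Z₂) :=
      { hA := Set.inter_subset_left
        hL := fun f hf => hf.1
        hR := Set.inter_subset_left
        neA := ⟨(a, c), by simp only [hQ, mem_Box]; omega, .inl (col₁ c le_rfl hcd.le)⟩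
        conA := touch_connected con₁ zt₁ (by omega) hcd
        conR := touch_connected con₂ zt₂ (by omega) hcd
        exit := fun x hx y hy hy' hxy => by
          have hxb : x ∈ Box a (b - 1) c (d - 1) := by
            have := t₁ x hx.2; have := hx.1; simp only [hQ, mem_Box] at this ⊢; omega
          exact ⟨hx, hxb, mixed_of_exit hx.2 (fun h => hy' ⟨hy, h⟩) hxy hxb⟩
        disj := fun x hx hx' => by have := t₁ x hx'.2; have := t₂ x hx.2; omega
        noCon := fun x hx y hy hxy => hdual ⟨x, hx.1.1, y, hy.1, hx.2.1, hx.2.2, hy.2, hxy⟩ }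
    obtain ⟨v, v', w, w', m, k1, k2, k3, k4, k5, k6, k7, k8⟩ := h₁.mixed hc₁ hd₁ (by omega) zt₁ zt₂
      col₁ col₂ (fun f hf hf' =>
        Explores.notMem_of_mem (show f ∈ Q ∩ touch Z₁ from ⟨hf, hf'⟩))
      (fun f hf hf' => ex.R_sub ⟨hf, hf'⟩)
    obtain ⟨s, s', r, r', n, l1, l2, l3, l4, l5, l6, l7, l8⟩ := h₂.mixed hc₂ hd₂ (by omega) zt₁ zt₂
      col₁ col₂ (fun f hf hf' =>
        Explores.notMem_of_mem (show f ∈ Q ∩ touch Z₁ from ⟨hf, hf'⟩))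
      (fun f hf hf' => ex.R_sub ⟨hf, hf'⟩)
    have wall := ex.wall_connected (.inl fun z hz hza => ⟨hz, .inl (by
      have := col₁ z.2 (by simp only [mem_Box] at hz; omega) (by simp only [mem_Box] at hz; omega)
      rwa [← hza] at this)⟩) (f := (m.1 - 1, m.2 - 1)) (g := (n.1 - 1, n.2 - 1))
      (by simp only [mem_Box] at k8 ⊢; omega) (by simp only [mem_Box] at l8 ⊢; omega) k7 l7
    rw [star_star] at wall
    have wall' : Con ω (Box (a + 1) (b' - 1) (c + 1) (d - 1)) m n :=
      ((transl (1, 1)).con' (fun z => by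
        simp only [mem_Box, transl, Equiv.coe_addRight, Prod.fst_add, Prod.snd_add]; omega)
        (by simp [transl]) (by simp [transl])).2 wall
    have sm : ∀ {p q r s : ℤ}, c ≤ r → s ≤ d → a ≤ p → q ≤ b' → Box p q r s ⊆ Box a b' c d :=
      fun h1 h2 h3 h4 z hz => by simp only [mem_Box] at hz ⊢; omega
    have sm' : ∀ {r s : ℤ}, Box (a + 1) (b' - 1) r s ⊆ Box a b' r s := by
      intro r s z hz; simp only [mem_Box] at hz ⊢; omega
    have n1 := openAdj_near k3
    have n2 := openAdj_near k5
    have n3 := openAdj_near l3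
    have n4 := openAdj_near l5
    have z1 := zlt _ k4
    have z2 := zgt _ k6
    have z3 := zlt _ l4
    have z4 := zgt _ l6
    refine ⟨v, v', s, s', by omega, by omega, by omega, by omega, k1.mono_set sm', l1.mono_set sm',
      ?_⟩
    exact (k2.mono_set (sm (by omega) (by omega) (by omega) (by omega))).trans
      ((wall'.mono_set (sm (by omega) (by omega) (by omega) (by omega))).trans
        (l2.symm.mono_set (sm (by omega) (by omega) (by omega) (by omega))))

end Dichotomy

lemma VC_transl {ω : Config} {a b c d : ℤ} (t : Vertex) :
    VC ω a b c d ↔ VC (ω ∘ (transl t).j) (a - t.1) (b - t.1) (c - t.2) (d - t.2) := by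
  have key : ∀ x y, Con ω (Box a b c d) (x + t) (y + t) ↔
      Con (ω ∘ (transl t).j) (Box (a - t.1) (b - t.1) (c - t.2) (d - t.2)) x y := fun x y =>
    (transl t).con' (fun z => by
      simp only [mem_Box, transl, Equiv.coe_addRight, Prod.fst_add, Prod.snd_add]
      omega) rfl rfl
  constructor
  · rintro ⟨x, y, hx, hy, h⟩
    refine ⟨x - t, y - t, by simp [hx], by simp [hy], (key _ _).1 (by simpa using h)⟩
  · rintro ⟨x, y, hx, hy, h⟩
    exact ⟨x + t, y + t, by simp [hx], by simp [hy], (key _ _).2 h⟩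

section Rings

variable {ω ω' η : Config} {u : ℤ} {I O D I' O' D' : Set Vertex}

/-- The part of a blocking circuit outside the switching square, used for the dual path. -/
def DualRing (u : ℤ) (η : Config) : Prop :=
  (VC η (-22 * u) (-21 * u) (-23 * u) (23 * u) ∧ VC η (21 * u) (22 * u) (-23 * u) (23 * u)) ∧
    HC η (-23 * u) (23 * u) (-22 * u) (-21 * u) ∧
    HC η (-23 * u) (12 * u) (14 * u) (16 * u) ∧ HC η (18 * u) (23 * u) (14 * u) (16 * u)

/-- The part of a blocking circuit outside the switching square, used for the primal path. -/
def PrimalRing (u : ℤ) (η : Config) : Prop :=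
  (HC η (-23 * u) (23 * u) (-22 * u) (-21 * u) ∧ HC η (-23 * u) (23 * u) (21 * u) (22 * u)) ∧
    VC η (-22 * u) (-21 * u) (-23 * u) (23 * u) ∧
    VC η (14 * u) (16 * u) (-23 * u) (12 * u) ∧ VC η (14 * u) (16 * u) (18 * u) (23 * u)

/-- The mixed faces of a strip form a connected dual set joining bottom and top. -/
lemma exists_wall {a b c d i j : ℤ} (hij : (i = a ∧ j = b) ∨ (i = b ∧ j = a)) (hab : a < b)
    (hcd : c < d) (h : ¬HC ω a b c d) : ∃ s t, s.2 = c ∧ t.2 = d - 1 ∧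
      Con (star ω) (Box a (b - 1) c (d - 1)) s t ∧
      ∀ f ∈ Box a (b - 1) c (d - 1), Mixed (colN ω a b c d i j) f →
        Con (star ω) (Box a (b - 1) c (d - 1)) s f := by
  obtain ⟨k, k1, k2, k3, -⟩ := colN_mixed hij hab hcd.le h (r := c) ⟨le_rfl, hcd.le⟩
  obtain ⟨l, l1, l2, -, l3, -⟩ := colN_mixed hij hab hcd.le h (r := d) ⟨hcd.le, le_rfl⟩
  have hs : (k, c) ∈ Box a (b - 1) c (d - 1) := by simp only [mem_Box]; omega
  have ht : (l, d - 1) ∈ Box a (b - 1) c (d - 1) := by simp only [mem_Box]; omega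
  exact ⟨_, _, rfl, rfl, colN_wall hij hab hcd.le h hs ht k3 l3,
    fun f hf hm => colN_wall hij hab hcd.le h hs hf k3 hm⟩

/-- The switching square closes one of the two rings, which blocks the corresponding arm. -/
theorem ring_blocks (hu : 1 < u) (hd : DualRing u (star ω)) (hp : PrimalRing u ω')
    (heq : ∀ e ∈ loc (Box (10 * u) (20 * u) (10 * u) (20 * u)), ω e = ω' e)
    (hL : ¬HC ω (10 * u) (11 * u) (10 * u) (20 * u))
    (hR : ¬HC ω (19 * u) (20 * u) (10 * u) (20 * u))
    (h₁ : Link (explored ω (10 * u) (11 * u) (10 * u) (20 * u) (10 * u) (11 * u))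
      (explored ω (19 * u) (20 * u) (10 * u) (20 * u) (20 * u) (19 * u))
      (10 * u) (20 * u) (10 * u + 1) (12 * u) ω)
    (h₂ : Link (explored ω (10 * u) (11 * u) (10 * u) (20 * u) (10 * u) (11 * u))
      (explored ω (19 * u) (20 * u) (10 * u) (20 * u) (20 * u) (19 * u))
      (10 * u) (20 * u) (18 * u) (20 * u - 1) ω)
    (hs : Spans I O D u) (hs' : Spans I' O' D' u) (hA : Arm I O D ω)
    (hA' : Arm I' O' D' (star ω')) : False := by
  obtain ⟨⟨dl, dr⟩, db, d1, d2⟩ := hd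
  obtain ⟨⟨pb, pt⟩, pl, p1, p2⟩ := hp
  rcases links_or_dual (by omega) (by omega) (by omega) (by omega) hL hR h₁ h₂ (by omega)
    (by omega) (by omega) (by omega) with ⟨f, g, hf, hg, hfm, hgm, hfg⟩ |
    ⟨v, v', s, s', e1, e2, e3, e4, hv, hs1, hvs⟩
  · obtain ⟨s, t, hs1, ht1, hst, hsf⟩ := exists_wall (.inl ⟨rfl, rfl⟩) (by omega) (by omega) hL
    obtain ⟨s', t', hs1', ht1', hst', hsf'⟩ :=
      exists_wall (.inr ⟨rfl, rfl⟩) (by omega) (by omega) hR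
    obtain ⟨q, q', hq, hq', cq⟩ := d1
    obtain ⟨r, r', hr, hr', cr⟩ := d2
    obtain ⟨z, z1, z2⟩ := cq.meet hst (fun z hz => hz.2.2) (fun z hz => ⟨hz.1, hz.2.1⟩)
      (by omega) (by omega) (by omega) (by omega)
    obtain ⟨y, y1, y2⟩ := cr.meet hst' (fun z hz => hz.2.2) (fun z hz => ⟨hz.1, hz.2.1⟩)
      (by omega) (by omega) (by omega) (by omega)
    have sub : ∀ {p q r s : ℤ}, 10 * u ≤ r → s ≤ 20 * u - 1 →
        Box p q r s ⊆ {z | 10 * u ≤ z.2 ∧ z.2 ≤ 20 * u - 1} := fun h h' z hz => by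
      simp only [mem_Box] at hz; exact ⟨by omega, by omega⟩
    have chain : Con (star ω) {z | 10 * u ≤ z.2 ∧ z.2 ≤ 20 * u - 1} q r' :=
      (z1.mono_set (sub (by omega) (by omega))).trans <|
      (z2.symm.mono_set (sub le_rfl le_rfl)).trans <|
      ((hsf f hf hfm).mono_set (sub le_rfl le_rfl)).trans <|
      (hfg.mono_set (sub le_rfl le_rfl)).trans <|
      ((hsf' g hg hgm).symm.mono_set (sub le_rfl le_rfl)).trans <|
      (y2.mono_set (sub le_rfl le_rfl)).trans <|
      (y1.symm.trans cr).mono_set (sub (by omega) (by omega))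
    have dt := HC_of_con (a := -23 * u) (b := 23 * u) chain (fun z hz => hz) (by omega) hq.le hr'.ge
    obtain ⟨x, hx, y, hy, hxy⟩ := hA
    have hx' := vnorm_le.1 (hs.inner x hx)
    have hy' := le_vnorm.1 (hs.outer y hy)
    have := mem_Box_of_blocked (a := -22 * u + 1) (b := 22 * u) (c := -22 * u + 1) (d := 20 * u) hxy
      (by simp only [mem_Box]; omega) dl (by omega) (by omega) (by omega) (by omega)
      dr (by omega) (by omega) (by omega) (by omega) dt (by omega) (by omega) (by omega) (by omega)
      db (by omega) (by omega) (by omega) (by omega)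
    simp only [mem_Box] at this; omega
  · obtain ⟨q, q', hq, hq', cq⟩ := p1
    obtain ⟨r, r', hr, hr', cr⟩ := p2
    have toQ : ∀ {x y : Vertex} {p q : ℤ}, 10 * u ≤ p → q ≤ 20 * u →
        Con ω (Box (10 * u) (20 * u) p q) x y → Con ω' (Box (10 * u) (20 * u) p q) x y :=
      fun h h' hc => dep_con _ _ (fun e he => heq e ⟨he.1, he.2.1, h.trans he.2.2.1,
        he.2.2.2.trans h'⟩) hc
    obtain ⟨z, z1, z2⟩ := (toQ (by omega) (by omega) hv).meet cq (fun z hz => hz.2.2)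
      (fun z hz => ⟨hz.1, hz.2.1⟩) (by omega) (by omega) (by omega) (by omega)
    obtain ⟨y, y1, y2⟩ := (toQ (by omega) (by omega) hs1).meet cr (fun z hz => hz.2.2)
      (fun z hz => ⟨hz.1, hz.2.1⟩) (by omega) (by omega) (by omega) (by omega)
    have hvs := toQ le_rfl le_rfl hvs
    have sub : ∀ {p q r s : ℤ}, 10 * u ≤ p → q ≤ 20 * u →
        Box p q r s ⊆ {z | 10 * u ≤ z.1 ∧ z.1 ≤ 20 * u} := fun h h' z hz => by
      simp only [mem_Box] at hz; exact ⟨by omega, by omega⟩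
    have chain : Con ω' {z | 10 * u ≤ z.1 ∧ z.1 ≤ 20 * u} q r' :=
      (z2.mono_set (sub (by omega) (by omega))).trans <|
      (z1.symm.mono_set (sub le_rfl le_rfl)).trans <|
      (hvs.mono_set (sub le_rfl le_rfl)).trans <|
      (y1.mono_set (sub le_rfl le_rfl)).trans <|
      (y2.symm.trans cr).mono_set (sub (by omega) (by omega))
    have pr := VC_of_con (c := -23 * u) (d := 23 * u) chain (fun z hz => hz) (by omega) hq.le hr'.ge
    rw [HC_transl (1, 1), ← star_star] at pb pt
    rw [VC_transl (1, 1), ← star_star] at pl pr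
    obtain ⟨x, hx, y, hy, hxy⟩ := hA'
    have hx' := vnorm_le.1 (hs'.inner x hx)
    have hy' := le_vnorm.1 (hs'.outer y hy)
    have := mem_Box_of_blocked (a := -22 * u) (b := 20 * u) (c := -22 * u) (d := 22 * u) hxy
      (by simp only [mem_Box]; omega) pl (by omega) (by omega) (by omega) (by omega)
      pr (by omega) (by omega) (by omega) (by omega) pt (by omega) (by omega) (by omega) (by omega)
      pb (by omega) (by omega) (by omega) (by omega)
    simp only [mem_Box] at this; omega

end Rings

section Tags

open Classical in
/-- The embedding of the edges into two independent copies, using the first copy on `S`. -/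
noncomputable def tag (S : Set Edge) (e : Edge) : Edge × Bool := (e, decide (e ∉ S))

lemma tag_injective (S : Set Edge) : Function.Injective (tag S) :=
  fun _ _ h => congrArg Prod.fst h

lemma tag_of_mem {S : Set Edge} {e : Edge} (h : e ∈ S) : tag S e = (e, false) := by
  simp [tag, h]

lemma tag_of_notMem {S : Set Edge} {e : Edge} (h : e ∉ S) : tag S e = (e, true) := by
  simp [tag, h]

lemma Dep.tag {X S : Set Edge} {K : Set (Edge × Bool)} {E : Config → Prop} (h : Dep X E)
    (hK : ∀ e ∈ X, tag S e ∈ K) : Dep K fun Ω => E (Ω ∘ tag S) :=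
  fun _ _ hΩ => h _ _ fun e he => hΩ _ (hK e he)

lemma Inv.tag {S : Set Edge} {K : Set (Edge × Bool)} {Z : Set Edge} {f : Config → ℝ}
    (h : Inv Z f) (hK : ∀ e, FKArm.tag S e ∈ K → e ∈ Z) : Inv K fun Ω => f (Ω ∘ tag S) :=
  fun _ _ hΩ => h _ _ fun e he => hΩ _ fun he' => he (hK e he')

lemma MonoOn.tag {S : Set Edge} {f : Config → ℝ} (h : MonoOn Set.univ f)
    (K : Set (Edge × Bool)) : MonoOn K fun Ω => f (Ω ∘ tag S) :=
  fun _ _ hΩ _ => h _ _ (fun _ => hΩ _) fun _ he => absurd trivial he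

lemma avg_tag {S : Set Edge} {Z : Finset Edge} {K : Finset (Edge × Bool)} {f : Config → ℝ}
    (hK : ∀ e, tag S e ∈ K ↔ e ∈ Z) (Ω : Edge × Bool → Bool) :
    avg K (fun Ω => f (Ω ∘ tag S)) Ω = avg Z f (Ω ∘ tag S) := by
  rw [avg_comp (tag_injective S)]
  congr 1
  ext e
  rw [Finset.mem_preimage, hK]

/-- Decoupling the edges of `Z` increases the expected product of an increasing function and a
decreasing function. -/
theorem avg_unshare {S : Set Edge} {Z : Finset Edge} {F : Finset (Edge × Bool)} {f g : Config → ℝ}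
    {r : (Edge × Bool → Bool) → ℝ} (hZS : ↑Z ⊆ S) (hZF : Z ×ˢ Finset.univ ⊆ F)
    (hf : MonoOn Set.univ f) (hg : AntiOn Set.univ g) (hr : ∀ Ω, 0 ≤ r Ω)
    (hr' : Inv (↑(Z ×ˢ (Finset.univ : Finset Bool))) r) (Ω : Edge × Bool → Bool) :
    avg F (fun Ω => r Ω * (f (Ω ∘ tag Set.univ) * g (Ω ∘ tag S))) Ω ≤
      avg F (fun Ω => r Ω * (f (Ω ∘ tag Set.univ) * g (Ω ∘ tag (S \ Z)))) Ω := by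
  classical
  rw [← Finset.sdiff_union_of_subset hZF, avg_union Finset.sdiff_disjoint,
    avg_union Finset.sdiff_disjoint]
  refine avg_mono (fun Ω => ?_) Ω
  rw [avg_mul_left_of_inv hr', avg_mul_left_of_inv hr']
  refine mul_le_mul_of_nonneg_left ?_ (hr Ω)
  set Z0 : Finset (Edge × Bool) := Z ×ˢ {false} with hZ0
  set Z1 : Finset (Edge × Bool) := Z ×ˢ {true} with hZ1
  have hdis : Disjoint Z0 Z1 := by
    rw [Finset.disjoint_left]
    rintro ⟨e, b⟩ h h'
    simp only [hZ0, hZ1, Finset.mem_product, Finset.mem_singleton] at h h'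
    rw [h.2] at h'; simp at h'
  have hun : Z ×ˢ (Finset.univ : Finset Bool) = Z0 ∪ Z1 := by
    ext ⟨e, b⟩
    cases b <;> simp [hZ0, hZ1]
  have m0 : ∀ e b, (e, b) ∈ Z0 ↔ e ∈ Z ∧ b = false := by simp [hZ0]
  have m1 : ∀ e b, (e, b) ∈ Z1 ↔ e ∈ Z ∧ b = true := by simp [hZ1]
  have tu : ∀ e, tag Set.univ e = (e, false) := fun e => tag_of_mem trivial
  have k1 : ∀ e, tag Set.univ e ∈ Z0 ↔ e ∈ Z := fun e => by rw [tu, m0]; simp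
  have k2 : ∀ e, tag Set.univ e ∉ Z1 := fun e => by rw [tu, m1]; simp
  have k3 : ∀ e, tag S e ∈ Z0 ↔ e ∈ Z := fun e => by
    by_cases h : e ∈ S
    · rw [tag_of_mem h, m0]; simp
    · rw [tag_of_notMem h, m0]; simpa using fun h' => h (hZS h')
  have k4 : ∀ e, tag S e ∉ Z1 := fun e => by
    by_cases h : e ∈ S
    · rw [tag_of_mem h, m1]; simp
    · rw [tag_of_notMem h, m1]; simpa using fun h' => h (hZS h')
  have k5 : ∀ e, tag (S \ Z) e ∈ Z1 ↔ e ∈ Z := fun e => by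
    by_cases h : e ∈ S \ Z
    · rw [tag_of_mem h, m1]; simpa using h.2
    · rw [tag_of_notMem h, m1]; simp
  have k6 : ∀ e, tag (S \ Z) e ∉ Z0 := fun e => by
    by_cases h : e ∈ S \ Z
    · rw [tag_of_mem h, m0]; simpa using h.2
    · rw [tag_of_notMem h, m0]; simp
  have iv : ∀ (h : Config → ℝ) {T : Set Edge} {K : Finset (Edge × Bool)}, (∀ e, tag T e ∉ K) →
      Inv (K : Set (Edge × Bool)) fun Ω => h (Ω ∘ tag T) := fun h T K hK Ω Ω' hΩ => by
    have : Ω ∘ tag T = Ω' ∘ tag T := funext fun e => hΩ _ (hK e)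
    exact congrArg h this
  have e1 : avg (Z0 ∪ Z1) (fun Ω => f (Ω ∘ tag Set.univ)) Ω = avg Z f (Ω ∘ tag Set.univ) := by
    rw [avg_union hdis, avg_congr (g := fun Ω => f (Ω ∘ tag Set.univ)) fun Ω _ =>
      avg_of_inv (iv f k2) Ω, avg_tag k1]
  have e2 : avg (Z0 ∪ Z1) (fun Ω => g (Ω ∘ tag (S \ Z))) Ω = avg Z g (Ω ∘ tag (S \ Z)) := by
    rw [avg_union' hdis, avg_congr (g := fun Ω => g (Ω ∘ tag (S \ Z))) fun Ω _ =>
      avg_of_inv (iv g k6) Ω, avg_tag k5]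
  rw [hun, avg_mul_of_disjoint hdis (iv f k2) (iv g k6), e1, e2, avg_union hdis,
    avg_congr (g := fun Ω => f (Ω ∘ tag Set.univ) * g (Ω ∘ tag S)) fun Ω _ =>
      avg_of_inv ((iv f k2).mul (iv g k4)) Ω]
  refine (avg_mul_le (hf.tag _) (fun Ω Ω' h h' => (MonoOn.tag hg _) Ω Ω' h h') Ω).trans
    (le_of_eq ?_)
  rw [avg_tag k1, avg_tag k3]
  congr 1
  refine inv_avg Z g _ _ fun e he => ?_
  have : tag S e = tag (S \ Z) e := by simp [tag, show e ∉ Z from he]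
  simp [this]

end Tags

section Likely

variable {ι : Type*} [DecidableEq ι] {F : Finset ι} {c c' : ℝ} {E E' : (ι → Bool) → Prop}

/-- An increasing event of conditional probability at least `c` when `F` is resampled. -/
structure LikelyUp (F : Finset ι) (c : ℝ) (E : (ι → Bool) → Prop) : Prop where
  incr : Incr E
  le : ∀ ω, c ≤ avg F (ind E) ω

/-- A decreasing event of conditional probability at least `c` when `F` is resampled. -/
structure LikelyDown (F : Finset ι) (c : ℝ) (E : (ι → Bool) → Prop) : Prop where
  decr : Decr E
  le : ∀ ω, c ≤ avg F (ind E) ω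

lemma LikelyUp.mul (h : LikelyUp F c E) (hE' : Incr E') (ω : ι → Bool) :
    c * avg F (ind E') ω ≤ avg F (ind fun ω => E ω ∧ E' ω) ω := by
  have h1 : (ind fun ω => E ω ∧ E' ω) = fun ω => ind E ω * ind E' ω := funext (ind_and E E')
  rw [h1]
  exact (mul_le_mul_of_nonneg_right (h.le ω) (avg_nonneg (ind_nonneg _) _)).trans
    (avg_mul_ge (h.incr.monoOn _) (hE'.monoOn _) ω)

lemma LikelyDown.mul (h : LikelyDown F c E) (hE' : Decr E') (ω : ι → Bool) :
    c * avg F (ind E') ω ≤ avg F (ind fun ω => E ω ∧ E' ω) ω := by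
  have h1 : (ind fun ω => E ω ∧ E' ω) = fun ω => ind E ω * ind E' ω := funext (ind_and E E')
  rw [h1]
  exact (mul_le_mul_of_nonneg_right (h.le ω) (avg_nonneg (ind_nonneg _) _)).trans
    (avg_mul_ge_of_anti (h.decr.antiOn _) (hE'.antiOn _) ω)

lemma LikelyUp.and (h : LikelyUp F c E) (h' : LikelyUp F c' E') (hc : 0 ≤ c) :
    LikelyUp F (c * c') fun ω => E ω ∧ E' ω :=
  ⟨h.incr.and h'.incr, fun ω => (mul_le_mul_of_nonneg_left (h'.le ω) hc).trans (h.mul h'.incr ω)⟩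

lemma LikelyDown.and (h : LikelyDown F c E) (h' : LikelyDown F c' E') (hc : 0 ≤ c) :
    LikelyDown F (c * c') fun ω => E ω ∧ E' ω :=
  ⟨h.decr.and h'.decr, fun ω => (mul_le_mul_of_nonneg_left (h'.le ω) hc).trans (h.mul h'.decr ω)⟩

end Likely

/-- The edges of the annulus at scale `u`. -/
noncomputable def annE (u : ℤ) : Finset Edge :=
  (bx (-31 * u) (31 * u) (-31 * u) (31 * u)).filter fun e => u ≤ vnorm e.1

lemma mem_annE {u : ℤ} {e : Edge} : e ∈ annE u ↔ u ≤ vnorm e.1 ∧ vnorm e.1 ≤ 31 * u := by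
  rw [annE, Finset.mem_filter, mem_bx, vnorm_le]
  simp only [mem_Box]
  constructor <;> intro h <;> refine ⟨?_, ?_⟩ <;> first | exact h.1 | exact h.2 | skip
  all_goals omega

/-- Two copies of the edges of the annulus at scale `u`. -/
noncomputable def annF (u : ℤ) : Finset (Edge × Bool) := annE u ×ˢ Finset.univ

lemma mem_annF {u : ℤ} {x : Edge × Bool} : x ∈ annF u ↔ x.1 ∈ annE u := by
  simp [annF]

lemma tag_fst (S : Set Edge) (e : Edge) : (tag S e).1 = e := rfl

section Crossings

variable {u k a b c d : ℤ} {p : ℝ} {S : Set Edge} {E : Config → Prop}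

lemma Incr.tag (h : Incr E) : Incr fun Ω => E (Ω ∘ FKArm.tag S) :=
  fun _ _ hΩ hE => h _ _ (fun _ => hΩ _) hE

lemma Decr.tag (h : Decr E) : Decr fun Ω => E (Ω ∘ FKArm.tag S) :=
  fun _ _ hΩ hE => h _ _ (fun _ => hΩ _) hE

lemma avg_annF_eq (h : Dep (loc (Box a b c d)) E)
    (hb : ∀ z ∈ Box a b c d, u ≤ vnorm z ∧ vnorm z ≤ 31 * u) (Ω : Edge × Bool → Bool) :
    avg (annF u) (ind fun Ω => E (Ω ∘ tag S)) Ω = pr E := by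
  rw [avg_ind_eq_pr, pr_comp (tag_injective S) h.isLocal]
  exact h.tag fun e he => mem_annF.2 (mem_annE.2 (hb _ he))

/-- `p` bounds from below the probability of crossing a rectangle of bounded aspect ratio. -/
def CrossBound (p : ℝ) : Prop := 0 < p ∧ ∀ w h : ℤ, 3 ≤ h → 0 ≤ w → w ≤ 60 * h → p ≤ hp w h

lemma up_HC (hp : CrossBound p) (hb : ∀ z ∈ Box a b c d, u ≤ vnorm z ∧ vnorm z ≤ 31 * u)
    (h1 : 3 ≤ d - c) (h2 : 0 ≤ b - a) (h3 : b - a ≤ 60 * (d - c)) :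
    LikelyUp (annF u) p fun Ω => HC (Ω ∘ tag S) a b c d :=
  ⟨incr_HC.tag, fun Ω => by
    rw [avg_annF_eq (E := fun ω => HC ω a b c d) dep_HC hb, pr_HC]; exact hp.2 _ _ h1 h2 h3⟩

lemma up_VC (hp : CrossBound p) (hb : ∀ z ∈ Box a b c d, u ≤ vnorm z ∧ vnorm z ≤ 31 * u)
    (h1 : 3 ≤ b - a) (h2 : 0 ≤ d - c) (h3 : d - c ≤ 60 * (b - a)) :
    LikelyUp (annF u) p fun Ω => VC (Ω ∘ tag S) a b c d :=
  ⟨incr_VC.tag, fun Ω => by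
    rw [avg_annF_eq (E := fun ω => VC ω a b c d) dep_VC hb, pr_VC]; exact hp.2 _ _ h1 h2 h3⟩

lemma down_HC (hp : CrossBound p)
    (hb : ∀ z ∈ Box a (b + 1) c (d + 1), u ≤ vnorm z ∧ vnorm z ≤ 31 * u)
    (h1 : 3 ≤ d - c) (h2 : 0 ≤ b - a) (h3 : b - a ≤ 60 * (d - c)) :
    LikelyDown (annF u) p fun Ω => HC (star (Ω ∘ tag S)) a b c d :=
  ⟨(Incr.star (E := fun ω => HC ω a b c d) incr_HC).tag, fun Ω => by
    rw [avg_annF_eq (E := fun ω => HC (star ω) a b c d)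
      (Dep.star_box (E := fun ω => HC ω a b c d) dep_HC) hb, pr_HC_star]
    exact hp.2 _ _ h1 h2 h3⟩

lemma down_VC (hp : CrossBound p)
    (hb : ∀ z ∈ Box a (b + 1) c (d + 1), u ≤ vnorm z ∧ vnorm z ≤ 31 * u)
    (h1 : 3 ≤ b - a) (h2 : 0 ≤ d - c) (h3 : d - c ≤ 60 * (b - a)) :
    LikelyDown (annF u) p fun Ω => VC (star (Ω ∘ tag S)) a b c d :=
  ⟨(Incr.star (E := fun ω => VC ω a b c d) incr_VC).tag, fun Ω => by
    rw [avg_annF_eq (E := fun ω => VC (star ω) a b c d)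
      (Dep.star_box (E := fun ω => VC ω a b c d) dep_VC) hb, pr_VC_star]
    exact hp.2 _ _ h1 h2 h3⟩

lemma down_not_HC (hp : CrossBound p) (hb : ∀ z ∈ Box a b c d, u ≤ vnorm z ∧ vnorm z ≤ 31 * u)
    (h1 : 4 ≤ b - a) (h2 : 0 ≤ d - c) (h3 : d - c + 1 ≤ 60 * (b - a - 1)) :
    LikelyDown (annF u) p fun Ω => ¬ HC (Ω ∘ tag S) a b c d := by
  refine ⟨fun Ω Ω' h h' h'' => h' (incr_HC.tag _ _ h h''), fun Ω => ?_⟩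
  rw [avg_annF_eq (E := fun ω => ¬ HC ω a b c d) dep_HC.not hb]
  have h4 : p ≤ pr fun ω => VC (star ω) a (b - 1) (c - 1) d := by
    rw [pr_VC_star]; exact hp.2 _ _ (by omega) (by omega) (by omega)
  exact h4.trans (pr_mono (Dep.isLocal dep_VC).star (Dep.isLocal dep_HC.not)
    fun _ h => not_HC_of_VC_star h)

lemma up_Circuit (hp : CrossBound p) (hu : 10 ≤ u) (hk : 1 ≤ k) (hk' : k ≤ 25) :
    LikelyUp (annF u) (p ^ 4) fun Ω => Circuit (Ω ∘ tag S) (k * u) ((k + 1) * u) := by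
  have e : (k + 1) * u = k * u + u := by ring
  have e1 : u ≤ k * u := by nlinarith
  have e2 : k * u ≤ 25 * u := by nlinarith
  rw [e]
  refine (?_ : p * p * (p * p) = p ^ 4) ▸ ((LikelyUp.and ?_ ?_ hp.1.le).and
    (LikelyUp.and ?_ ?_ hp.1.le) (mul_nonneg hp.1.le hp.1.le))
  · ring
  all_goals first
    | refine up_VC hp (fun z hz => ?_) (by omega) (by omega) (by omega)
    | refine up_HC hp (fun z hz => ?_) (by omega) (by omega) (by omega)
  all_goals
    simp only [mem_Box] at hz
    rw [vnorm_le, le_vnorm]; omega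

lemma down_Circuit (hp : CrossBound p) (hu : 10 ≤ u) (hk : 2 ≤ k) (hk' : k ≤ 25) :
    LikelyDown (annF u) (p ^ 4) fun Ω => Circuit (star (Ω ∘ tag S)) (k * u) ((k + 1) * u) := by
  have e : (k + 1) * u = k * u + u := by ring
  have e1 : 2 * u ≤ k * u := by nlinarith
  have e2 : k * u ≤ 25 * u := by nlinarith
  rw [e]
  refine (?_ : p * p * (p * p) = p ^ 4) ▸ ((LikelyDown.and ?_ ?_ hp.1.le).and
    (LikelyDown.and ?_ ?_ hp.1.le) (mul_nonneg hp.1.le hp.1.le))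
  · ring
  all_goals first
    | refine down_VC hp (fun z hz => ?_) (by omega) (by omega) (by omega)
    | refine down_HC hp (fun z hz => ?_) (by omega) (by omega) (by omega)
  all_goals
    simp only [mem_Box] at hz
    rw [vnorm_le, le_vnorm]; omega

lemma up_PrimalRing (hp : CrossBound p) (hu : 10 ≤ u) :
    LikelyUp (annF u) (p ^ 5) fun Ω => PrimalRing u (Ω ∘ tag S) := by
  refine (?_ : p * p * (p * (p * p)) = p ^ 5) ▸ ((LikelyUp.and ?_ ?_ hp.1.le).and
    (LikelyUp.and ?_ (LikelyUp.and ?_ ?_ hp.1.le) hp.1.le) (mul_nonneg hp.1.le hp.1.le))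
  · ring
  all_goals first
    | refine up_VC hp (fun z hz => ?_) (by omega) (by omega) (by omega)
    | refine up_HC hp (fun z hz => ?_) (by omega) (by omega) (by omega)
  all_goals
    simp only [mem_Box] at hz
    rw [vnorm_le, le_vnorm]; omega

lemma down_DualRing (hp : CrossBound p) (hu : 10 ≤ u) :
    LikelyDown (annF u) (p ^ 5) fun Ω => DualRing u (star (Ω ∘ tag S)) := by
  refine (?_ : p * p * (p * (p * p)) = p ^ 5) ▸ ((LikelyDown.and ?_ ?_ hp.1.le).and
    (LikelyDown.and ?_ (LikelyDown.and ?_ ?_ hp.1.le) hp.1.le) (mul_nonneg hp.1.le hp.1.le))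
  · ring
  all_goals first
    | refine down_VC hp (fun z hz => ?_) (by omega) (by omega) (by omega)
    | refine down_HC hp (fun z hz => ?_) (by omega) (by omega) (by omega)
  all_goals
    simp only [mem_Box] at hz
    rw [vnorm_le, le_vnorm]; omega

end Crossings

section Scale

variable {I O D I' O' D' : Set Vertex} {u : ℤ} {p : ℝ} {S : Set Edge} {Ω : Edge × Bool → Bool}

/-- The increasing part of the construction of a blocking ring. -/
def IncPart (I O D : Set Vertex) (u : ℤ) (S : Set Edge) (Ω : Edge × Bool → Bool) : Prop :=
  (Joinable I O D u (Ω ∘ tag Set.univ) ∧ HC (Ω ∘ tag Set.univ) 0 (16 * u) u (3 * u) ∧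
    VC (Ω ∘ tag Set.univ) (14 * u) (16 * u) 0 (30 * u)) ∧ PrimalRing u (Ω ∘ tag S)

/-- The decreasing part of the construction of a blocking ring. -/
def DecPart (I O D : Set Vertex) (u : ℤ) (S : Set Edge) (Ω : Edge × Bool → Bool) : Prop :=
  (Joinable I O D u (star (Ω ∘ tag S)) ∧ VC (star (Ω ∘ tag S)) u (3 * u) 0 (16 * u) ∧
    HC (star (Ω ∘ tag S)) 0 (30 * u) (14 * u) (16 * u)) ∧ DualRing u (star (Ω ∘ tag Set.univ))

/-- The second configuration uses the first copy of the edges of the switching square, except for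
those of its core. -/
def Switching (u : ℤ) (S : Set Edge) : Prop := ∀ e ∈ annE u, (e ∈ S ↔
  e.1 ∈ Box (10 * u) (20 * u) (10 * u) (20 * u) ∧ e.1 ∉ Box (13 * u) (17 * u) (13 * u) (17 * u))

lemma IncPart.incr : Incr (IncPart I O D u S) := by
  refine Incr.and (Incr.and Joinable.incr.tag (incr_HC.tag.and incr_VC.tag)) (Incr.tag ?_)
  exact (incr_HC.and incr_HC).and (incr_VC.and (incr_VC.and incr_VC))

lemma DecPart.decr : Decr (DecPart I O D u S) := by
  refine Decr.and (Decr.and (Incr.star Joinable.incr).tag (Decr.and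
    (Incr.star (E := fun ω => VC ω _ _ _ _) incr_VC).tag
    (Incr.star (E := fun ω => HC ω _ _ _ _) incr_HC).tag))
    (Decr.tag (Incr.star (E := DualRing u) ?_))
  exact (incr_VC.and incr_VC).and (incr_HC.and (incr_HC.and incr_HC))

lemma avg_IncPart (hp : CrossBound p) (hu : 10 ≤ u) :
    p ^ 15 * avg (annF u) (ind fun Ω => Arm I O D (Ω ∘ tag Set.univ)) Ω ≤
      avg (annF u) (ind (IncPart I O D u S)) Ω := by
  have h1 := up_Circuit (S := Set.univ) (k := 4) hp hu (by omega) (by omega)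
  have h2 := up_Circuit (S := Set.univ) (k := 25) hp hu (by omega) (by omega)
  have h3 : LikelyUp (annF u) p fun Ω => HC (Ω ∘ tag Set.univ) 0 (16 * u) u (3 * u) :=
    up_HC hp (fun z hz => by simp only [mem_Box] at hz; rw [vnorm_le, le_vnorm]; omega)
      (by omega) (by omega) (by omega)
  have h4 : LikelyUp (annF u) p fun Ω => VC (Ω ∘ tag Set.univ) (14 * u) (16 * u) 0 (30 * u) :=
    up_VC hp (fun z hz => by simp only [mem_Box] at hz; rw [vnorm_le, le_vnorm]; omega)
      (by omega) (by omega) (by omega)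
  have h5 := up_PrimalRing (S := S) hp hu
  have h6 := ((h1.and h2 (by have := hp.1; positivity)).and (h3.and h4 hp.1.le)
    (by have := hp.1; positivity)).and h5 (by have := hp.1; positivity)
  refine le_trans (le_of_eq ?_) ((h6.mul (E' := fun Ω => Arm I O D (Ω ∘ tag Set.univ))
    Arm.incr.tag Ω).trans (avg_mono (fun Ω => ind_mono ?_) Ω))
  · ring
  · rintro ⟨⟨⟨⟨g1, g2⟩, g3⟩, g4⟩, g5⟩
    exact ⟨⟨Joinable.of_arm ⟨g1, g2⟩ g5, g3⟩, g4⟩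

lemma avg_DecPart (hp : CrossBound p) (hu : 10 ≤ u) :
    p ^ 15 * avg (annF u) (ind fun Ω => Arm I O D (star (Ω ∘ tag S))) Ω ≤
      avg (annF u) (ind (DecPart I O D u S)) Ω := by
  have h1 := down_Circuit (S := S) (k := 4) hp hu (by omega) (by omega)
  have h2 := down_Circuit (S := S) (k := 25) hp hu (by omega) (by omega)
  have h3 : LikelyDown (annF u) p fun Ω => VC (star (Ω ∘ tag S)) u (3 * u) 0 (16 * u) :=
    down_VC hp (fun z hz => by simp only [mem_Box] at hz; rw [vnorm_le, le_vnorm]; omega)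
      (by omega) (by omega) (by omega)
  have h4 : LikelyDown (annF u) p fun Ω => HC (star (Ω ∘ tag S)) 0 (30 * u) (14 * u) (16 * u) :=
    down_HC hp (fun z hz => by simp only [mem_Box] at hz; rw [vnorm_le, le_vnorm]; omega)
      (by omega) (by omega) (by omega)
  have h5 := down_DualRing (S := Set.univ) hp hu
  have h6 := ((h1.and h2 (by have := hp.1; positivity)).and (h3.and h4 hp.1.le)
    (by have := hp.1; positivity)).and h5 (by have := hp.1; positivity)
  refine le_trans (le_of_eq ?_) ((h6.mul (E' := fun Ω => Arm I O D (star (Ω ∘ tag S)))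
    (Incr.star Arm.incr).tag Ω).trans (avg_mono (fun Ω => ind_mono ?_) Ω))
  · ring
  · rintro ⟨⟨⟨⟨g1, g2⟩, g3⟩, g4⟩, g5⟩
    exact ⟨⟨Joinable.of_arm ⟨g1, g2⟩ g5, g3⟩, g4⟩

/-- The location of the crossings of `PrimalRing`. -/
def ringZone (u : ℤ) : Set Vertex :=
  Box (-23 * u) (23 * u) (-22 * u) (-21 * u) ∪ (Box (-23 * u) (23 * u) (21 * u) (22 * u) ∪
    (Box (-22 * u) (-21 * u) (-23 * u) (23 * u) ∪ (Box (14 * u) (16 * u) (-23 * u) (12 * u) ∪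
      Box (14 * u) (16 * u) (18 * u) (23 * u))))

/-- The location of the links. -/
def linkZone (u : ℤ) : Set Vertex :=
  Box (10 * u) (20 * u) (10 * u + 1) (12 * u) ∪ Box (10 * u) (20 * u) (18 * u) (20 * u - 1)

/-- The part of the first copy used by the increasing part. -/
def incZone (u : ℤ) : Set Edge :=
  {e | e ∉ middle u ∨ e.1 ∈ Box (14 * u) (16 * u) 0 (30 * u) ∨ e.1 ∈ Box 0 (16 * u) u (3 * u)}

lemma dep_PrimalRing : Dep (loc (ringZone u)) (PrimalRing u) := by
  refine Dep.and (Dep.and ?_ ?_) (Dep.and ?_ (Dep.and ?_ ?_))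
  · exact dep_HC.mono (loc_mono fun _ h => .inl h)
  · exact dep_HC.mono (loc_mono fun _ h => .inr (.inl h))
  · exact dep_VC.mono (loc_mono fun _ h => .inr (.inr (.inl h)))
  · exact dep_VC.mono (loc_mono fun _ h => .inr (.inr (.inr (.inl h))))
  · exact dep_VC.mono (loc_mono fun _ h => .inr (.inr (.inr (.inr h))))

lemma dep_IncPart (hu : 10 ≤ u) (hs : Spans I O D u) (hS : Switching u S) :
    Dep {x | x.1 ∈ annE u → (x.2 = false → x.1 ∈ incZone u) ∧ (x.2 = true → x.1.1 ∈ ringZone u)}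
      (IncPart I O D u S) := by
  have hf : ∀ e, e ∈ incZone u → tag Set.univ e ∈ {x : Edge × Bool | x.1 ∈ annE u →
      (x.2 = false → x.1 ∈ incZone u) ∧ (x.2 = true → x.1.1 ∈ ringZone u)} := fun e he _ => by
    rw [tag_of_mem (Set.mem_univ e)]
    exact ⟨fun _ => he, fun h => absurd h (by simp)⟩
  refine Dep.and (Dep.and ?_ (Dep.and ?_ ?_)) ?_
  · exact (dep_Joinable (by omega) hs).tag fun e he => hf e (.inl he.2)
  · exact (dep_HC (a := 0) (b := 16 * u) (c := u) (d := 3 * u)).tag fun e he =>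
      hf e (.inr (.inr he))
  · exact (dep_VC (a := 14 * u) (b := 16 * u) (c := 0) (d := 30 * u)).tag fun e he =>
      hf e (.inr (.inl he))
  · refine dep_PrimalRing.tag fun e he hA => ?_
    rw [tag_fst] at hA ⊢
    have h1 := hS e hA
    by_cases h : e ∈ S
    · rw [tag_of_mem h]
      refine ⟨fun _ => .inr (.inl ?_), fun h => absurd h (by simp)⟩
      have h2 := (h1.1 h).1
      have h3 : e.1 ∈ ringZone u := he
      simp only [ringZone, Set.mem_union, mem_Box] at h2 h3 ⊢
      omega
    · rw [tag_of_notMem h]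
      exact ⟨fun h => absurd h (by simp), fun _ => he⟩

lemma Dep.star_tag {E : Config → Prop} {X S : Set Edge} {K : Set (Edge × Bool)} (h : Dep X E)
    (hK : ∀ e ∈ X, FKArm.tag S (crossed e) ∈ K) : Dep K fun Ω => E (FKArm.star (Ω ∘ FKArm.tag S)) :=
  fun _ _ hΩ => h _ _ fun e he => congrArg (!·) (hΩ _ (hK e he))

lemma crossed_mem_Box {a b c d : ℤ} {e : Edge} (h : e.1 ∈ Box a b c d) :
    (crossed e).1 ∈ Box a (b + 1) c (d + 1) := by
  obtain ⟨⟨x, y⟩, _ | _⟩ := e <;> simp only [crossed, mem_Box] at h ⊢ <;> simp <;> omega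

lemma dep_DecPart (hu : 10 ≤ u) (hs : Spans I O D u) (hS : Switching u S) :
    Dep {x | x.1 ∈ annE u → (x.2 = false → x.1 ∉ incZone u ∧ x.1.1 ∉ linkZone u) ∧
      (x.2 = true → x.1.1 ∉ ringZone u)} (DecPart I O D u S) := by
  refine Dep.and (Dep.and ?_ (Dep.and ?_ ?_)) ?_
  · refine (dep_Joinable (by omega) hs).star_tag fun e he hA => ?_
    rw [tag_fst] at hA ⊢
    have h1 := hS _ hA
    have h2 : (crossed e).1 ∈ Box (e.1.1) (e.1.1 + 1) (e.1.2) (e.1.2 + 1) :=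
      crossed_mem_Box (by simp [mem_Box])
    have h3 : ¬ (6 * u ≤ vnorm e.1 ∧ vnorm e.1 ≤ 24 * u) := he.2
    simp only [mem_Box] at h2
    rw [le_vnorm, vnorm_le] at h3
    have h : crossed e ∉ S := fun h => by
      have h2' := (h1.1 h).1
      simp only [mem_Box] at h2'
      omega
    rw [tag_of_notMem h]
    refine ⟨fun h => absurd h (by simp), fun _ => ?_⟩
    simp only [ringZone, Set.mem_union, mem_Box]
    omega
  · refine (dep_VC (a := u) (b := 3 * u) (c := 0) (d := 16 * u)).star_tag fun e he hA => ?_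
    rw [tag_fst] at hA ⊢
    have h1 := hS _ hA
    have h2 := crossed_mem_Box he
    simp only [mem_Box] at h2
    have h : crossed e ∉ S := fun h => by
      have h2' := (h1.1 h).1
      simp only [mem_Box] at h2'
      omega
    rw [tag_of_notMem h]
    refine ⟨fun h => absurd h (by simp), fun _ => ?_⟩
    simp only [ringZone, Set.mem_union, mem_Box]
    omega
  · refine (dep_HC (a := 0) (b := 30 * u) (c := 14 * u) (d := 16 * u)).star_tag fun e he hA => ?_
    rw [tag_fst] at hA ⊢
    have h1 := hS _ hA
    have h2 := crossed_mem_Box he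
    simp only [mem_Box] at h1 h2
    by_cases h : crossed e ∈ S
    · rw [tag_of_mem h]
      refine ⟨fun _ => ?_, fun h => absurd h (by simp)⟩
      have h3 := h1.1 h
      simp only [incZone, linkZone, middle, Set.mem_ofPred_eq, Set.mem_union, mem_Box, le_vnorm,
        vnorm_le]
      omega
    · rw [tag_of_notMem h]
      refine ⟨fun h => absurd h (by simp), fun _ => ?_⟩
      simp only [ringZone, Set.mem_union, mem_Box]
      omega
  · have hf : ∀ {a b c d : ℤ}, (∀ z ∈ Box a (b + 1) c (d + 1), (z.1 ≤ -21 * u + 1 ∨ 21 * u ≤ z.1 ∨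
        z.2 ≤ -21 * u + 1 ∨ ((z.1 ≤ 12 * u + 1 ∨ 18 * u ≤ z.1) ∧ 14 * u ≤ z.2 ∧ z.2 ≤ 16 * u + 1)) ∧
        vnorm z ≤ 24 * u) → ∀ e ∈ loc (Box a b c d), tag Set.univ (crossed e) ∈
        {x : Edge × Bool | x.1 ∈ annE u → (x.2 = false → x.1 ∉ incZone u ∧ x.1.1 ∉ linkZone u) ∧
        (x.2 = true → x.1.1 ∉ ringZone u)} := fun hb e he _ => by
      rw [tag_of_mem (Set.mem_univ _)]
      refine ⟨fun _ => ?_, fun h => absurd h (by simp)⟩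
      have h2 := hb _ (crossed_mem_Box he)
      rw [vnorm_le] at h2
      simp only [incZone, linkZone, middle, Set.mem_ofPred_eq, Set.mem_union, mem_Box, le_vnorm,
        vnorm_le]
      omega
    refine Dep.and (Dep.and ?_ ?_) (Dep.and ?_ (Dep.and ?_ ?_))
    · exact dep_VC.star_tag (hf fun z hz => by simp only [mem_Box] at hz; rw [vnorm_le]; omega)
    · exact dep_VC.star_tag (hf fun z hz => by simp only [mem_Box] at hz; rw [vnorm_le]; omega)
    · exact dep_HC.star_tag (hf fun z hz => by simp only [mem_Box] at hz; rw [vnorm_le]; omega)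
    · exact dep_HC.star_tag (hf fun z hz => by simp only [mem_Box] at hz; rw [vnorm_le]; omega)
    · exact dep_HC.star_tag (hf fun z hz => by simp only [mem_Box] at hz; rw [vnorm_le]; omega)

end Scale

section Exploration

variable {I O D I' O' D' : Set Vertex} {u : ℤ} {p : ℝ} {S : Set Edge} {Ω : Edge × Bool → Bool}
  {ω : Config} {n : Set Vertex × Set Vertex}

/-- There are dual vertical crossings of the two lateral strips of the switching square. -/
def Walls (u : ℤ) (ω : Config) : Prop :=
  ¬ HC ω (10 * u) (11 * u) (10 * u) (20 * u) ∧ ¬ HC ω (19 * u) (20 * u) (10 * u) (20 * u)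

/-- The regions that remain unexplored once the outermost walls are known. -/
def between (u : ℤ) (ω : Config) : Set Vertex × Set Vertex :=
  (colN ω (10 * u) (11 * u) (10 * u) (20 * u) (10 * u) (11 * u),
    colN ω (19 * u) (20 * u) (10 * u) (20 * u) (20 * u) (19 * u))

/-- The two walls are linked along the bottom and along the top of the switching square. -/
def Linked (u : ℤ) (n : Set Vertex × Set Vertex) (ω : Config) : Prop :=
  Link (Box (10 * u) (11 * u) (10 * u) (20 * u) \ n.1)
    (Box (19 * u) (20 * u) (10 * u) (20 * u) \ n.2) (10 * u) (20 * u) (10 * u + 1) (12 * u) ω ∧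
  Link (Box (10 * u) (11 * u) (10 * u) (20 * u) \ n.1)
    (Box (19 * u) (20 * u) (10 * u) (20 * u) \ n.2) (10 * u) (20 * u) (18 * u) (20 * u - 1) ω

/-- The edges inspected in order to determine that `between u ω = n`. -/
def inspected (u : ℤ) (n : Set Vertex × Set Vertex) : Set Edge :=
  {e | ((ends e).1 ∈ Box (10 * u) (11 * u) (10 * u) (20 * u) ∧
      (ends e).2 ∈ Box (10 * u) (11 * u) (10 * u) (20 * u) ∧
      ((ends e).1 ∉ n.1 ∨ (ends e).2 ∉ n.1)) ∨
    ((ends e).1 ∈ Box (19 * u) (20 * u) (10 * u) (20 * u) ∧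
      (ends e).2 ∈ Box (19 * u) (20 * u) (10 * u) (20 * u) ∧
      ((ends e).1 ∉ n.2 ∨ (ends e).2 ∉ n.2))}

lemma exists_between_values (hu : 0 < u) : ∃ T : Finset (Set Vertex × Set Vertex),
    (∀ ω, Walls u ω → between u ω ∈ T) ∧ ∀ n ∈ T,
      (∀ z ∈ Col (10 * u) (11 * u) (10 * u) (20 * u) (10 * u), z ∉ n.1) ∧
      ∀ z ∈ Col (19 * u) (20 * u) (10 * u) (20 * u) (20 * u), z ∉ n.2 := by
  obtain ⟨T, hT⟩ := exists_colValues (10 * u) (11 * u) (10 * u) (20 * u) (10 * u) (11 * u)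
  obtain ⟨T', hT'⟩ := exists_colValues (19 * u) (20 * u) (10 * u) (20 * u) (20 * u) (19 * u)
  refine ⟨T ×ˢ T', fun ω hω => Finset.mem_product.2 ⟨(hT _).2 ?_, (hT' _).2 ?_⟩, fun n hn => ?_⟩
  · exact colN_values (.inl ⟨rfl, rfl⟩) (by omega) (by omega) hω.1
  · exact colN_values (.inr ⟨rfl, rfl⟩) (by omega) (by omega) hω.2
  · have := Finset.mem_product.1 hn
    exact ⟨((hT _).1 this.1).2.1, ((hT' _).1 this.2).2.1⟩

lemma inv_between (hu : 0 < u) :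
    Inv (inspected u n)ᶜ (ind fun ω => Walls u ω ∧ between u ω = n) := by
  have h1 := inv_colN (i := 10 * u) (j := 11 * u) (a := 10 * u) (b := 11 * u) (c := 10 * u)
    (d := 20 * u) (.inl ⟨rfl, rfl⟩) (by omega) (by omega) (N := n.1) (G := (inspected u n)ᶜ)
    fun e he h => he (.inl h)
  have h2 := inv_colN (i := 20 * u) (j := 19 * u) (a := 19 * u) (b := 20 * u) (c := 10 * u)
    (d := 20 * u) (.inr ⟨rfl, rfl⟩) (by omega) (by omega) (N := n.2) (G := (inspected u n)ᶜ)
    fun e he h => he (.inr h)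
  convert h1.mul h2 using 1
  funext ω
  rw [← ind_and]
  exact ind_congr (by
    simp only [Walls, between, Prod.ext_iff]
    tauto)

lemma dep_Link {Z₁ Z₂ : Set Vertex} {a b c d : ℤ} :
    Dep {e | (ends e).1 ∈ Box a b c d \ (Z₁ ∪ Z₂) ∧ (ends e).2 ∈ Box a b c d \ (Z₁ ∪ Z₂)}
      (Link Z₁ Z₂ a b c d) := by
  rintro ω ω' hω ⟨v, v', w, w', h1, h2⟩
  exact ⟨v, v', w, w', h1.mono le_rfl fun e e1 e2 e3 => by rw [← hω e ⟨e1, e2⟩, e3], h2⟩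

lemma dep_Linked : Dep (loc (linkZone u) \ inspected u n) (Linked u n) := by
  refine Dep.and (dep_Link.mono ?_) (dep_Link.mono ?_)
  · rintro e ⟨h1, h2⟩
    refine ⟨.inl h1.1, ?_⟩
    rintro (⟨h3, h4, h5 | h5⟩ | ⟨h3, h4, h5 | h5⟩)
    · exact h1.2 (.inl ⟨h3, h5⟩)
    · exact h2.2 (.inl ⟨h4, h5⟩)
    · exact h1.2 (.inr ⟨h3, h5⟩)
    · exact h2.2 (.inr ⟨h4, h5⟩)
  · rintro e ⟨h1, h2⟩
    refine ⟨.inr h1.1, ?_⟩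
    rintro (⟨h3, h4, h5 | h5⟩ | ⟨h3, h4, h5 | h5⟩)
    · exact h1.2 (.inl ⟨h3, h5⟩)
    · exact h2.2 (.inl ⟨h4, h5⟩)
    · exact h1.2 (.inr ⟨h3, h5⟩)
    · exact h2.2 (.inr ⟨h4, h5⟩)

lemma link_of_HC {c d : ℤ} (hu : 1 < u) (hc : 10 * u ≤ c) (hd : d ≤ 20 * u)
    (hn : ∀ z ∈ Col (10 * u) (11 * u) (10 * u) (20 * u) (10 * u), z ∉ n.1)
    (hn' : ∀ z ∈ Col (19 * u) (20 * u) (10 * u) (20 * u) (20 * u), z ∉ n.2)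
    (h : HC ω (10 * u) (20 * u) c d) :
    Link (Box (10 * u) (11 * u) (10 * u) (20 * u) \ n.1)
      (Box (19 * u) (20 * u) (10 * u) (20 * u) \ n.2) (10 * u) (20 * u) c d ω := by
  obtain ⟨x, y, hx, hy, hc⟩ := h
  have mx := hc.left_mem
  have my := hc.right_mem
  simp only [mem_Box] at mx my
  have bx : x ∈ Box (10 * u) (11 * u) (10 * u) (20 * u) := by simp only [mem_Box]; omega
  have bY : y ∈ Box (19 * u) (20 * u) (10 * u) (20 * u) := by simp only [mem_Box]; omega
  obtain ⟨v, v', w, w', h1, h2, h3, -, h4, h5, -⟩ := hc.extract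
    (Z₁ := Box (10 * u) (11 * u) (10 * u) (20 * u) \ n.1)
    (Z₂ := Box (19 * u) (20 * u) (10 * u) (20 * u) \ n.2) ⟨bx, hn x ⟨bx, hx⟩⟩ ⟨bY, hn' y ⟨bY, hy⟩⟩
    (fun z h h' => by have := h.1; have := h'.1; simp only [mem_Box] at *; omega)
    (fun a h b h' hab => by
      have := h.1; have := h'.1; have := openAdj_near hab; simp only [mem_Box] at *; omega)
  exact ⟨v, v', w, w', h1, h2.full, h3, h4.full, h5⟩

/-- The ingredients of `ring_blocks`. -/
def Blocking (u : ℤ) (S : Set Edge) (Ω : Edge × Bool → Bool) : Prop :=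
  (DualRing u (star (Ω ∘ tag Set.univ)) ∧ PrimalRing u (Ω ∘ tag S)) ∧
    Walls u (Ω ∘ tag Set.univ) ∧ Linked u (between u (Ω ∘ tag Set.univ)) (Ω ∘ tag Set.univ)

lemma inspected_sub (hu : 10 ≤ u) {e : Edge} (he : e ∈ inspected u n) :
    e ∈ annE u ∧ e ∉ incZone u := by
  have h : (ends e).1 = e.1 := rfl
  simp only [inspected, Set.mem_ofPred_eq, h, mem_Box] at he
  simp only [mem_annE, incZone, middle, Set.mem_ofPred_eq, mem_Box, le_vnorm, vnorm_le]
  omega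

/-- Resampling the part of the annulus not used by the decreasing part, the walls can be linked
while keeping the increasing part. -/
lemma avg_walls_linked (hp : CrossBound p) (hu : 10 ≤ u) (hs : Spans I O D u)
    (hS : Switching u S) {F : Finset (Edge × Bool)} (hF : ∀ x, x ∈ F ↔ x.1 ∈ annE u ∧
      ¬ ((x.2 = false → x.1 ∉ incZone u ∧ x.1.1 ∉ linkZone u) ∧
        (x.2 = true → x.1.1 ∉ ringZone u))) :
    p ^ 2 * avg (annF u) (ind (IncPart I O D u S)) Ω *
      avg F (ind fun Ω => Walls u (Ω ∘ tag Set.univ)) Ω ≤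
      avg F (ind fun Ω => Walls u (Ω ∘ tag Set.univ) ∧
        Linked u (between u (Ω ∘ tag Set.univ)) (Ω ∘ tag Set.univ) ∧ IncPart I O D u S Ω) Ω := by
  classical
  obtain ⟨T, hT, hT'⟩ := exists_between_values (u := u) (by omega)
  have hsub : F ⊆ annF u := fun x hx => mem_annF.2 ((hF x).1 hx).1
  have tu : ∀ e, tag Set.univ e = (e, false) := fun e => tag_of_mem trivial
  refine avg_explore (T := T) (N := fun Ω => between u (Ω ∘ tag Set.univ))
    (E := fun Ω => Walls u (Ω ∘ tag Set.univ))
    (Y := fun n Ω => Linked u n (Ω ∘ tag Set.univ) ∧ IncPart I O D u S Ω)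
    (G := fun n => F.filter fun x => x.2 = false ∧ x.1 ∈ inspected u n)
    (fun Ω h => hT _ h) (fun n _ => Finset.filter_subset _ _) (fun n _ => ?_) (fun n _ => ?_)
    fun n hn => ?_
  · refine Inv.tag (f := ind fun ω => Walls u ω ∧ between u ω = n) (inv_between (by omega))
      fun e he h => ?_
    rw [tu] at he
    have he' := Finset.mem_sdiff.1 (Finset.mem_coe.1 he)
    exact he'.2 (Finset.mem_filter.2 ⟨he'.1, rfl, h⟩)
  · refine (Dep.and (dep_Linked.tag (S := Set.univ) fun e he => ?_)
      ((dep_IncPart hu hs hS).mono ?_)).inv (F := {x | ¬ (x.2 = false ∧ x.1 ∈ inspected u n)}) ?_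
    · rw [tu]
      exact fun h => he.2 h.2
    · intro x hx h
      exact (inspected_sub hu h.2).2 ((hx (inspected_sub hu h.2).1).1 h.1)
    · rw [Set.disjoint_left]
      intro x hx hx'
      exact hx (Finset.mem_filter.1 hx').2
  · have h1 : LikelyUp (annF u) p fun Ω => HC (Ω ∘ tag Set.univ) (10 * u) (20 * u) (10 * u + 1)
        (12 * u) :=
      up_HC hp (fun z hz => by simp only [mem_Box] at hz; rw [vnorm_le, le_vnorm]; omega)
        (by omega) (by omega) (by omega)
    have h2 : LikelyUp (annF u) p fun Ω => HC (Ω ∘ tag Set.univ) (10 * u) (20 * u) (18 * u)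
        (20 * u - 1) :=
      up_HC hp (fun z hz => by simp only [mem_Box] at hz; rw [vnorm_le, le_vnorm]; omega)
        (by omega) (by omega) (by omega)
    have h3 := (h1.and h2 hp.1.le).mul
      (IncPart.incr (I := I) (O := O) (D := D) (u := u) (S := S)) Ω
    rw [← sq] at h3
    refine h3.trans ?_
    rw [avg_eq_of_subset hsub]
    · refine avg_mono (fun Ω => ind_mono fun h => ⟨⟨?_, ?_⟩, h.2⟩) Ω
      · exact link_of_HC (by omega) (by omega) (by omega) (hT' n hn).1 (hT' n hn).2 h.1.1
      · exact link_of_HC (by omega) (by omega) (by omega) (hT' n hn).1 (hT' n hn).2 h.1.2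
    · refine (Dep.and (Dep.and (dep_HC.tag fun e he => ?_) (dep_HC.tag fun e he => ?_))
        ((dep_IncPart hu hs hS).mono ?_)).inv (F := {x | x.1 ∈ annE u → x ∈ F}) ?_
      · intro h
        rw [hF, tu]
        exact ⟨h, fun h' => (h'.1 rfl).2 (.inl he)⟩
      · intro h
        rw [hF, tu]
        exact ⟨h, fun h' => (h'.1 rfl).2 (.inr he)⟩
      · rintro ⟨e, b⟩ hx h
        rw [hF]
        refine ⟨h, fun h' => ?_⟩
        cases b
        · exact (h'.1 rfl).1 ((hx h).1 rfl)
        · exact h'.2 rfl ((hx h).2 rfl)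
      · rw [Set.disjoint_left]
        intro x hx hx'
        have := Finset.mem_sdiff.1 (Finset.mem_coe.1 hx')
        exact this.2 (hx (mem_annF.1 this.1))

/-- The blocking event is compatible with the arm events. -/
theorem avg_blocking_ge (hp : CrossBound p) (hu : 10 ≤ u) (hs : Spans I O D u)
    (hs' : Spans I' O' D' u) (hS : Switching u S) :
    p ^ 34 * (avg (annF u) (ind fun Ω => Arm I O D (Ω ∘ tag Set.univ)) Ω *
      avg (annF u) (ind fun Ω => Arm I' O' D' (star (Ω ∘ tag S))) Ω) ≤
      avg (annF u) (ind fun Ω => Blocking u S Ω ∧ Arm I O D (Ω ∘ tag Set.univ) ∧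
        Arm I' O' D' (star (Ω ∘ tag S))) Ω := by
  classical
  set F := (annF u).filter fun x => ¬ ((x.2 = false → x.1 ∉ incZone u ∧ x.1.1 ∉ linkZone u) ∧
    (x.2 = true → x.1.1 ∉ ringZone u)) with hFdef
  have hF : ∀ x, x ∈ F ↔ x.1 ∈ annE u ∧ ¬ ((x.2 = false → x.1 ∉ incZone u ∧ x.1.1 ∉ linkZone u) ∧
    (x.2 = true → x.1.1 ∉ ringZone u)) := fun x => by rw [hFdef, Finset.mem_filter, mem_annF]
  have hsub : F ⊆ annF u := Finset.filter_subset _ _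
  set H := annF u \ F with hH
  have hun : annF u = H ∪ F := (Finset.sdiff_union_of_subset hsub).symm
  have hdis : Disjoint H F := Finset.sdiff_disjoint
  set P := ind (DecPart I' O' D' u S) with hP
  have hPF : Inv (F : Set (Edge × Bool)) P := by
    refine (dep_DecPart hu hs' hS).inv ?_
    rw [Set.disjoint_left]
    intro x hx hx'
    have := (hF x).1 hx'
    exact this.2 (hx this.1)
  set W := fun Ω : Edge × Bool → Bool => Walls u (Ω ∘ tag Set.univ) with hW
  set a := avg (annF u) (ind (IncPart I O D u S)) Ω with ha
  have hp0 := hp.1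
  have h1 : p ^ 15 * avg (annF u) (ind fun Ω => Arm I O D (Ω ∘ tag Set.univ)) Ω ≤ a :=
    avg_IncPart hp hu
  have h2 : p ^ 15 * avg (annF u) (ind fun Ω => Arm I' O' D' (star (Ω ∘ tag S))) Ω ≤
    avg (annF u) P Ω := avg_DecPart hp hu
  have h3 : p ^ 2 * avg (annF u) P Ω ≤ avg (annF u) (fun Ω => P Ω * ind W Ω) Ω := by
    have g1 : LikelyDown (annF u) p fun Ω => ¬ HC (Ω ∘ tag Set.univ) (10 * u) (11 * u) (10 * u)
        (20 * u) :=
      down_not_HC hp (fun z hz => by simp only [mem_Box] at hz; rw [vnorm_le, le_vnorm]; omega)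
        (by omega) (by omega) (by omega)
    have g2 : LikelyDown (annF u) p fun Ω => ¬ HC (Ω ∘ tag Set.univ) (19 * u) (20 * u) (10 * u)
        (20 * u) :=
      down_not_HC hp (fun z hz => by simp only [mem_Box] at hz; rw [vnorm_le, le_vnorm]; omega)
        (by omega) (by omega) (by omega)
    have g3 := (g1.and g2 hp.1.le).mul
      (DecPart.decr (I := I') (O := O') (D := D') (u := u) (S := S)) Ω
    rw [← sq] at g3
    refine g3.trans (le_of_eq ?_)
    congr 1
    funext Ω
    rw [ind_and, mul_comm]
    rfl
  have h4 : p ^ 2 * a * avg (annF u) (fun Ω => P Ω * ind W Ω) Ω ≤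
      avg (annF u) (fun Ω => P Ω * ind (fun Ω => W Ω ∧
        Linked u (between u (Ω ∘ tag Set.univ)) (Ω ∘ tag Set.univ) ∧ IncPart I O D u S Ω) Ω) Ω := by
    rw [hun, avg_union hdis, avg_union hdis, ← avg_const_mul]
    refine avg_mono' fun Ω' hΩ' => ?_
    rw [avg_mul_left_of_inv hPF, avg_mul_left_of_inv hPF, mul_left_comm]
    refine mul_le_mul_of_nonneg_left ?_ (ind_nonneg _ _)
    have e : a = avg (annF u) (ind (IncPart I O D u S)) Ω' :=
      inv_avg _ _ _ _ fun x hx => (hΩ' x fun h => hx (Finset.sdiff_subset h)).symm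
    rw [e]
    exact avg_walls_linked hp hu hs hS hF
  have h5 : avg (annF u) (fun Ω => P Ω * ind (fun Ω => W Ω ∧
      Linked u (between u (Ω ∘ tag Set.univ)) (Ω ∘ tag Set.univ) ∧ IncPart I O D u S Ω) Ω) Ω ≤
      avg (annF u) (ind fun Ω => Blocking u S Ω ∧ Arm I O D (Ω ∘ tag Set.univ) ∧
        Arm I' O' D' (star (Ω ∘ tag S))) Ω := by
    refine avg_mono (fun Ω => ?_) Ω
    rw [hP, ← ind_and]
    refine ind_mono ?_
    rintro ⟨⟨⟨d1, d2⟩, d3⟩, k1, k2, ⟨i1, i2⟩, i3⟩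
    exact ⟨⟨⟨d3, i3⟩, k1, k2⟩, i1.arm hs (by omega) (.inl i2), d1.arm hs' (by omega) (.inr d2)⟩
  refine le_trans ?_ (h4.trans h5)
  have n2 := avg_nonneg (F := annF u)
    (ind_nonneg fun Ω : Edge × Bool → Bool => Arm I' O' D' (star (Ω ∘ tag S))) Ω
  have n3 : 0 ≤ a := avg_nonneg (ind_nonneg _) _
  generalize avg (annF u) (ind fun Ω => Arm I O D (Ω ∘ tag Set.univ)) Ω = x at h1 ⊢
  generalize avg (annF u) (ind fun Ω => Arm I' O' D' (star (Ω ∘ tag S))) Ω = y at h2 n2 ⊢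
  generalize avg (annF u) (fun Ω => P Ω * ind W Ω) Ω = z at h3 ⊢
  generalize avg (annF u) P Ω = b at h2 h3
  clear_value a
  calc _ = p ^ 2 * (p ^ 15 * x) * (p ^ 2 * (p ^ 15 * y)) := by ring
    _ ≤ p ^ 2 * a * (p ^ 2 * b) := by gcongr
    _ ≤ p ^ 2 * a * z := by gcongr

end Exploration

section Strip

variable {I O D I' O' D' : Set Vertex} {u : ℤ} {p : ℝ} {S S' : Set Edge}

/-- The core of the switching square. -/
def core (u : ℤ) : Set Vertex := Box (13 * u) (17 * u) (13 * u) (17 * u)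

lemma dep_DualRing_star (hu : 10 ≤ u) : Dep (loc (core u))ᶜ fun ω => DualRing u (star ω) := by
  have hf : ∀ {a b c d : ℤ} {E : Config → Prop}, Dep (loc (Box a b c d)) E →
      (∀ z ∈ Box a (b + 1) c (d + 1), z ∉ core u) → Dep (loc (core u))ᶜ fun ω => E (star ω) :=
    fun h hb => h.star_box.mono fun e he => hb _ he
  refine Dep.and (Dep.and ?_ ?_) (Dep.and ?_ (Dep.and ?_ ?_))
  · exact hf dep_VC fun z hz h => by simp only [core, mem_Box] at hz h; omega
  · exact hf dep_VC fun z hz h => by simp only [core, mem_Box] at hz h; omega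
  · exact hf dep_HC fun z hz h => by simp only [core, mem_Box] at hz h; omega
  · exact hf dep_HC fun z hz h => by simp only [core, mem_Box] at hz h; omega
  · exact hf dep_HC fun z hz h => by simp only [core, mem_Box] at hz h; omega

lemma dep_PrimalRing_core (hu : 10 ≤ u) : Dep (loc (core u))ᶜ (PrimalRing u) :=
  dep_PrimalRing.mono fun e he h => by
    have h1 : e.1 ∈ ringZone u := he
    have h2 : e.1 ∈ core u := h
    simp only [core, ringZone, Set.mem_union, mem_Box] at h1 h2
    omega

lemma dep_walls_linked (hu : 10 ≤ u) :
    Dep (loc (core u))ᶜ fun ω => Walls u ω ∧ Linked u (between u ω) ω := by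
  rintro ω ω' hω ⟨⟨h1, h2⟩, h3⟩
  obtain ⟨g1, k1⟩ := colN_congr (.inl ⟨rfl, rfl⟩) (by omega) (by omega) h1 (ω' := ω')
    fun e he _ _ => hω e fun h => by
      have h' : e.1 ∈ core u := h
      have he' : e.1 ∈ Box (10 * u) (11 * u) (10 * u) (20 * u) := he
      simp only [core, mem_Box] at h' he'
      omega
  obtain ⟨g2, k2⟩ := colN_congr (.inr ⟨rfl, rfl⟩) (by omega) (by omega) h2 (ω' := ω')
    fun e he _ _ => hω e fun h => by
      have h' : e.1 ∈ core u := h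
      have he' : e.1 ∈ Box (19 * u) (20 * u) (10 * u) (20 * u) := he
      simp only [core, mem_Box] at h' he'
      omega
  have hb : between u ω' = between u ω := Prod.ext k1 k2
  refine ⟨⟨g1, g2⟩, hb ▸ dep_Linked _ _ (fun e he => hω e fun h => ?_) h3⟩
  have h' : e.1 ∈ core u := h
  have he' : e.1 ∈ linkZone u := he.1
  simp only [core, linkZone, Set.mem_union, mem_Box] at h' he'
  omega

lemma dep_Blocking (hu : 10 ≤ u) : Dep {x | x.1.1 ∉ core u} (Blocking u S) := by
  refine Dep.and (Dep.and ?_ ?_) ?_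
  · exact Dep.tag (E := fun ω => DualRing u (star ω)) (dep_DualRing_star hu) fun e he => he
  · exact (dep_PrimalRing_core hu).tag fun e he => he
  · exact Dep.tag (E := fun ω => Walls u ω ∧ Linked u (between u ω) ω) (dep_walls_linked hu)
      fun e he => he

lemma Blocking.false {Ω : Edge × Bool → Bool} (h : Blocking u S Ω) (hu : 10 ≤ u)
    (hS : ∀ e, e.1 ∉ core u → (e ∈ S ↔ e ∈ S'))
    (hS' : loc (Box (10 * u) (20 * u) (10 * u) (20 * u)) ⊆ S')
    (hs : Spans I O D u) (hs' : Spans I' O' D' u) (hA : Arm I O D (Ω ∘ tag Set.univ))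
    (hA' : Arm I' O' D' (star (Ω ∘ tag S'))) : False := by
  obtain ⟨⟨h1, h2⟩, ⟨h3, h4⟩, h5, h6⟩ := h
  refine ring_blocks (by omega) h1 (dep_PrimalRing_core hu _ _ (fun e he => ?_) h2) (fun e he => ?_)
    h3 h4 h5 h6 hs hs' hA hA'
  · have := hS e he
    by_cases h : e ∈ S
    · simp only [Function.comp_apply, tag_of_mem h, tag_of_mem (this.1 h)]
    · simp only [Function.comp_apply, tag_of_notMem h, tag_of_notMem fun h' => h (this.2 h')]
  · simp only [Function.comp_apply, tag_of_mem (Set.mem_univ e), tag_of_mem (hS' he)]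

lemma avg_annF_tag {f : Config → ℝ} (hS : ∀ e ∉ annE u, (e ∈ S ↔ e ∈ S'))
    (Ω : Edge × Bool → Bool) :
    avg (annF u) (fun Ω => f (Ω ∘ tag S)) Ω = avg (annF u) (fun Ω => f (Ω ∘ tag S')) Ω := by
  rw [avg_tag (Z := annE u) fun e => mem_annF, avg_tag (Z := annE u) fun e => mem_annF]
  refine inv_avg _ _ _ _ fun e he => ?_
  have := hS e he
  by_cases h : e ∈ S
  · simp only [Function.comp_apply, tag_of_mem h, tag_of_mem (this.1 h)]
  · simp only [Function.comp_apply, tag_of_notMem h, tag_of_notMem fun h' => h (this.2 h')]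

lemma avg_prod_mul {Z : Finset Edge} {f g : Config → ℝ} (hS : ∀ e ∈ Z, e ∉ S)
    (Ω : Edge × Bool → Bool) :
    avg (Z ×ˢ Finset.univ) (fun Ω => f (Ω ∘ tag Set.univ) * g (Ω ∘ tag S)) Ω =
      avg (Z ×ˢ Finset.univ) (fun Ω => f (Ω ∘ tag Set.univ)) Ω *
        avg (Z ×ˢ Finset.univ) (fun Ω => g (Ω ∘ tag S)) Ω := by
  classical
  have hun : Z ×ˢ (Finset.univ : Finset Bool) = Z ×ˢ {false} ∪ Z ×ˢ {true} := by
    ext ⟨e, b⟩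
    cases b <;> simp
  have hdis : Disjoint (Z ×ˢ {false}) (Z ×ˢ {true}) := by
    rw [Finset.disjoint_left]
    rintro ⟨e, b⟩ h h'
    cases b <;> simp at h h'
  have i1 : Inv (↑(Z ×ˢ ({true} : Finset Bool))) fun Ω : Edge × Bool → Bool =>
      f (Ω ∘ tag Set.univ) := fun Ω Ω' h => congrArg f (funext fun e => h _ (by
    simp [tag_of_mem (Set.mem_univ e)]))
  have i2 : Inv (↑(Z ×ˢ ({false} : Finset Bool))) fun Ω : Edge × Bool → Bool =>
      g (Ω ∘ tag S) := fun Ω Ω' h => congrArg g (funext fun e => h _ (by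
    by_cases he : e ∈ Z
    · simp [tag_of_notMem (hS e he)]
    · exact fun h => he (Finset.mem_product.1 (Finset.mem_coe.1 h)).1))
  rw [hun]
  exact avg_mul_of_disjoint hdis i1 i2 Ω

/-- Decoupling the edges of an annulus multiplies the two-arm probability by more than a constant
factor. -/
theorem avg_strip (hp : CrossBound p) (hu : 10 ≤ u) (hs : Spans I O D u) (hs' : Spans I' O' D' u)
    (hS : ↑(annE u) ⊆ S) (Ω : Edge × Bool → Bool) :
    avg (annF u) (fun Ω => ind (Arm I O D) (Ω ∘ tag Set.univ) *
        ind (fun ω => Arm I' O' D' (star ω)) (Ω ∘ tag S)) Ω ≤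
      (1 - p ^ 34) * avg (annF u) (fun Ω => ind (Arm I O D) (Ω ∘ tag Set.univ) *
        ind (fun ω => Arm I' O' D' (star ω)) (Ω ∘ tag (S \ annE u))) Ω := by
  classical
  set f : Config → ℝ := ind (Arm I O D) with hf
  set g : Config → ℝ := ind fun ω => Arm I' O' D' (star ω) with hg
  have mf : MonoOn Set.univ f := Arm.incr.monoOn _
  have mg : AntiOn Set.univ g := (Incr.star Arm.incr).antiOn _
  set Q := bx (10 * u) (20 * u) (10 * u) (20 * u) with hQ
  set T := bx (13 * u) (17 * u) (13 * u) (17 * u) with hT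
  have hQA : ∀ e ∈ Q, e ∈ annE u := fun e he => by
    rw [hQ, mem_bx, mem_Box] at he
    rw [mem_annE, vnorm_le, le_vnorm]
    omega
  have hTQ : ∀ e ∈ T, e ∈ Q := fun e he => by
    rw [hT, mem_bx, mem_Box] at he
    rw [hQ, mem_bx, mem_Box]
    omega
  have hTc : ∀ e, e ∈ T ↔ e.1 ∈ core u := fun e => mem_bx
  set S₁ := S \ ↑(annE u \ Q) with hS₁
  set S₂ := S₁ \ ↑T with hS₂
  have m1 : ∀ e, e ∈ S₁ ↔ e ∈ S ∧ ¬ (e ∈ annE u ∧ e ∉ Q) := fun e => by simp [hS₁]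
  have m2 : ∀ e, e ∈ S₂ ↔ e ∈ S₁ ∧ e ∉ T := fun e => by simp [hS₂]
  have m3 : S \ annE u = S₂ \ ↑(Q \ T) := by
    ext e
    have h1 := hQA e
    have h2 := hTQ e
    simp only [Set.mem_sdiff, m2, m1, Finset.coe_sdiff, Finset.mem_coe]
    generalize (e ∈ Q) = a at h1 h2 ⊢
    generalize (e ∈ T) = b at h2 ⊢
    generalize (e ∈ annE u) = c at h1 ⊢
    tauto
  have hsub : ∀ Z : Finset Edge, (∀ e ∈ Z, e ∈ annE u) → Z ×ˢ Finset.univ ⊆ annF u :=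
    fun Z hZ x hx => mem_annF.2 (hZ _ (Finset.mem_product.1 hx).1)
  have sw : Switching u S₂ := fun e he => by
    have h1 := hS he
    have h2 := hQA e
    rw [m2, m1, hTc, hQ, mem_bx]
    rw [hQ, mem_bx] at h2
    simp only [core]
    tauto
  set r : (Edge × Bool → Bool) → ℝ := fun Ω => 1 - ind (Blocking u S₂) Ω with hr
  have r0 : ∀ Ω, 0 ≤ r Ω := fun Ω => sub_nonneg.2 (ind_le_one _ _)
  have rinv : Inv (↑(T ×ˢ (Finset.univ : Finset Bool))) r := fun Ω Ω' h => by
    refine congrArg (1 - ·) (ind_congr ((dep_Blocking hu).iff fun x hx => h x fun hx' => hx ?_))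
    exact (hTc _).1 (Finset.mem_product.1 (Finset.mem_coe.1 hx')).1
  have e1 : avg (annF u) (fun Ω => f (Ω ∘ tag Set.univ) * g (Ω ∘ tag S)) Ω ≤
      avg (annF u) (fun Ω => f (Ω ∘ tag Set.univ) * g (Ω ∘ tag S₁)) Ω := by
    have := avg_unshare (r := fun _ => 1) (S := S) (Z := annE u \ Q)
      (fun e he => hS (Finset.sdiff_subset he)) (hsub _ fun e he => Finset.sdiff_subset he) mf mg
      (fun _ => zero_le_one) (fun _ _ _ => rfl) Ω
    simpa only [one_mul] using this
  have e2 : avg (annF u) (fun Ω => f (Ω ∘ tag Set.univ) * g (Ω ∘ tag S₁)) Ω ≤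
      avg (annF u) (fun Ω => r Ω * (f (Ω ∘ tag Set.univ) * g (Ω ∘ tag S₁))) Ω := by
    refine avg_mono (fun Ω => ?_) Ω
    by_cases hB : Blocking u S₂ Ω ∧ Arm I O D (Ω ∘ tag Set.univ) ∧
        Arm I' O' D' (star (Ω ∘ tag S₁))
    · refine (hB.1.false hu (fun e he => ?_) (fun e he => ?_) hs hs' hB.2.1 hB.2.2).elim
      · rw [m2, hTc]
        exact and_iff_left he
      · have : e ∈ Q := mem_bx.2 he
        rw [m1]
        exact ⟨hS (hQA e this), fun h => h.2 this⟩
    · by_cases h1 : Blocking u S₂ Ω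
      · have : f (Ω ∘ tag Set.univ) * g (Ω ∘ tag S₁) = 0 := by
          by_cases h2 : Arm I O D (Ω ∘ tag Set.univ)
          · rw [mul_eq_zero]
            exact .inr (ind_of_not fun h3 => hB ⟨h1, h2, h3⟩)
          · rw [mul_eq_zero]
            exact .inl (ind_of_not h2)
        rw [this, mul_zero]
      · rw [hr]
        simp only [ind_of_not h1, sub_zero, one_mul, le_refl]
  have e3 := avg_unshare (S := S₁) (Z := T)
    (fun e he => (m1 e).2 ⟨hS (hQA e (hTQ e he)), fun h => h.2 (hTQ e he)⟩)
    (hsub _ fun e he => hQA e (hTQ e he)) mf mg r0 rinv Ω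
  have e4 : avg (annF u) (fun Ω => r Ω * (f (Ω ∘ tag Set.univ) * g (Ω ∘ tag S₂))) Ω =
      avg (annF u) (fun Ω => f (Ω ∘ tag Set.univ) * g (Ω ∘ tag S₂)) Ω -
        avg (annF u) (ind fun Ω => Blocking u S₂ Ω ∧ Arm I O D (Ω ∘ tag Set.univ) ∧
          Arm I' O' D' (star (Ω ∘ tag S₂))) Ω := by
    rw [← avg_sub]
    congr 1
    funext Ω
    rw [ind_and, ind_and (fun Ω => Arm I O D (Ω ∘ tag Set.univ))]
    change (1 - _) * (f _ * g _) = f _ * g _ - _ * (f _ * g _)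
    ring
  have e5 : p ^ 34 * (avg (annF u) (fun Ω => f (Ω ∘ tag Set.univ)) Ω *
      avg (annF u) (fun Ω => g (Ω ∘ tag S₂)) Ω) ≤ _ := avg_blocking_ge (Ω := Ω) hp hu hs hs' sw
  have e6 : avg (annF u) (fun Ω => f (Ω ∘ tag Set.univ) * g (Ω ∘ tag S₂)) Ω ≤
      avg (annF u) (fun Ω => f (Ω ∘ tag Set.univ) * g (Ω ∘ tag (S \ annE u))) Ω := by
    rw [m3]
    have := avg_unshare (r := fun _ => 1) (S := S₂) (Z := Q \ T)
      (fun e he => by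
        have := Finset.mem_sdiff.1 (Finset.mem_coe.1 he)
        exact (m2 e).2 ⟨(m1 e).2 ⟨hS (hQA e this.1), fun h => h.2 this.1⟩, this.2⟩)
      (hsub _ fun e he => hQA e (Finset.sdiff_subset he)) mf mg
      (fun _ => zero_le_one) (fun _ _ _ => rfl) Ω
    simpa only [one_mul] using this
  have e7 : avg (annF u) _ Ω = avg (annF u) _ Ω * avg (annF u) _ Ω :=
    avg_prod_mul (Z := annE u) (f := f) (g := g) (S := S \ annE u) (fun e he h => h.2 he) Ω
  have e8 : avg (annF u) (fun Ω => g (Ω ∘ tag S₂)) Ω =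
      avg (annF u) (fun Ω => g (Ω ∘ tag (S \ annE u))) Ω := by
    refine avg_annF_tag (fun e he => ?_) Ω
    have h1 := hQA e
    have h2 := hTQ e
    simp only [Set.mem_sdiff, m2, m1, Finset.mem_coe]
    tauto
  rw [e8, ← e7] at e5
  linarith

end Strip

section Iterate

variable {I O D I' O' D' : Set Vertex} {p : ℝ}

/-- The edges outside the first `k` annuli. -/
def outside (k : ℕ) : Set Edge := {e | ∀ j < k, e ∉ annE (10 * 32 ^ j)}

lemma outside_zero : outside 0 = Set.univ := by
  ext e
  simp [outside]

lemma outside_succ (k : ℕ) : outside (k + 1) = outside k \ annE (10 * 32 ^ k) := by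
  ext e
  simp only [outside, Set.mem_ofPred_eq, Set.mem_sdiff, Finset.mem_coe, Nat.lt_succ_iff_lt_or_eq]
  exact ⟨fun h => ⟨fun j hj => h j (.inl hj), h k (.inr rfl)⟩,
    fun h j hj => hj.elim (h.1 j) fun e => e ▸ h.2⟩

lemma annE_subset_outside (k : ℕ) : ↑(annE (10 * 32 ^ k)) ⊆ outside k := by
  intro e he j hj h
  have h1 := (mem_annE.1 (Finset.mem_coe.1 he)).1
  have h2 := (mem_annE.1 h).2
  have h3 : (32 : ℤ) ^ (j + 1) ≤ 32 ^ k := pow_le_pow_right₀ (by norm_num) hj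
  have h4 : (0 : ℤ) < 32 ^ j := by positivity
  rw [pow_succ] at h3
  omega

theorem avg_strips (hp : CrossBound p) (hp1 : p ^ 34 ≤ 1) {F : Finset (Edge × Bool)} (K : ℕ)
    (hF : ∀ k < K, annF (10 * 32 ^ k) ⊆ F) (hs : ∀ k < K, Spans I O D (10 * 32 ^ k))
    (hs' : ∀ k < K, Spans I' O' D' (10 * 32 ^ k)) (Ω : Edge × Bool → Bool) :
    avg F (fun Ω => ind (Arm I O D) (Ω ∘ tag Set.univ) *
        ind (fun ω => Arm I' O' D' (star ω)) (Ω ∘ tag Set.univ)) Ω ≤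
      (1 - p ^ 34) ^ K * avg F (fun Ω => ind (Arm I O D) (Ω ∘ tag Set.univ) *
        ind (fun ω => Arm I' O' D' (star ω)) (Ω ∘ tag (outside K))) Ω := by
  classical
  induction K with
  | zero => rw [outside_zero, pow_zero, one_mul]
  | succ k ih =>
    refine (ih (fun j hj => hF j (by omega)) (fun j hj => hs j (by omega))
      (fun j hj => hs' j (by omega))).trans ?_
    rw [pow_succ (1 - p ^ 34), mul_assoc]
    refine mul_le_mul_of_nonneg_left ?_ (pow_nonneg (sub_nonneg.2 hp1) _)
    have hsub := hF k (by omega)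
    have h1 : (1 : ℤ) ≤ 32 ^ k := one_le_pow₀ (by norm_num)
    rw [← Finset.sdiff_union_of_subset hsub, avg_union Finset.sdiff_disjoint,
      avg_union Finset.sdiff_disjoint, ← avg_const_mul, outside_succ]
    exact avg_mono (avg_strip hp (by omega) (hs k (by omega)) (hs' k (by omega))
      (annE_subset_outside k)) Ω

/-- The two-arm probability is much smaller than the product of the one-arm probabilities. -/
theorem pr_arms_le (hp : CrossBound p) (hp1 : p ^ 34 ≤ 1) (K : ℕ)
    (hs : ∀ k < K, Spans I O D (10 * 32 ^ k)) (hs' : ∀ k < K, Spans I' O' D' (10 * 32 ^ k))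
    (hA : IsLocal (Arm I O D)) (hA' : IsLocal fun ω => Arm I' O' D' (star ω)) :
    pr (fun ω => Arm I O D ω ∧ Arm I' O' D' (star ω)) ≤
      (1 - p ^ 34) ^ K * (pr (Arm I O D) * pr fun ω => Arm I' O' D' (star ω)) := by
  classical
  obtain ⟨G, hG⟩ := hA
  obtain ⟨G', hG'⟩ := hA'
  set f : Config → ℝ := ind (Arm I O D) with hf
  set g : Config → ℝ := ind fun ω => Arm I' O' D' (star ω) with hg
  set Z : Finset Edge := (G ∪ G') ∪ (Finset.range K).biUnion fun k => annE (10 * 32 ^ k) with hZ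
  have gZ : ∀ e ∈ G, e ∈ Z := fun e he => by simp [hZ, he]
  have gZ' : ∀ e ∈ G', e ∈ Z := fun e he => by simp [hZ, he]
  have aZ : ∀ k < K, ∀ e ∈ annE (10 * 32 ^ k), e ∈ Z := fun k hk e he =>
    Finset.mem_union_right _ (Finset.mem_biUnion.2 ⟨k, Finset.mem_range.2 hk, he⟩)
  set Ω : Edge × Bool → Bool := fun _ => false
  have tz : ∀ {E : Config → Prop} (S : Set Edge), Dep (Z : Set Edge) E →
      avg (Z ×ˢ (Finset.univ : Finset Bool)) (fun Ω => ind E (Ω ∘ tag S)) Ω = pr E := by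
    intro E S hE
    rw [avg_tag (Z := Z) fun e => by simp [tag_fst]]
    exact avg_ind_eq_pr hE _
  have hA : Dep (Z : Set Edge) (Arm I O D) := hG.mono fun e he => gZ e he
  have hA' : Dep (Z : Set Edge) fun ω => Arm I' O' D' (star ω) := hG'.mono fun e he => gZ' e he
  have h1 := avg_strips (F := Z ×ˢ Finset.univ) hp hp1 K
    (fun k hk x hx => Finset.mem_product.2 ⟨aZ k hk _ (mem_annF.1 hx), Finset.mem_univ _⟩)
    hs hs' Ω
  have h2 := avg_unshare (r := fun _ => 1) (S := outside K) (Z := Z.filter (· ∈ outside K))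
    (F := Z ×ˢ Finset.univ) (fun e he => (Finset.mem_filter.1 (Finset.mem_coe.1 he)).2)
    (Finset.product_subset_product_left (Finset.filter_subset _ _))
    (Arm.incr (I := I) (O := O) (D := D).monoOn _)
    ((Incr.star (Arm.incr (I := I') (O := O') (D := D'))).antiOn _)
    (fun _ => zero_le_one) (fun _ _ _ => rfl) Ω
  simp only [one_mul] at h2
  have h3 := avg_prod_mul (Z := Z) (f := f) (g := g)
    (S := outside K \ ↑(Z.filter (· ∈ outside K)))
    (fun e he h => h.2 (Finset.mem_coe.2 (Finset.mem_filter.2 ⟨he, h.1⟩))) Ω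
  rw [tz _ hA, tz _ hA'] at h3
  have h0 : (fun Ω : Edge × Bool → Bool => f (Ω ∘ tag Set.univ) * g (Ω ∘ tag Set.univ)) =
      fun Ω => ind (fun ω => Arm I O D ω ∧ Arm I' O' D' (star ω)) (Ω ∘ tag Set.univ) := by
    funext Ω
    rw [hf, hg, ind_and]
  rw [h0, tz _ (hA.and hA')] at h1
  exact h1.trans (mul_le_mul_of_nonneg_left (h2.trans h3.le) (pow_nonneg (sub_nonneg.2 hp1) _))

end Iterate

section Exponents

variable {μ : Measure Config} {p : ℝ}

lemma measurableSet_cylinder (F : Finset Edge) (b : Config) :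
    MeasurableSet {ω : Config | ∀ e ∈ F, ω e = b e} := by
  have : {ω : Config | ∀ e ∈ F, ω e = b e} = ⋂ e ∈ F, (fun ω : Config => ω e) ⁻¹' {b e} := by
    ext ω
    simp
  rw [this]
  exact F.measurableSet_biInter fun e _ => measurable_pi_apply e (measurableSet_singleton _)

/-- Under the Bernoulli law, local events have their elementary probability. -/
theorem measure_eq_pr (hμ : IsBernoulliHalf μ) {E : Config → Prop} (hE : IsLocal E) :
    (μ {ω | E ω}).toReal = pr E := by
  classical
  obtain ⟨F, hF⟩ := hE
  have h1 : {ω | E ω} = ⋃ s ∈ F.powerset.filter fun s => E fun e => decide (e ∈ s),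
      {ω : Config | ∀ e ∈ F, ω e = decide (e ∈ s)} := by
    ext ω
    simp only [Set.mem_ofPred_eq, Set.mem_iUnion, Finset.mem_filter, Finset.mem_powerset,
      exists_prop]
    constructor
    · intro h
      refine ⟨F.filter fun e => ω e = true, ⟨Finset.filter_subset _ _, ?_⟩, fun e he => ?_⟩
      · refine hF ω _ (fun e he => ?_) h
        simp [Finset.mem_coe.1 he]
      · simp [he]
    · rintro ⟨s, ⟨_, h⟩, hs⟩
      exact hF _ ω (fun e he => (hs e he).symm) h
  have h2 : (F.powerset.filter fun s => E fun e => decide (e ∈ s) :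
      Set (Finset Edge)).PairwiseDisjoint
      fun s => {ω : Config | ∀ e ∈ F, ω e = decide (e ∈ s)} := by
    intro s hs t ht hst
    refine Set.disjoint_left.2 fun ω h h' => hst ?_
    simp only [Finset.coe_filter, Finset.mem_powerset, Set.mem_ofPred_eq] at hs ht
    ext e
    by_cases he : e ∈ F
    · exact decide_eq_decide.1 ((h e he).symm.trans (h' e he))
    · exact ⟨fun h => absurd (hs.1 h) he, fun h => absurd (ht.1 h) he⟩
  rw [h1, measure_biUnion_finset h2 fun s _ => measurableSet_cylinder F _,
    Finset.sum_congr rfl fun s _ => hμ.2 F fun e => decide (e ∈ s), Finset.sum_const,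
    ← avg_ind_eq_pr hF fun _ => false, avg]
  have h3 : ∀ s ∈ F.powerset, ind E (fun i => if i ∈ F then decide (i ∈ s) else false) =
      if E fun e => decide (e ∈ s) then 1 else 0 := by
    intro s hs
    have : (fun i => if i ∈ F then decide (i ∈ s) else false) = fun i => decide (i ∈ s) := by
      funext i
      by_cases hi : i ∈ s
      · simp [hi, Finset.mem_powerset.1 hs hi]
      · simp [hi]
    rw [this, ind]
  rw [Finset.sum_congr rfl h3, Finset.sum_boole, nsmul_eq_mul, ENNReal.toReal_mul]
  simp [div_eq_mul_inv]

lemma isLocal_Arm {I O D : Set Vertex} {n : ℤ} (h : ∀ z ∈ D, vnorm z ≤ n) :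
    IsLocal (Arm I O D) :=
  (dep_Arm.mono (loc_mono fun z hz => by
    have := vnorm_le.1 (h z hz)
    exact mem_Box.2 ⟨this.1, this.2.1, this.2.2.1, this.2.2.2⟩ :
      loc D ⊆ loc (Box (-n) n (-n) n))).isLocal

lemma A1_eq (R : ℤ) (hR : 1 ≤ R) : A1 1 R =
    {ω | Arm {x | vnorm x = 1} {y | vnorm y = R} {z | 1 ≤ vnorm z ∧ vnorm z ≤ R} ω} := by
  ext ω
  constructor
  · rintro ⟨x, y, hx, hy, h⟩
    exact ⟨x, hx, y, hy, ⟨hx.ge, by rw [hx]; exact hR⟩, h⟩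
  · rintro ⟨x, hx, y, hy, _, h⟩
    exact ⟨x, y, hx, hy, h⟩

lemma dnorm2_le {k : ℤ} {z : Vertex} : dnorm2 z ≤ k ↔
    -k ≤ 2 * z.1 + 1 ∧ 2 * z.1 + 1 ≤ k ∧ -k ≤ 2 * z.2 + 1 ∧ 2 * z.2 + 1 ≤ k := by
  simp only [dnorm2, max_le_iff, abs_le]; tauto

lemma le_dnorm2 {k : ℤ} {z : Vertex} : k ≤ dnorm2 z ↔
    2 * z.1 + 1 ≤ -k ∨ k ≤ 2 * z.1 + 1 ∨ 2 * z.2 + 1 ≤ -k ∨ k ≤ 2 * z.2 + 1 := by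
  simp only [dnorm2, le_max_iff, le_abs]; omega

lemma A0_eq (R : ℤ) (hR : 1 ≤ R) : A0 1 R =
    {ω | Arm {x | dnorm2 x ≤ 3} {y | 2 * R - 1 ≤ dnorm2 y}
      {z | 1 ≤ dnorm2 z ∧ dnorm2 z ≤ 2 * R + 1} (star ω)} := by
  ext ω
  constructor
  · rintro ⟨x, y, hx, hy, h⟩
    rw [dualAdj_eq_star] at h
    exact ⟨x, hx, y, hy, ⟨le_dnorm2.2 (by omega), hx.trans (by omega)⟩, h⟩
  · rintro ⟨x, hx, y, hy, _, h⟩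
    refine ⟨x, y, hx, hy, ?_⟩
    rw [dualAdj_eq_star]
    exact h

lemma spans_primal {R u : ℤ} (hu : 1 ≤ u) (hR : 30 * u + 1 ≤ R) :
    Spans {x | vnorm x = 1} {y | vnorm y = R} {z | 1 ≤ vnorm z ∧ vnorm z ≤ R} u where
  inner x hx := by
    have : vnorm x = 1 := hx
    omega
  outer y hy := by
    have : vnorm y = R := hy
    omega
  mid z h h' := ⟨by omega, by omega⟩

lemma spans_dual {R u : ℤ} (hu : 1 ≤ u) (hR : 30 * u + 1 ≤ R) :
    Spans {x | dnorm2 x ≤ 3} {y | 2 * R - 1 ≤ dnorm2 y}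
      {z | 1 ≤ dnorm2 z ∧ dnorm2 z ≤ 2 * R + 1} u where
  inner x hx := by
    have := dnorm2_le.1 hx
    rw [vnorm_le]
    omega
  outer y hy := by
    have := le_dnorm2.1 hy
    rw [le_vnorm]
    omega
  mid z _ h' := by
    rw [vnorm_le] at h'
    exact ⟨le_dnorm2.2 (by omega), dnorm2_le.2 (by omega)⟩

/-- Quantitative failure of independence of the two arms across `K` scales. -/
theorem measure_A01_le (hμ : IsBernoulliHalf μ) (hp : CrossBound p) (hp1 : p ^ 34 ≤ 1) (K : ℕ)
    (R : ℤ) (hR : 32 ^ (K + 1) ≤ R) :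
    (μ (A01 1 R)).toReal ≤
      (1 - p ^ 34) ^ K * ((μ (A1 1 R)).toReal * (μ (A0 1 R)).toReal) := by
  have hR1 : 1 ≤ R := (one_le_pow₀ (by norm_num)).trans hR
  have hk : ∀ k < K, (1 : ℤ) ≤ 10 * 32 ^ k ∧ 30 * (10 * 32 ^ k) + 1 ≤ R := by
    intro k hk
    have h1 : (1 : ℤ) ≤ 32 ^ k := one_le_pow₀ (by norm_num)
    have h2 : (32 : ℤ) ^ (k + 2) ≤ 32 ^ (K + 1) := pow_le_pow_right₀ (by norm_num) (by omega)
    rw [pow_add] at h2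
    omega
  have l1 : IsLocal (Arm {x | vnorm x = 1} {y | vnorm y = R} {z | 1 ≤ vnorm z ∧ vnorm z ≤ R}) :=
    isLocal_Arm fun z hz => hz.2
  have l0 : IsLocal fun ω => Arm {x | dnorm2 x ≤ 3} {y | 2 * R - 1 ≤ dnorm2 y}
      {z | 1 ≤ dnorm2 z ∧ dnorm2 z ≤ 2 * R + 1} (star ω) :=
    IsLocal.star (isLocal_Arm (n := R + 1) fun z hz => by
      have := dnorm2_le.1 hz.2
      rw [vnorm_le]
      omega)
  have h01 : A01 1 R = {ω | Arm {x | vnorm x = 1} {y | vnorm y = R}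
      {z | 1 ≤ vnorm z ∧ vnorm z ≤ R} ω ∧ Arm {x | dnorm2 x ≤ 3} {y | 2 * R - 1 ≤ dnorm2 y}
      {z | 1 ≤ dnorm2 z ∧ dnorm2 z ≤ 2 * R + 1} (star ω)} := by
    rw [A01, A1_eq R hR1, A0_eq R hR1, Set.inter_comm]
    rfl
  rw [h01, A1_eq R hR1, A0_eq R hR1, measure_eq_pr hμ (l1.and l0), measure_eq_pr hμ l1,
    measure_eq_pr hμ l0]
  exact pr_arms_le hp hp1 K (fun k h => spans_primal (hk k h).1 (hk k h).2)
    (fun k h => spans_dual (hk k h).1 (hk k h).2) l1 l0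

lemma exists_crossBound : ∃ p : ℝ, CrossBound p ∧ p < 1 := by
  obtain ⟨c, hc, h⟩ := rsw 60
  exact ⟨min c (1 / 2), ⟨lt_min hc (by norm_num), fun w h' h1 h2 h3 =>
    (min_le_left _ _).trans (h w h' h1 h2 (by exact_mod_cast h3))⟩,
    (min_le_right _ _).trans_lt (by norm_num)⟩

end Exponents

end FKArm

open FKArm Filter in
/-- If the one-arm primal, one-arm dual and alternating two-arm exponents exist
for critical Bernoulli bond percolation on `ℤ²`, then `α_01 > α_0 + α_1`. -/
theorem arm_exponents_strict_inequality_Bernoulli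
    (μ : MeasureTheory.Measure Config) (hμ : IsBernoulliHalf μ)
    (hpos : ∀ R : ℕ, 2 ≤ R → 0 < μ (A01 1 R))
    (α0 α1 α01 : ℝ)
    (h1 : Tendsto (fun R : ℕ => -Real.log (μ (A1 1 R)).toReal / Real.log R)
      atTop (nhds α1))
    (h0 : Tendsto (fun R : ℕ => -Real.log (μ (A0 1 R)).toReal / Real.log R)
      atTop (nhds α0))
    (h01 : Tendsto (fun R : ℕ => -Real.log (μ (A01 1 R)).toReal / Real.log R)
      atTop (nhds α01)) :
    α0 + α1 < α01 := by
  have := hμ.1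
  obtain ⟨p, hp, hp1⟩ := exists_crossBound
  have c0 : 0 < p ^ 34 := pow_pos hp.1 _
  have c1 : p ^ 34 < 1 := pow_lt_one₀ hp.1.le hp1 (by norm_num)
  have hl : Real.log (1 - p ^ 34) < 0 := Real.log_neg (by linarith) (by linarith)
  have hlog : 0 < Real.log 32 := Real.log_pos (by norm_num)
  set d := -Real.log (1 - p ^ 34) / (2 * Real.log 32) with hd
  have hd0 : 0 < d := div_pos (by linarith) (by linarith)
  have hr : Tendsto (fun K : ℕ => 32 ^ (K + 1)) atTop atTop :=
    (tendsto_pow_atTop_atTop_of_one_lt (by norm_num : 1 < 32)).comp (tendsto_add_atTop_nat 1)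
  suffices h : α0 + α1 + d ≤ α01 by linarith
  refine le_of_tendsto_of_tendsto ((((h0.add h1).add_const d)).comp hr) (h01.comp hr)
    (Filter.eventually_atTop.2 ⟨1, fun K hK => ?_⟩)
  simp only [Function.comp]
  have hR2 : 2 ≤ 32 ^ (K + 1) := by
    rw [pow_succ]
    have := Nat.one_le_pow K 32 (by norm_num)
    omega
  have main := measure_A01_le hμ hp c1.le K ((32 ^ (K + 1) : ℕ) : ℤ) (by push_cast; rfl)
  have pos := hpos _ hR2
  set R := 32 ^ (K + 1) with hR
  have q01 : 0 < (μ (A01 1 R)).toReal := ENNReal.toReal_pos pos.ne' (measure_ne_top _ _)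
  have q1 : 0 < (μ (A1 1 R)).toReal := ENNReal.toReal_pos
    (pos.trans_le (measure_mono Set.inter_subset_right)).ne' (measure_ne_top _ _)
  have q0 : 0 < (μ (A0 1 R)).toReal := ENNReal.toReal_pos
    (pos.trans_le (measure_mono Set.inter_subset_left)).ne' (measure_ne_top _ _)
  have hm := Real.log_le_log q01 main
  have hq : 0 < (1 - p ^ 34) ^ K := pow_pos (by linarith) _
  rw [Real.log_mul hq.ne' (mul_pos q1 q0).ne', Real.log_mul q1.ne' q0.ne', Real.log_pow] at hm
  have hRl : Real.log (R : ℝ) = (K + 1) * Real.log 32 := by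
    rw [hR]
    push_cast
    rw [Real.log_pow]
    push_cast
    rfl
  have hK' : (1 : ℝ) ≤ K := by exact_mod_cast hK
  have hdl : d * Real.log R ≤ -(K * Real.log (1 - p ^ 34)) := by
    have e : d * Real.log R = (K + 1) / 2 * -Real.log (1 - p ^ 34) := by
      rw [hRl, hd]
      field_simp
    rw [e]
    nlinarith
  have hRp : 0 < Real.log (R : ℝ) := by
    rw [hRl]
    positivity
  rw [← add_div, div_add' _ _ _ hRp.ne', div_le_div_iff_of_pos_right hRp]
  linarith
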